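/- arXiv:2108.11639 — 2 statements merged into one kernel-verified Lean document; each statement's English description precedes it below -/
import Mathlib

section
/- Let $(M,g)$ be a smooth Riemannian manifold of dimension $2n+1$ with Levi-Civita connection $\nabla$, curvature tensor $R(X,Y)Z=\nabla_X\nabla_YZ-\nabla_Y\nabla_XZ-\nabla_{[X,Y]}Z$, Ricci tensor $S(Y,Z)=\operatorname{tr}\big(X\mapsto R(X,Y)Z\big)$ and scalar curvature $r=\operatorname{tr}_g S$. Let $\varphi$ be a smooth $(1,1)$-tensor field, $\xi$ a smooth vector field and $\eta$ a smooth $1$-form on $M$ such that $(M,g,\varphi,\xi,\eta)$ is a Kenmotsu manifold, that is, for all vector fields $X,Y$, $$\varphi^2=-I+\eta\otimes\xi,\qquad \eta(\xi)=1,\qquad \eta(X)=g(X,\xi),\qquad g(\varphi X,\varphi Y)=g(X,Y)-\eta(X)\eta(Y),$$ $$(\nabla_X\varphi)Y=g(\varphi X,Y)\,\xi-\eta(Y)\,\varphi X .$$ Suppose that $(g,V,\lambda,\mu)$ is a conformal $\eta$-Ricci soliton on $M$ with conformal pressure $p$, that is, $V$ is a smooth vector field, $\lambda,\mu,p$ are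 real constants, and $$\mathcal L_Vg+2S+\Big[2\lambda-\Big(p+\frac{2}{2n+1}\Big)\Big]g+2\mu\,\eta\otimes\eta=0 .$$ Then the Lie derivative of the Ricci tensor along $V$ satisfies $$(\mathcal L_VS)(Y,\xi)=(\xi r)\,\eta(Y)-(Yr)$$ for every smooth vector field $Y$ on $M$, where $Xr$ denotes the derivative of $r$ along a vector field $X$. -/
open Bundle FiberBundle VectorField
open scoped Manifold ContDiff

namespace Riem

noncomputable section

variable {E : Type*} [NormedAddCommGroup E] [NormedSpace ℝ E]
  {H : Type*} [TopologicalSpace H] {I : ModelWithCorners ℝ E H}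
  {M : Type*} [TopologicalSpace M] [ChartedSpace H M]

/-- The derivative `X f` of a function `f` along a vector field `X`. -/
def dirDeriv (X : Π x : M, TangentSpace I x) (f : M → ℝ) (x : M) : ℝ := d% f x (X x)

/-- The Lie derivative along `V` of a `(0,2)`-tensor field `T`, evaluated on the vector fields
`X`, `Y`: `(L_V T)(X, Y) = V (T(X, Y)) - T([V, X], Y) - T(X, [V, Y])`. -/
def lieDeriv (V : Π x : M, TangentSpace I x)
    (T : Π x : M, TangentSpace I x → TangentSpace I x → ℝ)
    (X Y : Π x : M, TangentSpace I x) (x : M) : ℝ :=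
  dirDeriv V (fun y => T y (X y) (Y y)) x
    - T x (mlieBracket I V X x) (Y x) - T x (X x) (mlieBracket I V Y x)

instance finiteDimensional_tangentSpace [FiniteDimensional ℝ E] (x : M) :
    FiniteDimensional ℝ (TangentSpace I x) :=
  inferInstanceAs (FiniteDimensional ℝ E)

/-- Smoothness of a vector field on `M`. -/
def SmoothVF [IsManifold I ∞ M] (X : Π x : M, TangentSpace I x) : Prop := CMDiff ∞ (T% X)

variable [RiemannianBundle (fun x : M => TangentSpace I x)]

/-- The function `g(X, Y)`, where `g` is the Riemannian metric of `M`. -/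
def met (X Y : Π x : M, TangentSpace I x) (x : M) : ℝ := inner ℝ (X x) (Y x)

/-- The right-hand side of the Koszul formula for `g(∇_X Y, Z)`. -/
def koszul (X Y Z : Π x : M, TangentSpace I x) (x : M) : ℝ :=
  (1 / 2) * (dirDeriv X (met Y Z) x + dirDeriv Y (met Z X) x - dirDeriv Z (met X Y) x
    + met (mlieBracket I X Y) Z x - met (mlieBracket I Y Z) X x + met (mlieBracket I Z X) Y x)

lemma met_comm (X Y : Π x : M, TangentSpace I x) : met X Y = met Y X :=
  funext fun _ => real_inner_comm _ _

section

variable [IsManifold I ∞ M] [IsContMDiffRiemannianBundle I ∞ E (fun x : M => TangentSpace I x)]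
  {X Y Z : Π x : M, TangentSpace I x} {x : M}

lemma mdifferentiableAt_met (hX : MDiffAt (T% X) x) (hY : MDiffAt (T% Y) x) :
    MDiffAt (met X Y) x :=
  MDifferentiableAt.inner_bundle hX hY

variable [FiniteDimensional ℝ E]

lemma koszul_tensorial_right (hX : MDiffAt (T% X) x) (hY : MDiffAt (T% Y) x) :
    TensorialAt I E (koszul X Y · x) x where
  smul {f Z} hf hZ := by
    have e1 : met Y (f • Z) = f * met Y Z := by funext y; simp [met, inner_smul_right]
    have e2 : met (f • Z) X = f * met Z X := by funext y; simp [met, inner_smul_left]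
    simp only [koszul, dirDeriv, e1, e2, mvfderiv_mul hf (mdifferentiableAt_met hY hZ),
      mvfderiv_mul hf (mdifferentiableAt_met hZ hX)]
    simp [met, mlieBracket_smul_right hf hZ, mlieBracket_smul_left hf hZ, inner_smul_left,
      inner_smul_right, inner_add_left]
    rw [real_inner_comm (Z x) (Y x), real_inner_comm (X x) (Z x)]
    ring
  add {Z Z'} hZ hZ' := by
    have e1 : met Y (Z + Z') = met Y Z + met Y Z' := by funext y; simp [met, inner_add_right]
    have e2 : met (Z + Z') X = met Z X + met Z' X := by funext y; simp [met, inner_add_left]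
    simp only [koszul, dirDeriv, e1, e2,
      mvfderiv_add (mdifferentiableAt_met hY hZ) (mdifferentiableAt_met hY hZ'),
      mvfderiv_add (mdifferentiableAt_met hZ hX) (mdifferentiableAt_met hZ' hX)]
    simp [met, mlieBracket_add_right hZ hZ', mlieBracket_add_left hZ hZ',
      inner_add_left, inner_add_right]
    ring

lemma koszul_tensorial_left (hY : MDiffAt (T% Y) x) (hZ : MDiffAt (T% Z) x) :
    TensorialAt I E (koszul · Y Z x) x where
  smul {f X} hf hX := by
    have e1 : met (f • X) Y = f * met X Y := by funext y; simp [met, inner_smul_left]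
    have e2 : met Z (f • X) = f * met Z X := by funext y; simp [met, inner_smul_right]
    simp only [koszul, dirDeriv, e1, e2, mvfderiv_mul hf (mdifferentiableAt_met hX hY),
      mvfderiv_mul hf (mdifferentiableAt_met hZ hX)]
    simp [met, mlieBracket_smul_right hf hX, mlieBracket_smul_left hf hX, inner_smul_left,
      inner_smul_right, inner_add_left]
    rw [real_inner_comm (X x) (Z x)]
    ring
  add {X X'} hX hX' := by
    have e1 : met (X + X') Y = met X Y + met X' Y := by funext y; simp [met, inner_add_left]
    have e2 : met Z (X + X') = met Z X + met Z X' := by funext y; simp [met, inner_add_right]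
    simp only [koszul, dirDeriv, e1, e2,
      mvfderiv_add (mdifferentiableAt_met hX hY) (mdifferentiableAt_met hX' hY),
      mvfderiv_add (mdifferentiableAt_met hZ hX) (mdifferentiableAt_met hZ hX')]
    simp [met, mlieBracket_add_right hX hX', mlieBracket_add_left hX hX',
      inner_add_left, inner_add_right]
    ring

open Classical in
/-- `leviCivitaFun Y x (X x)` is the vector `(∇_X Y)(x)` determined by the Koszul formula
`g(∇_X Y, Z) = koszul X Y Z`, for `Y` differentiable at `x`, see `inner_leviCivitaFun`. -/
def leviCivitaFun (Y : Π x : M, TangentSpace I x) (x : M) :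
    TangentSpace I x →L[ℝ] TangentSpace I x :=
  if hY : MDiffAt (T% Y) x then
    ∑ i, ((TensorialAt.mkHom₂ (koszul · Y · x) x (fun _ hZ => koszul_tensorial_left hY hZ)
      (fun _ hX => koszul_tensorial_right hX hY)).flip
        (stdOrthonormalBasis ℝ (TangentSpace I x) i)).smulRight
        (stdOrthonormalBasis ℝ (TangentSpace I x) i)
  else 0

lemma inner_leviCivitaFun (hX : MDiffAt (T% X) x) (hY : MDiffAt (T% Y) x)
    (hZ : MDiffAt (T% Z) x) :
    inner ℝ (leviCivitaFun Y x (X x)) (Z x) = koszul X Y Z x := by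
  rw [leviCivitaFun, dif_pos hY]
  set B := TensorialAt.mkHom₂ (koszul · Y · x) x (fun _ hZ => koszul_tensorial_left hY hZ)
      (fun _ hX => koszul_tensorial_right hX hY) with hB
  have : koszul X Y Z x = B (X x) (Z x) :=
    (TensorialAt.mkHom₂_apply (Φ := (koszul · Y · x)) _ _ hX hZ).symm
  rw [this]
  conv_rhs => rw [← (stdOrthonormalBasis ℝ (TangentSpace I x)).sum_repr (Z x)]
  simp [sum_inner, inner_smul_left, OrthonormalBasis.repr_apply_apply, mul_comm]


lemma koszul_add_mid {Y' : Π x : M, TangentSpace I x} (hX : MDiffAt (T% X) x)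
    (hY : MDiffAt (T% Y) x) (hY' : MDiffAt (T% Y') x) (hZ : MDiffAt (T% Z) x) :
    koszul X (Y + Y') Z x = koszul X Y Z x + koszul X Y' Z x := by
  have e1 : met (Y + Y') Z = met Y Z + met Y' Z := by funext y; simp [met, inner_add_left]
  have e2 : met X (Y + Y') = met X Y + met X Y' := by funext y; simp [met, inner_add_right]
  simp only [koszul, dirDeriv, e1, e2,
    mvfderiv_add (mdifferentiableAt_met hY hZ) (mdifferentiableAt_met hY' hZ),
    mvfderiv_add (mdifferentiableAt_met hX hY) (mdifferentiableAt_met hX hY')]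
  simp [met, mlieBracket_add_right hY hY', mlieBracket_add_left hY hY',
    inner_add_left, inner_add_right]
  ring

lemma koszul_smul_mid {f : M → ℝ} (hf : MDiffAt f x) (hX : MDiffAt (T% X) x)
    (hY : MDiffAt (T% Y) x) (hZ : MDiffAt (T% Z) x) :
    koszul X (f • Y) Z x = f x * koszul X Y Z x + dirDeriv X f x * met Y Z x := by
  have e1 : met (f • Y) Z = f * met Y Z := by funext y; simp [met, inner_smul_left]
  have e2 : met X (f • Y) = f * met X Y := by funext y; simp [met, inner_smul_right]
  simp only [koszul, dirDeriv, e1, e2, mvfderiv_mul hf (mdifferentiableAt_met hY hZ),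
    mvfderiv_mul hf (mdifferentiableAt_met hX hY)]
  simp [met, mlieBracket_smul_right hf hY, mlieBracket_smul_left hf hY, inner_smul_left,
    inner_smul_right, inner_add_left]
  rw [real_inner_comm (X x) (Y x)]
  ring

variable (I M) in
/-- The Levi-Civita connection of the Riemannian manifold `M`. In Mathlib's convention for
covariant derivatives, `leviCivita I M Y x (X x)` is `(∇_X Y)(x)`. -/
def leviCivita : CovariantDerivative I E (fun x : M => TangentSpace I x) where
  toFun := leviCivitaFun
  isCovariantDerivativeOnUniv :=
    { add := by
        intro Y Y' x hY hY' _
        ext1 u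
        refine ext_inner_right ℝ fun w => ?_
        have hu := mdifferentiableAt_extend I E u
        have hw := mdifferentiableAt_extend I E w
        have h1 := inner_leviCivitaFun hu (mdifferentiableAt_add_section hY hY') hw
        rw [koszul_add_mid hu hY hY' hw, ← inner_leviCivitaFun hu hY hw,
          ← inner_leviCivitaFun hu hY' hw, ← inner_add_left] at h1
        simpa using h1
      leibniz := by
        intro Y f x hY hf _
        ext1 u
        refine ext_inner_right ℝ fun w => ?_
        have hu := mdifferentiableAt_extend I E u
        have hw := mdifferentiableAt_extend I E w
        have h1 := inner_leviCivitaFun hu (hf.smul_section hY) hw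
        have h2 := koszul_smul_mid hf hu hY hw
        rw [← inner_leviCivitaFun hu hY hw] at h2
        have h3 := h1.trans h2
        simp only [dirDeriv, met, extend_apply_self] at h3
        simpa [inner_add_left, inner_smul_left] using h3 }

/-- The Levi-Civita connection is torsion free. -/
theorem leviCivita_torsion : (leviCivita I M).torsion = 0 := by
  rw [CovariantDerivative.torsion_eq_zero_iff]
  intro X Y x hX hY
  refine ext_inner_right ℝ fun w => ?_
  have hw := mdifferentiableAt_extend I E w
  have h1 := inner_leviCivitaFun hX hY hw
  have h2 := inner_leviCivitaFun hY hX hw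
  simp only [koszul, met_comm Y X, met_comm (extend E w), mlieBracket_swap (V := extend E w),
    mlieBracket_swap (V := Y) (W := X)] at h1 h2
  simp only [met, extend_apply_self, Pi.neg_apply, inner_neg_left] at h1 h2
  have : inner ℝ (leviCivitaFun Y x (X x) - leviCivitaFun X x (Y x)) w
      = inner ℝ (mlieBracket I X Y x) w := by
    rw [inner_sub_left, h1, h2]
    ring
  exact this

/-- The Levi-Civita connection is metric. -/
theorem leviCivita_metric (hX : MDiffAt (T% X) x) (hY : MDiffAt (T% Y) x)
    (hZ : MDiffAt (T% Z) x) :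
    dirDeriv X (met Y Z) x =
      inner ℝ (leviCivita I M Y x (X x)) (Z x) + inner ℝ (Y x) (leviCivita I M Z x (X x)) := by
  have h1 := inner_leviCivitaFun hX hY hZ
  have h2 := inner_leviCivitaFun hX hZ hY
  rw [← real_inner_comm (Y x)]
  change _ = inner ℝ (leviCivitaFun Y x (X x)) (Z x) + inner ℝ (leviCivitaFun Z x (X x)) (Y x)
  rw [h1, h2]
  simp only [koszul, met_comm Z Y, met_comm Z X, met_comm Y X, mlieBracket_swap (V := Z),
    mlieBracket_swap (V := Y) (W := X)]
  simp only [met, Pi.neg_apply, inner_neg_left]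
  ring

/-- The covariant derivative `∇_X Y` of vector fields, for the Levi-Civita connection. -/
def nabla (X Y : Π x : M, TangentSpace I x) (x : M) : TangentSpace I x :=
  leviCivita I M Y x (X x)

/-- The curvature of vector fields, `R(X, Y)Z = ∇_X ∇_Y Z - ∇_Y ∇_X Z - ∇_[X, Y] Z`. -/
def curvatureField (X Y Z : Π x : M, TangentSpace I x) (x : M) : TangentSpace I x :=
  nabla X (nabla Y Z) x - nabla Y (nabla X Z) x - nabla (mlieBracket I X Y) Z x

/-- The curvature tensor `R(u, v)w` at a point `x`: the value at `x` of `R(X, Y)Z` for vector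
fields `X`, `Y`, `Z` that are smooth near `x` and extend the tangent vectors `u`, `v`, `w`. -/
def curvature (x : M) (u v w : TangentSpace I x) : TangentSpace I x :=
  curvatureField (extend E u) (extend E v) (extend E w) x

/-- The Ricci tensor: `S(v, w)` is the trace of `u ↦ R(u, v)w`, computed in an orthonormal basis
of the tangent space. -/
def ricci (x : M) (v w : TangentSpace I x) : ℝ :=
  ∑ i, inner ℝ (curvature x (stdOrthonormalBasis ℝ (TangentSpace I x) i) v w)
    (stdOrthonormalBasis ℝ (TangentSpace I x) i)

variable (I) in
/-- The scalar curvature: the trace of the Ricci tensor with respect to the metric. -/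
def scalarCurvature (x : M) : ℝ :=
  ∑ i, ricci x (stdOrthonormalBasis ℝ (TangentSpace I x) i)
    (stdOrthonormalBasis ℝ (TangentSpace I x) i)

/-- `(φ, ξ, η)` is a smooth almost contact structure on `M` compatible with the metric. -/
structure IsAlmostContactMetric (φ : Π x : M, TangentSpace I x →L[ℝ] TangentSpace I x)
    (ξ : Π x : M, TangentSpace I x) (η : Π x : M, TangentSpace I x →L[ℝ] ℝ) : Prop where
  smooth_phi : ContMDiff I (I.prod 𝓘(ℝ, E →L[ℝ] E)) ∞
    (fun x => TotalSpace.mk' (E →L[ℝ] E) (E := fun x : M => TangentSpace I x →L[ℝ] TangentSpace I x)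
      x (φ x))
  smooth_xi : SmoothVF ξ
  smooth_eta : ContMDiff I (I.prod 𝓘(ℝ, E →L[ℝ] ℝ)) ∞
    (fun x => TotalSpace.mk' (E →L[ℝ] ℝ) (E := fun x : M => TangentSpace I x →L[ℝ] Trivial M ℝ x)
      x (η x))
  phi_phi : ∀ (x : M) (u : TangentSpace I x), φ x (φ x u) = -u + η x u • ξ x
  eta_xi : ∀ x : M, η x (ξ x) = 1
  eta_eq : ∀ (x : M) (u : TangentSpace I x), η x u = inner ℝ u (ξ x)
  inner_phi : ∀ (x : M) (u v : TangentSpace I x),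
    inner ℝ (φ x u) (φ x v) = inner ℝ u v - η x u * η x v

/-- The almost contact metric manifold `(M, g, φ, ξ, η)` is a Kenmotsu manifold:
`(∇_X φ)Y = g(φX, Y)ξ - η(Y)φX`, where `(∇_X φ)Y = ∇_X (φY) - φ(∇_X Y)`. -/
structure IsKenmotsu (φ : Π x : M, TangentSpace I x →L[ℝ] TangentSpace I x)
    (ξ : Π x : M, TangentSpace I x) (η : Π x : M, TangentSpace I x →L[ℝ] ℝ) : Prop
    extends IsAlmostContactMetric φ ξ η where
  nabla_phi : ∀ X Y : Π x : M, TangentSpace I x, SmoothVF X → SmoothVF Y → ∀ x : M,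
    nabla X (fun y => φ y (Y y)) x - φ x (nabla X Y x)
      = (inner ℝ (φ x (X x)) (Y x) : ℝ) • ξ x - η x (Y x) • φ x (X x)

/-- `(g, V, lam, mu)` is a conformal `η`-Ricci soliton on `M` with conformal pressure `p`:
`L_V g + 2S + [2 lam - (p + 2 / dim M)] g + 2 mu η ⊗ η = 0`. -/
structure IsConformalEtaRicciSoliton (η : Π x : M, TangentSpace I x →L[ℝ] ℝ)
    (V : Π x : M, TangentSpace I x) (lam mu p : ℝ) : Prop where
  smooth : SmoothVF V
  soliton_eq : ∀ X Y : Π x : M, TangentSpace I x, SmoothVF X → SmoothVF Y → ∀ x : M,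
    lieDeriv V (fun _ u v => inner ℝ u v) X Y x + 2 * ricci x (X x) (Y x)
      + (2 * lam - (p + 2 / (Module.finrank ℝ E : ℝ))) * inner ℝ (X x) (Y x)
      + 2 * mu * (η x (X x) * η x (Y x)) = 0

end

end

end Riem

/-- An algebraic model of the vector fields on a Riemannian manifold: a module `L` over a
commutative ring `R`, whose elements act on `R` by derivations `D`, with a symmetric nondegenerate
form `g` and a metric torsion-free connection `nab`. The Lie bracket is
`nab X Y - nab Y X`. -/
structure RiemannianLieRinehart (R L : Type*) [CommRing R] [AddCommGroup L] [Module R L] where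
  D : L → R → R
  nab : L → L → L
  g : L → L → R
  D_add_left : ∀ X Y f, D (X + Y) f = D X f + D Y f
  D_smul_left : ∀ (h : R) X f, D (h • X) f = h * D X f
  D_add : ∀ X f h, D X (f + h) = D X f + D X h
  D_mul : ∀ X f h, D X (f * h) = D X f * h + f * D X h
  nab_add_left : ∀ X Y Z, nab (X + Y) Z = nab X Z + nab Y Z
  nab_smul_left : ∀ (h : R) X Z, nab (h • X) Z = h • nab X Z
  nab_add : ∀ X Y Z, nab X (Y + Z) = nab X Y + nab X Z
  nab_smul : ∀ X (f : R) Y, nab X (f • Y) = D X f • Y + f • nab X Y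
  g_comm : ∀ X Y, g X Y = g Y X
  g_add_left : ∀ X Y Z, g (X + Y) Z = g X Z + g Y Z
  g_smul_left : ∀ (h : R) X Z, g (h • X) Z = h * g X Z
  two_cancel : ∀ f : R, 2 * f = 0 → f = 0
  g_nondeg : ∀ X, (∀ Z, g X Z = 0) → X = 0
  metric : ∀ X Y Z, D X (g Y Z) = g (nab X Y) Z + g Y (nab X Z)
  D_lie : ∀ X Y f, D (nab X Y - nab Y X) f = D X (D Y f) - D Y (D X f)
  jacobi : ∀ X Y Z, nab X (nab Y Z - nab Z Y) - nab (nab Y Z - nab Z Y) X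
    = (nab (nab X Y - nab Y X) Z - nab Z (nab X Y - nab Y X))
      + (nab Y (nab X Z - nab Z X) - nab (nab X Z - nab Z X) Y)

namespace RiemannianLieRinehart

variable {R L : Type*} [CommRing R] [AddCommGroup L] [Module R L]
  (G : RiemannianLieRinehart R L)

/-- The Lie bracket. -/
def br (X Y : L) : L := G.nab X Y - G.nab Y X

/-- The curvature. -/
def K (X Y Z : L) : L := G.nab X (G.nab Y Z) - G.nab Y (G.nab X Z) - G.nab (G.br X Y) Z

/-- The covariant derivative of the curvature. -/
def dK (W X Y Z : L) : L :=
  G.nab W (G.K X Y Z) - G.K (G.nab W X) Y Z - G.K X (G.nab W Y) Z - G.K X Y (G.nab W Z)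

/-- The covariant derivative of a `(0,2)`-tensor. -/
def dT (T : L → L → R) (W X Y : L) : R := G.D W (T X Y) - T (G.nab W X) Y - T X (G.nab W Y)

/-- The Lie derivative of a `(0,2)`-tensor. -/
def lie (V : L) (T : L → L → R) (X Y : L) : R :=
  G.D V (T X Y) - T (G.br V X) Y - T X (G.br V Y)

lemma D_one (X : L) : G.D X 1 = 0 := by
  simpa using G.D_mul X 1 1

lemma D_zero (X : L) : G.D X 0 = 0 := by
  simpa using G.D_add X 0 0

lemma D_neg (X : L) (f : R) : G.D X (-f) = -G.D X f :=
  eq_neg_of_add_eq_zero_left (by rw [← D_add, neg_add_cancel, D_zero])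

lemma D_sub (X : L) (f h : R) : G.D X (f - h) = G.D X f - G.D X h := by
  rw [sub_eq_add_neg, D_add, D_neg, sub_eq_add_neg]

lemma D_natCast (X : L) (n : ℕ) : G.D X (n : R) = 0 := by
  induction n with
  | zero => simp [D_zero]
  | succ n ih => rw [Nat.cast_succ, D_add, ih, D_one, add_zero]

lemma D_sum {ι : Type*} (s : Finset ι) (X : L) (f : ι → R) :
    G.D X (∑ i ∈ s, f i) = ∑ i ∈ s, G.D X (f i) :=
  map_sum (⟨⟨G.D X, G.D_zero X⟩, G.D_add X⟩ : R →+ R) f s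

lemma D_of_br (X Y : L) (f : R) : G.D (G.br X Y) f = G.D X (G.D Y f) - G.D Y (G.D X f) :=
  G.D_lie X Y f

lemma nab_neg_left (X Y : L) : G.nab (-X) Y = -G.nab X Y := by
  simpa using G.nab_smul_left (-1) X Y

lemma nab_sub_left (X Y Z : L) : G.nab (X - Y) Z = G.nab X Z - G.nab Y Z := by
  rw [sub_eq_add_neg, nab_add_left, nab_neg_left, sub_eq_add_neg]

lemma nab_zero_left (X : L) : G.nab 0 X = 0 := by
  simpa using G.nab_smul_left 0 0 X

lemma nab_zero (X : L) : G.nab X 0 = 0 := by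
  simpa using G.nab_add X 0 0

lemma nab_neg (X Y : L) : G.nab X (-Y) = -G.nab X Y :=
  eq_neg_of_add_eq_zero_left (by rw [← nab_add, neg_add_cancel, nab_zero])

lemma nab_sub (X Y Z : L) : G.nab X (Y - Z) = G.nab X Y - G.nab X Z := by
  rw [sub_eq_add_neg, nab_add, nab_neg, sub_eq_add_neg]

lemma g_add (X Y Z : L) : G.g X (Y + Z) = G.g X Y + G.g X Z := by
  rw [G.g_comm, g_add_left, G.g_comm Y, G.g_comm Z]

lemma g_smul (h : R) (X Z : L) : G.g X (h • Z) = h * G.g X Z := by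
  rw [G.g_comm, g_smul_left, G.g_comm]

lemma g_neg_left (X Y : L) : G.g (-X) Y = -G.g X Y := by
  simpa using G.g_smul_left (-1) X Y

lemma g_neg (X Y : L) : G.g X (-Y) = -G.g X Y := by
  simpa using G.g_smul (-1) X Y

lemma g_sub_left (X Y Z : L) : G.g (X - Y) Z = G.g X Z - G.g Y Z := by
  rw [sub_eq_add_neg, g_add_left, g_neg_left, sub_eq_add_neg]

lemma g_sub (X Y Z : L) : G.g X (Y - Z) = G.g X Y - G.g X Z := by
  rw [sub_eq_add_neg, g_add, g_neg, sub_eq_add_neg]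

lemma g_zero_left (X : L) : G.g 0 X = 0 := by
  simpa using G.g_smul_left 0 0 X

lemma ext_g {X Y : L} (h : ∀ Z, G.g X Z = G.g Y Z) : X = Y :=
  sub_eq_zero.1 (G.g_nondeg _ fun Z => by rw [g_sub_left, h, sub_self])

lemma br_swap (X Y : L) : G.br Y X = -G.br X Y := by simp [br]

lemma br_jacobi (X Y Z : L) :
    G.br (G.br X Y) Z + G.br (G.br Y Z) X + G.br (G.br Z X) Y = 0 := by
  have h := G.jacobi X Y Z
  simp only [br, nab_sub, nab_sub_left] at h ⊢
  rw [← sub_eq_zero] at h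
  rw [← neg_eq_zero, ← h]
  abel

lemma K_swap (X Y Z : L) : G.K Y X Z = -G.K X Y Z := by
  simp only [K, G.br_swap X Y, nab_neg_left]
  abel

lemma K_add_left (X X' Y Z : L) : G.K (X + X') Y Z = G.K X Y Z + G.K X' Y Z := by
  simp only [K, br, nab_add_left, nab_add, nab_sub_left]
  abel

lemma K_smul_left (f : R) (X Y Z : L) : G.K (f • X) Y Z = f • G.K X Y Z := by
  simp only [K, br, nab_smul_left, nab_smul, nab_sub_left, nab_add_left]
  module

lemma K_neg_left (X Y Z : L) : G.K (-X) Y Z = -G.K X Y Z := by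
  simpa using G.K_smul_left (-1) X Y Z

lemma K_sub_left (X X' Y Z : L) : G.K (X - X') Y Z = G.K X Y Z - G.K X' Y Z := by
  rw [sub_eq_add_neg, K_add_left, K_neg_left, sub_eq_add_neg]

lemma K_add_mid (X Y Y' Z : L) : G.K X (Y + Y') Z = G.K X Y Z + G.K X Y' Z := by
  rw [G.K_swap (Y + Y') X, K_add_left, G.K_swap X Y, G.K_swap X Y']
  abel

lemma K_smul_mid (f : R) (X Y Z : L) : G.K X (f • Y) Z = f • G.K X Y Z := by
  rw [G.K_swap (f • Y) X, K_smul_left, G.K_swap X Y]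
  module

lemma K_sub_mid (X Y Y' Z : L) : G.K X (Y - Y') Z = G.K X Y Z - G.K X Y' Z := by
  rw [G.K_swap (Y - Y') X, K_sub_left, G.K_swap X Y, G.K_swap X Y']
  abel

lemma K_add_right (X Y Z Z' : L) : G.K X Y (Z + Z') = G.K X Y Z + G.K X Y Z' := by
  simp only [K, nab_add]
  abel

lemma K_smul_right (f : R) (X Y Z : L) : G.K X Y (f • Z) = f • G.K X Y Z := by
  simp only [K, nab_smul, nab_add, D_of_br]
  module

lemma g_K_skew (X Y Z W : L) : G.g (G.K X Y Z) W = -G.g (G.K X Y W) Z := by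
  have h := G.D_of_br X Y (G.g Z W)
  simp only [metric, D_add] at h
  simp only [K, g_sub_left]
  rw [G.g_comm _ Z, G.g_comm _ Z, G.g_comm _ Z]
  linear_combination -h

lemma bianchi_first (X Y Z : L) : G.K X Y Z + G.K Y Z X + G.K Z X Y = 0 := by
  have h := G.br_jacobi X Y Z
  rw [← neg_eq_zero] at h
  rw [← h]
  simp only [K, br, nab_sub, nab_sub_left]
  abel

lemma bianchi_second (W X Y Z : L) : G.dK W X Y Z + G.dK X Y W Z + G.dK Y W X Z = 0 := by
  have h : G.nab (G.br (G.br W X) Y) Z + G.nab (G.br (G.br X Y) W) Z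
      + G.nab (G.br (G.br Y W) X) Z = 0 := by
    rw [← nab_add_left, ← nab_add_left, br_jacobi, nab_zero_left]
  have e : G.dK W X Y Z + G.dK X Y W Z + G.dK Y W X Z
      = (G.nab W (G.K X Y Z) - G.K X Y (G.nab W Z)) + (G.nab X (G.K Y W Z) - G.K Y W (G.nab X Z))
        + (G.nab Y (G.K W X Z) - G.K W X (G.nab Y Z))
        - (G.K (G.br W X) Y Z + G.K (G.br X Y) W Z + G.K (G.br Y W) X Z) := by
    simp only [dK, br, K_sub_left]
    rw [G.K_swap (G.nab W Y) X, G.K_swap (G.nab X W) Y, G.K_swap (G.nab Y X) W]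
    abel
  rw [e, ← h]
  simp only [K, nab_sub]
  abel

lemma dK_swap (W X Y Z : L) : G.dK W Y X Z = -G.dK W X Y Z := by
  simp only [dK, G.K_swap X Y, nab_neg, G.K_swap (G.nab W X) Y, G.K_swap X (G.nab W Y)]
  abel

lemma g_dK_skew (W X Y Z Z' : L) : G.g (G.dK W X Y Z) Z' = -G.g (G.dK W X Y Z') Z := by
  have h := congrArg (G.D W) (G.g_K_skew X Y Z Z')
  simp only [metric, D_neg] at h
  have h1 := G.g_K_skew (G.nab W X) Y Z Z'
  have h2 := G.g_K_skew X (G.nab W Y) Z Z'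
  have h3 := G.g_K_skew X Y Z (G.nab W Z')
  have h4 := G.g_K_skew X Y (G.nab W Z) Z'
  simp only [dK, g_sub_left]
  linear_combination h - h1 - h2 - h3 - h4

/-- A `(0,2)`-tensor. -/
structure IsBilin (T : L → L → R) : Prop where
  add_left : ∀ X X' Y, T (X + X') Y = T X Y + T X' Y
  smul_left : ∀ (f : R) X Y, T (f • X) Y = f * T X Y
  add_right : ∀ X Y Y', T X (Y + Y') = T X Y + T X Y'
  smul_right : ∀ (f : R) X Y, T X (f • Y) = f * T X Y

lemma g_K_pair (X Y Z W : L) : G.g (G.K X Y Z) W = G.g (G.K Z W X) Y := by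
  have b (X Y Z W : L) : G.g (G.K X Y Z) W + G.g (G.K Y Z X) W + G.g (G.K Z X Y) W = 0 := by
    rw [← g_add_left, ← g_add_left, bianchi_first, g_zero_left]
  have s (X Y Z W : L) : G.g (G.K Y X Z) W = -G.g (G.K X Y Z) W := by
    rw [K_swap, g_neg_left]
  have k := G.g_K_skew
  refine sub_eq_zero.1 (G.two_cancel _ ?_)
  linear_combination b Z X Y W - b X Y W Z - b Y W Z X + b W Z X Y + k X Y W Z + k Y W Z X
    - k Z X W Y + s Y Z W X - k Y Z W X - s W X Z Y + k W X Z Y + k W Z Y X - 2 * s Z W X Y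

lemma isBilin_g_K (Y Z : L) : IsBilin (fun X W => G.g (G.K X Y Z) W) where
  add_left X X' W := by rw [K_add_left, g_add_left]
  smul_left f X W := by rw [K_smul_left, g_smul_left]
  add_right X W W' := G.g_add _ _ _
  smul_right f X W := G.g_smul _ _ _

end RiemannianLieRinehart

/-- A family of real points `ev p` of the ring `R` separating its elements, each with an
orthonormal frame `E p` of `L` near `p`, where "near `p`" means after multiplication by `χ p`,
together with the Ricci tensor `S` and the scalar curvature `r`. -/
structure FramedRiemannian (R L : Type*) [CommRing R] [AddCommGroup L] [Module R L]
    (P ι : Type*) [Fintype ι] [DecidableEq ι] extends RiemannianLieRinehart R L where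
  ev : P → R →+* ℝ
  ev_ext : ∀ f h, (∀ p, ev p f = ev p h) → f = h
  χ : P → R
  E : P → ι → L
  ev_χ : ∀ p, ev p (χ p) = 1
  ev_D_χ : ∀ p W, ev p (D W (χ p)) = 0
  orthonormal : ∀ p i j, χ p * g (E p i) (E p j) = if i = j then χ p else 0
  expand : ∀ p X, χ p • X = ∑ i, (χ p * g X (E p i)) • E p i
  S : L → L → R
  r : R
  χ_mul_S : ∀ p Y Z, χ p * S Y Z =
    χ p * ∑ i, g (toRiemannianLieRinehart.K (E p i) Y Z) (E p i)
  χ_mul_r : ∀ p, χ p * r = χ p * ∑ i, S (E p i) (E p i)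

namespace FramedRiemannian

open RiemannianLieRinehart

variable {R L : Type*} [CommRing R] [AddCommGroup L] [Module R L]
  {P ι : Type*} [Fintype ι] [DecidableEq ι] (G : FramedRiemannian R L P ι) (p : P)

lemma ev_congr {a b : R} (h : G.χ p * a = G.χ p * b) : G.ev p a = G.ev p b := by
  simpa [G.ev_χ] using congrArg (G.ev p) h

lemma ev_D_congr {a b : R} (h : G.χ p * a = G.χ p * b) (W : L) :
    G.ev p (G.D W a) = G.ev p (G.D W b) := by
  simpa [G.D_mul, G.ev_D_χ, G.ev_χ] using congrArg (fun f => G.ev p (G.D W f)) h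

lemma ev_g_E (i j : ι) : G.ev p (G.g (G.E p i) (G.E p j)) = if i = j then 1 else 0 := by
  have := congrArg (G.ev p) (G.orthonormal p i j)
  rw [map_mul, G.ev_χ, one_mul] at this
  rw [this]
  split_ifs <;> simp [G.ev_χ]

lemma ev_nab_E_skew (W : L) (i j : ι) :
    G.ev p (G.g (G.nab W (G.E p i)) (G.E p j))
      = -G.ev p (G.g (G.nab W (G.E p j)) (G.E p i)) := by
  have h := G.ev_D_congr p (a := G.g (G.E p i) (G.E p j)) (b := if i = j then 1 else 0)
    (by rw [G.orthonormal]; split_ifs <;> simp) W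
  have h0 : G.D W (if i = j then (1 : R) else 0) = 0 := by
    split_ifs
    · exact G.D_one W
    · exact G.D_zero W
  rw [h0, G.metric, map_add, map_zero, G.g_comm (G.E p i)] at h
  linarith

lemma ev_expand {F : L → R} (hadd : ∀ X Y, F (X + Y) = F X + F Y)
    (hsmul : ∀ (f : R) X, F (f • X) = f * F X) (X : L) :
    G.ev p (F X) = ∑ i, G.ev p (G.g X (G.E p i)) * G.ev p (F (G.E p i)) := by
  let F' : L →ₗ[R] R := ⟨⟨F, hadd⟩, hsmul⟩
  have h := congrArg (fun Y => G.ev p (F' Y)) (G.expand p X)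
  simp only [map_smul, map_sum, smul_eq_mul, map_mul, G.ev_χ, one_mul] at h
  exact h

lemma ev_expand_left {T : L → L → R} (hT : IsBilin T) (X Y : L) :
    G.ev p (T X Y) = ∑ i, G.ev p (G.g X (G.E p i)) * G.ev p (T (G.E p i) Y) :=
  G.ev_expand p (F := fun X => T X Y) (fun _ _ => hT.add_left _ _ _)
    (fun _ _ => hT.smul_left _ _ _) X

lemma ev_expand_right {T : L → L → R} (hT : IsBilin T) (X Y : L) :
    G.ev p (T X Y) = ∑ i, G.ev p (G.g Y (G.E p i)) * G.ev p (T X (G.E p i)) :=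
  G.ev_expand p (F := fun Y => T X Y) (fun _ _ => hT.add_right _ _ _)
    (fun _ _ => hT.smul_right _ _ _) Y

lemma sum_ev_g_mul (X : L) {F : L → R} (hadd : ∀ X Y, F (X + Y) = F X + F Y)
    (hsmul : ∀ (f : R) X, F (f • X) = f * F X) :
    ∑ i, G.ev p (G.g (G.E p i) X) * G.ev p (F (G.E p i)) = G.ev p (F X) := by
  rw [G.ev_expand p hadd hsmul X]
  simp_rw [G.g_comm X]

lemma sum_ev_g_mul_g (X Y : L) :
    ∑ i, G.ev p (G.g (G.E p i) X) * G.ev p (G.g (G.E p i) Y) = G.ev p (G.g X Y) :=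
  G.sum_ev_g_mul p X (F := fun Z => G.g Z Y) (fun _ _ => G.g_add_left _ _ _)
    (fun _ _ => G.g_smul_left _ _ _)

/-- The derivative of the trace of a tensor is the trace of its covariant derivative. -/
lemma ev_D_trace {T : L → L → R} (hT : IsBilin T) {t : R}
    (ht : G.χ p * t = G.χ p * ∑ i, T (G.E p i) (G.E p i)) (W : L) :
    G.ev p (G.D W t) = ∑ i, G.ev p (G.dT T W (G.E p i) (G.E p i)) := by
  have h : ∑ i, (G.ev p (T (G.nab W (G.E p i)) (G.E p i))
      + G.ev p (T (G.E p i) (G.nab W (G.E p i)))) = 0 := by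
    simp_rw [G.ev_expand_left p hT (G.nab W _), G.ev_expand_right p hT _ (G.nab W _)]
    rw [Finset.sum_add_distrib]
    nth_rw 2 [Finset.sum_comm]
    rw [← Finset.sum_add_distrib]
    refine Finset.sum_eq_zero fun i _ => ?_
    rw [← Finset.sum_add_distrib]
    refine Finset.sum_eq_zero fun j _ => ?_
    rw [G.ev_nab_E_skew p W i j]
    ring
  rw [G.ev_D_congr p ht, G.D_sum, map_sum, ← sub_zero (∑ i, G.ev p _), ← h,
    ← Finset.sum_sub_distrib]
  refine Finset.sum_congr rfl fun i _ => ?_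
  simp only [dT, map_sub]
  ring

lemma ev_S (Y Z : L) : G.ev p (G.S Y Z) = ∑ i, G.ev p (G.g (G.K (G.E p i) Y Z) (G.E p i)) := by
  rw [G.ev_congr p (G.χ_mul_S p Y Z), map_sum]

lemma ev_r : G.ev p G.r = ∑ i, G.ev p (G.S (G.E p i) (G.E p i)) := by
  rw [G.ev_congr p (G.χ_mul_r p), map_sum]

lemma S_comm (Y Z : L) : G.S Y Z = G.S Z Y := by
  refine G.ev_ext _ _ fun p => ?_
  rw [ev_S, ev_S]
  refine Finset.sum_congr rfl fun i _ => ?_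
  rw [G.g_K_pair, G.K_swap, G.g_neg_left, G.g_K_skew, neg_neg]

lemma isBilin_S : IsBilin G.S := by
  have h1 (X X' Y : L) : G.S (X + X') Y = G.S X Y + G.S X' Y := by
    refine G.ev_ext _ _ fun p => ?_
    simp only [map_add, ev_S, G.K_add_mid, G.g_add_left, Finset.sum_add_distrib]
  have h2 (f : R) (X Y : L) : G.S (f • X) Y = f * G.S X Y := by
    refine G.ev_ext _ _ fun p => ?_
    simp only [map_mul, ev_S, G.K_smul_mid, G.g_smul_left, Finset.mul_sum]
  exact ⟨h1, h2, fun X Y Y' => by rw [G.S_comm, h1, G.S_comm X, G.S_comm X],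
    fun f X Y => by rw [G.S_comm, h2, G.S_comm X]⟩

lemma ev_dS (W Y Z : L) :
    G.ev p (G.dT G.S W Y Z) = ∑ i, G.ev p (G.g (G.dK W (G.E p i) Y Z) (G.E p i)) := by
  rw [dT, map_sub, map_sub, G.ev_D_trace p (G.isBilin_g_K Y Z) (G.χ_mul_S p Y Z), ev_S, ev_S,
    ← Finset.sum_sub_distrib, ← Finset.sum_sub_distrib]
  refine Finset.sum_congr rfl fun i _ => ?_
  simp only [dT, dK, G.metric, G.g_sub_left, map_sub, map_add]
  ring

lemma ev_D_r (W : L) : G.ev p (G.D W G.r) = ∑ i, G.ev p (G.dT G.S W (G.E p i) (G.E p i)) :=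
  G.ev_D_trace p G.isBilin_S (G.χ_mul_r p) W

/-- The contracted second Bianchi identity. -/
lemma two_mul_sum_ev_dS (Y : L) :
    2 * ∑ i, G.ev p (G.dT G.S (G.E p i) Y (G.E p i)) = G.ev p (G.D Y G.r) := by
  rw [ev_D_r]
  simp only [ev_dS]
  have h (i j : ι) : G.ev p (G.g (G.dK Y (G.E p j) (G.E p i) (G.E p i)) (G.E p j))
      = G.ev p (G.g (G.dK (G.E p j) (G.E p i) Y (G.E p j)) (G.E p i))
        + G.ev p (G.g (G.dK (G.E p i) (G.E p j) Y (G.E p i)) (G.E p j)) := by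
    have b := congrArg (fun Z => G.ev p (G.g Z (G.E p j)))
      (G.bianchi_second Y (G.E p j) (G.E p i) (G.E p i))
    simp only [G.g_add_left, G.g_zero_left, map_add, map_zero] at b
    rw [G.g_dK_skew (G.E p j), G.dK_swap (G.E p i) (G.E p j) Y, G.g_neg_left] at b
    simp only [map_neg] at b
    linarith
  simp_rw [h, Finset.sum_add_distrib]
  rw [Finset.sum_comm (γ := ι), two_mul]

end FramedRiemannian

namespace RiemannianLieRinehart

variable {R L : Type*} [CommRing R] [AddCommGroup L] [Module R L]
  (G : RiemannianLieRinehart R L)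

lemma isBilin_g : IsBilin G.g :=
  ⟨G.g_add_left, G.g_smul_left, G.g_add, G.g_smul⟩

lemma IsBilin.neg_left {T : L → L → R} (hT : IsBilin T) (X Y : L) : T (-X) Y = -T X Y := by
  simpa using hT.smul_left (-1) X Y

lemma IsBilin.sub_left {T : L → L → R} (hT : IsBilin T) (X X' Y : L) :
    T (X - X') Y = T X Y - T X' Y := by
  rw [sub_eq_add_neg, hT.add_left, hT.neg_left, sub_eq_add_neg]

lemma IsBilin.neg_right {T : L → L → R} (hT : IsBilin T) (X Y : L) : T X (-Y) = -T X Y := by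
  simpa using hT.smul_right (-1) X Y

lemma IsBilin.sub_right {T : L → L → R} (hT : IsBilin T) (X Y Y' : L) :
    T X (Y - Y') = T X Y - T X Y' := by
  rw [sub_eq_add_neg, hT.add_right, hT.neg_right, sub_eq_add_neg]

lemma br_br (V W X : L) : G.br (G.br V W) X = G.br V (G.br W X) - G.br W (G.br V X) :=
  eq_sub_of_add_eq (G.jacobi V W X).symm

lemma lie_br {T : L → L → R} (hT : IsBilin T) (V W X Y : L) :
    G.lie (G.br V W) T X Y = G.lie V (G.lie W T) X Y - G.lie W (G.lie V T) X Y := by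
  simp only [lie, br_br, hT.sub_left, hT.sub_right, D_of_br, D_sub]
  ring

lemma lie_eq_dT {T : L → L → R} (hT : IsBilin T) (V X Y : L) :
    G.lie V T X Y = G.dT T V X Y + T (G.nab X V) Y + T X (G.nab Y V) := by
  simp only [lie, dT, br, hT.sub_left, hT.sub_right]
  ring

lemma dT_g (V X Y : L) : G.dT G.g V X Y = 0 := by
  simp only [dT, metric]
  ring

lemma lie_g (V X Y : L) : G.lie V G.g X Y = G.g (G.nab X V) Y + G.g (G.nab Y V) X := by
  rw [G.lie_eq_dT G.isBilin_g, dT_g, G.g_comm X]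
  ring

lemma g_K_eq_dT (X Y Z W : L) :
    G.g (G.K X Y Z) W = G.dT (fun Y W => G.g (G.nab Y Z) W) X Y W
      - G.dT (fun Y W => G.g (G.nab Y Z) W) Y X W := by
  simp only [dT, K, br, metric, g_sub_left, nab_sub_left]
  ring

section Xi

variable {G} {ξ : L}

lemma D_eta (hnab : ∀ X, G.nab X ξ = X - G.g X ξ • ξ)
    (X Y : L) :
    G.D X (G.g Y ξ) = G.g (G.nab X Y) ξ + (G.g X Y - G.g X ξ * G.g Y ξ) := by
  rw [metric, hnab, g_sub, g_smul, G.g_comm Y X]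

lemma D_eta_sub (hnab : ∀ X, G.nab X ξ = X - G.g X ξ • ξ)
    (X Y : L) : G.D X (G.g Y ξ) - G.D Y (G.g X ξ) = G.g (G.br X Y) ξ := by
  rw [D_eta hnab, D_eta hnab, G.g_comm Y X, br, g_sub_left]
  ring

lemma K_xi_right (hnab : ∀ X, G.nab X ξ = X - G.g X ξ • ξ)
    (X Y : L) : G.K X Y ξ = G.g X ξ • Y - G.g Y ξ • X := by
  simp only [K, hnab, nab_sub, nab_smul, D_eta hnab, br, g_sub_left]
  rw [G.g_comm Y X]
  module

lemma K_xi_mid (hnab : ∀ X, G.nab X ξ = X - G.g X ξ • ξ)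
    (Y Z : L) : G.K Y ξ Z = G.g Y Z • ξ - G.g Z ξ • Y := by
  refine G.ext_g fun W => ?_
  rw [g_K_pair, g_K_skew, K_xi_right hnab]
  simp only [g_sub_left, g_smul_left]
  rw [G.g_comm W Y, G.g_comm Z Y, G.g_comm W ξ]
  ring

lemma dK_xi_mid (hnab : ∀ X, G.nab X ξ = X - G.g X ξ • ξ)
    (X Y Z : L) :
    G.dK X Y ξ Z = G.g Y Z • X - G.g X Z • Y - G.K Y X Z := by
  simp only [dK, K_xi_mid hnab, hnab, nab_sub, nab_smul, K_sub_mid, K_smul_mid, D_eta hnab,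
    metric]
  module

lemma dK_xi_left (hnab : ∀ X, G.nab X ξ = X - G.g X ξ • ξ)
    (X Y Z : L) :
    G.dK ξ X Y Z = (-2 : R) • G.K X Y Z - (2 : R) • (G.g Y Z • X - G.g X Z • Y) := by
  have h := G.bianchi_second ξ X Y Z
  rw [dK_xi_mid hnab, G.dK_swap Y X ξ, dK_xi_mid hnab, G.K_swap X Y] at h
  rw [← sub_eq_zero, ← h]
  module

end Xi

end RiemannianLieRinehart

namespace FramedRiemannian

open RiemannianLieRinehart

variable {R L : Type*} [CommRing R] [AddCommGroup L] [Module R L]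
  {P ι : Type*} [Fintype ι] [DecidableEq ι] {G : FramedRiemannian R L P ι}
  {ξ : L}

lemma sum_ev_g_E (p : P) : ∑ i, G.ev p (G.g (G.E p i) (G.E p i)) = Fintype.card ι := by
  simp [ev_g_E]

lemma sum_ev_g_mul_S (p : P) (X Y : L) :
    ∑ i, G.ev p (G.g (G.E p i) X) * G.ev p (G.S Y (G.E p i)) = G.ev p (G.S Y X) :=
  G.sum_ev_g_mul p X (F := fun X => G.S Y X) (fun _ _ => G.isBilin_S.add_right _ _ _)
    (fun _ _ => G.isBilin_S.smul_right _ _ _)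

lemma S_xi (hnab : ∀ X, G.nab X ξ = X - G.g X ξ • ξ)
    (X : L) : G.S X ξ = -((Fintype.card ι : R) - 1) * G.g X ξ := by
  refine G.ev_ext _ _ fun p => ?_
  have h := G.sum_ev_g_mul_g p ξ X
  have h' := sum_ev_g_E (G := G) p
  rw [G.ev_S]
  simp only [K_xi_right hnab, G.g_sub_left, G.g_smul_left, map_sub, map_mul, map_neg, map_natCast,
    map_one, Finset.sum_sub_distrib, ← Finset.mul_sum, h', G.g_comm X (G.E p _), h]
  rw [G.g_comm ξ X]
  ring

lemma dS_xi (hnab : ∀ X, G.nab X ξ = X - G.g X ξ • ξ)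
    (Y Z : L) :
    G.dT G.S ξ Y Z = -2 * G.S Y Z - 2 * ((Fintype.card ι : R) - 1) * G.g Y Z := by
  refine G.ev_ext _ _ fun p => ?_
  have h := G.sum_ev_g_mul_g p Z Y
  have h' := sum_ev_g_E (G := G) p
  rw [G.ev_dS]
  simp only [dK_xi_left hnab, G.g_sub_left, G.g_smul_left, map_sub, map_mul, map_neg, map_natCast,
    map_one, map_ofNat, Finset.sum_sub_distrib, ← Finset.mul_sum, h', G.g_comm Y (G.E p _), h,
    ← G.ev_S]
  rw [G.g_comm Z Y]
  ring

lemma D_xi_r (hnab : ∀ X, G.nab X ξ = X - G.g X ξ • ξ) :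
    G.D ξ G.r = -2 * G.r - 2 * ((Fintype.card ι : R) - 1) * (Fintype.card ι : R) := by
  refine G.ev_ext _ _ fun p => ?_
  rw [G.ev_D_r]
  simp only [dS_xi hnab, map_sub, map_mul, map_neg, map_natCast, map_one, map_ofNat,
    Finset.sum_sub_distrib, ← Finset.mul_sum, sum_ev_g_E, ← G.ev_r]

lemma lie_xi_g (hnab : ∀ X, G.nab X ξ = X - G.g X ξ • ξ)
    (X Y : L) : G.lie ξ G.g X Y = 2 * (G.g X Y - G.g X ξ * G.g Y ξ) := by
  rw [G.lie_g, hnab, hnab, G.g_sub_left, G.g_sub_left, G.g_smul_left, G.g_smul_left, G.g_comm Y X,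
    G.g_comm ξ X, G.g_comm ξ Y]
  ring

lemma lie_xi_S (hnab : ∀ X, G.nab X ξ = X - G.g X ξ • ξ)
    (X Y : L) :
    G.lie ξ G.S X Y = -2 * ((Fintype.card ι : R) - 1) * (G.g X Y - G.g X ξ * G.g Y ξ) := by
  rw [G.lie_eq_dT G.isBilin_S, dS_xi hnab, hnab, hnab, G.isBilin_S.sub_left,
    G.isBilin_S.sub_right, G.isBilin_S.smul_left, G.isBilin_S.smul_right, G.S_comm ξ Y,
    S_xi hnab, S_xi hnab]
  ring

section Soliton

variable {V : L} {c mu : R}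

lemma lie_V_eta (hnab : ∀ X, G.nab X ξ = X - G.g X ξ • ξ) (hξ : G.g ξ ξ = 1)
    (hs : ∀ X Y, G.lie V G.g X Y + 2 * G.S X Y + c * G.g X Y + 2 * mu * (G.g X ξ * G.g Y ξ) = 0)
    (Y : L) :
    G.D V (G.g Y ξ) = G.g (G.br V Y) ξ
      + (2 * ((Fintype.card ι : R) - 1) - c - 2 * mu) * G.g Y ξ + G.g Y (G.br V ξ) := by
  have h := hs Y ξ
  rw [lie, S_xi hnab, hξ] at h
  linear_combination h

lemma g_nab_br_comm (hnab : ∀ X, G.nab X ξ = X - G.g X ξ • ξ) (hξ : G.g ξ ξ = 1)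
    (hc : ∀ X, G.D X c = 0) (hmu : ∀ X, G.D X mu = 0)
    (hs : ∀ X Y, G.lie V G.g X Y + 2 * G.S X Y + c * G.g X Y + 2 * mu * (G.g X ξ * G.g Y ξ) = 0)
    (X W : L) :
    G.g (G.nab X (G.br V ξ)) W = G.g (G.nab W (G.br V ξ)) X := by
  have e (Y : L) : G.g Y (G.br V ξ) = G.D V (G.g Y ξ) - G.g (G.br V Y) ξ
      - (2 * ((Fintype.card ι : R) - 1) - c - 2 * mu) * G.g Y ξ := by
    rw [lie_V_eta hnab hξ hs]
    ring
  have h0 (X : L) : G.D X (2 * ((Fintype.card ι : R) - 1) - c - 2 * mu) = 0 := by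
    have h2 : G.D X 2 = 0 := G.D_natCast X 2
    simp [G.D_mul, G.D_sub, hc, hmu, h2, G.D_natCast, G.D_one]
  have h1 := G.metric X W (G.br V ξ)
  have h2 := G.metric W X (G.br V ξ)
  have h3 := e (G.br X W)
  have h4 : G.g (G.br X W) (G.br V ξ)
      = G.g (G.nab X W) (G.br V ξ) - G.g (G.nab W X) (G.br V ξ) := by
    rw [br, G.g_sub_left]
  rw [e W, G.D_sub, G.D_sub, G.D_mul _ (_ - _), h0] at h1
  rw [e X, G.D_sub, G.D_sub, G.D_mul _ (_ - _), h0] at h2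
  have h5 := congrArg (G.D V) (D_eta_sub hnab X W)
  rw [G.D_sub] at h5
  have h6 := D_eta_sub hnab X W
  have h7 := D_eta_sub hnab (G.br V X) W
  have h8 := D_eta_sub hnab X (G.br V W)
  have h9 : G.g (G.br V (G.br X W)) ξ
      = G.g (G.br (G.br V X) W) ξ + G.g (G.br X (G.br V W)) ξ := by
    rw [← G.g_add_left, G.br_br V X W]
    abel_nf
  have h10 := G.D_of_br V X (G.g W ξ)
  have h11 := G.D_of_br V W (G.g X ξ)
  rw [G.g_comm W (G.nab X (G.br V ξ))] at h1
  rw [G.g_comm X (G.nab W (G.br V ξ))] at h2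
  linear_combination -h1 + h2 + h4 - h3
    - (2 * ((Fintype.card ι : R) - 1) - c - 2 * mu) * h6 + h5 + h10 - h11 - h7 - h8 + h9

lemma g_nab_br (hnab : ∀ X, G.nab X ξ = X - G.g X ξ • ξ) (hξ : G.g ξ ξ = 1)
    (hc : ∀ X, G.D X c = 0) (hmu : ∀ X, G.D X mu = 0)
    (hs : ∀ X Y, G.lie V G.g X Y + 2 * G.S X Y + c * G.g X Y + 2 * mu * (G.g X ξ * G.g Y ξ) = 0)
    (X W : L) :
    G.g (G.nab X (G.br V ξ)) W = -2 * G.S X W - 2 * ((Fintype.card ι : R) - 1) * G.g X W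
      - (2 * ((Fintype.card ι : R) - 1) - c - 2 * mu) * (G.g X ξ * G.g W ξ)
      - G.g X (G.br V ξ) * G.g W ξ - G.g X ξ * G.g W (G.br V ξ) := by
  refine sub_eq_zero.1 (G.two_cancel _ ?_)
  have h := G.lie_g (G.br V ξ) X W
  rw [← g_nab_br_comm hnab hξ hc hmu hs X W, G.lie_br G.isBilin_g] at h
  have e1 : G.lie ξ G.g = fun X Y => 2 * (G.g X Y - G.g X ξ * G.g Y ξ) := by
    funext X Y
    exact lie_xi_g hnab X Y
  have e2 : G.lie V G.g
      = fun X Y => -2 * G.S X Y - c * G.g X Y - 2 * mu * (G.g X ξ * G.g Y ξ) := by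
    funext X Y
    linear_combination hs X Y
  have h2 (X : L) : G.D X 2 = 0 := G.D_natCast X 2
  have l1 : G.lie V (G.lie ξ G.g) X W = 2 * (-2 * G.S X W - c * G.g X W
      - 2 * mu * (G.g X ξ * G.g W ξ)
      - ((2 * ((Fintype.card ι : R) - 1) - c - 2 * mu) * G.g X ξ + G.g X (G.br V ξ)) * G.g W ξ
      - G.g X ξ * ((2 * ((Fintype.card ι : R) - 1) - c - 2 * mu) * G.g W ξ
        + G.g W (G.br V ξ))) := by
    have h3 := hs X W
    have h4 := lie_V_eta hnab hξ hs X
    have h5 := lie_V_eta hnab hξ hs W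
    rw [e1]
    simp only [lie, G.D_mul, G.D_sub, h2] at h3 ⊢
    linear_combination 2 * h3 - 2 * G.g W ξ * h4 - 2 * G.g X ξ * h5
  have l2 : G.lie ξ (G.lie V G.g) X W
      = (4 * ((Fintype.card ι : R) - 1) - 2 * c) * (G.g X W - G.g X ξ * G.g W ξ) := by
    have h3 := lie_xi_S hnab X W
    have h4 := lie_xi_g hnab X W
    have h5 := D_eta hnab ξ X
    have h6 := D_eta hnab ξ W
    have h7 (X : L) : G.g (G.br ξ X) ξ = G.g (G.nab ξ X) ξ - G.g X ξ + G.g X ξ * G.g ξ ξ := by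
      rw [br, G.g_sub_left, hnab, G.g_sub_left, G.g_smul_left]
      ring
    rw [e2]
    simp only [lie, G.D_mul, G.D_sub, h2, hc, hmu, G.D_neg, h7, hξ] at h3 h4 ⊢
    rw [G.g_comm ξ X, hξ] at h5
    rw [G.g_comm ξ W, hξ] at h6
    linear_combination -2 * h3 - c * h4 - 2 * mu * G.g W ξ * h5 - 2 * mu * G.g X ξ * h6
  rw [l1, l2] at h
  linear_combination -h

lemma g_K_br (hnab : ∀ X, G.nab X ξ = X - G.g X ξ • ξ) (hξ : G.g ξ ξ = 1)
    (hc : ∀ X, G.D X c = 0) (hmu : ∀ X, G.D X mu = 0)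
    (hs : ∀ X Y, G.lie V G.g X Y + 2 * G.S X Y + c * G.g X Y + 2 * mu * (G.g X ξ * G.g Y ξ) = 0)
    (X Y W : L) :
    G.g (G.K X Y (G.br V ξ)) W = -2 * (G.dT G.S X Y W - G.dT G.S Y X W)
      + (c + 2 * mu) * (G.g Y ξ * G.g X W - G.g X ξ * G.g Y W)
      + 2 * (G.g Y ξ * G.S X W - G.g X ξ * G.S Y W)
      - G.g Y (G.br V ξ) * G.g X W + G.g X (G.br V ξ) * G.g Y W := by
  rw [G.g_K_eq_dT]
  have e : (fun Y W => G.g (G.nab Y (G.br V ξ)) W) = fun X W =>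
      -2 * G.S X W - 2 * ((Fintype.card ι : R) - 1) * G.g X W
      - (2 * ((Fintype.card ι : R) - 1) - c - 2 * mu) * (G.g X ξ * G.g W ξ)
      - G.g X (G.br V ξ) * G.g W ξ - G.g X ξ * G.g W (G.br V ξ) := by
    funext X W
    exact g_nab_br hnab hξ hc hmu hs X W
  have h2 (X : L) : G.D X 2 = 0 := G.D_natCast X 2
  have k (X Y W : L) : G.dT (fun Y W => G.g (G.nab Y (G.br V ξ)) W) X Y W
      = -2 * G.dT G.S X Y W
        - (2 * ((Fintype.card ι : R) - 1) - c - 2 * mu) * ((G.g X Y - G.g X ξ * G.g Y ξ) * G.g W ξ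
          + G.g Y ξ * (G.g X W - G.g X ξ * G.g W ξ))
        - G.g (G.nab X (G.br V ξ)) Y * G.g W ξ - G.g Y (G.br V ξ) * (G.g X W - G.g X ξ * G.g W ξ)
        - (G.g X Y - G.g X ξ * G.g Y ξ) * G.g W (G.br V ξ)
        - G.g Y ξ * G.g (G.nab X (G.br V ξ)) W := by
    rw [e]
    simp only [dT, G.D_mul, G.D_sub, D_eta hnab, h2, hc, hmu, G.D_neg, G.D_natCast, G.D_one,
      G.metric X _ (G.br V ξ), G.metric X Y W]
    rw [G.g_comm Y (G.nab X (G.br V ξ)), G.g_comm W (G.nab X (G.br V ξ))]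
    ring
  rw [k, k, g_nab_br_comm hnab hξ hc hmu hs Y X, g_nab_br hnab hξ hc hmu hs X W,
    g_nab_br hnab hξ hc hmu hs Y W, G.g_comm Y X]
  ring

/-- The Lie derivative of the Ricci tensor along the potential of a soliton, in the direction of
the characteristic vector field. -/
theorem lie_V_S_xi (hnab : ∀ X, G.nab X ξ = X - G.g X ξ • ξ) (hξ : G.g ξ ξ = 1)
    (hc : ∀ X, G.D X c = 0) (hmu : ∀ X, G.D X mu = 0)
    (hs : ∀ X Y, G.lie V G.g X Y + 2 * G.S X Y + c * G.g X Y + 2 * mu * (G.g X ξ * G.g Y ξ) = 0)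
    (Y : L) :
    G.lie V G.S Y ξ = G.D ξ G.r * G.g Y ξ - G.D Y G.r := by
  have h2 (X : L) : G.D X 2 = 0 := G.D_natCast X 2
  have hl : G.lie V G.S Y ξ = -((Fintype.card ι : R) - 1)
      * ((2 * ((Fintype.card ι : R) - 1) - c - 2 * mu) * G.g Y ξ + G.g Y (G.br V ξ))
      - G.S Y (G.br V ξ) := by
    simp only [lie, S_xi hnab, G.D_mul, G.D_neg, G.D_sub, G.D_natCast, G.D_one,
      lie_V_eta hnab hξ hs Y]
    ring
  refine G.ev_ext _ _ fun p => ?_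
  have hS : G.ev p (G.S Y (G.br V ξ)) = G.ev p (G.D Y G.r)
      + (G.ev p c + 2 * G.ev p mu) * ((Fintype.card ι : ℝ) - 1) * G.ev p (G.g Y ξ)
      + 2 * G.ev p G.r * G.ev p (G.g Y ξ)
      + 2 * ((Fintype.card ι : ℝ) - 1) * G.ev p (G.g Y ξ)
      - ((Fintype.card ι : ℝ) - 1) * G.ev p (G.g Y (G.br V ξ)) := by
    have t1 := G.two_mul_sum_ev_dS p Y
    have t2 := G.ev_D_r p Y
    have t3 := G.sum_ev_g_mul_g p ξ Y
    have t4 := G.sum_ev_g_mul_g p (G.br V ξ) Y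
    have t5 := sum_ev_g_mul_S (G := G) p ξ Y
    rw [S_xi hnab] at t5
    simp only [map_mul, map_neg, map_sub, map_natCast, map_one] at t5
    rw [G.ev_S]
    simp only [g_K_br hnab hξ hc hmu hs, map_add, map_sub, map_mul, map_neg, map_ofNat,
      Finset.sum_add_distrib, Finset.sum_sub_distrib, ← Finset.mul_sum, sum_ev_g_E,
      G.g_comm Y (G.E p _), t3, t4, t5, ← t2, ← G.ev_r]
    rw [G.g_comm ξ Y, G.g_comm (G.br V ξ) Y]
    linear_combination -t1
  rw [hl, D_xi_r hnab]
  simp only [map_add, map_sub, map_mul, map_neg, map_ofNat, map_natCast, map_one, hS]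
  ring

end Soliton

end FramedRiemannian

namespace Riem

noncomputable section

open Topology Filter

lemma gramSchmidtNormed_eq {F : Type*} [NormedAddCommGroup F] [InnerProductSpace ℝ F]
    {ι : Type*} [LinearOrder ι] [LocallyFiniteOrderBot ι] [WellFoundedLT ι] (f : ι → F) (i : ι) :
    InnerProductSpace.gramSchmidtNormed ℝ f i
      = (Real.sqrt (inner ℝ (InnerProductSpace.gramSchmidt ℝ f i)
          (InnerProductSpace.gramSchmidt ℝ f i)))⁻¹ • InnerProductSpace.gramSchmidt ℝ f i := by
  rw [InnerProductSpace.gramSchmidtNormed, norm_eq_sqrt_real_inner]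
  rfl

variable {E : Type*} [NormedAddCommGroup E] [NormedSpace ℝ E]
  {H : Type*} [TopologicalSpace H] {I : ModelWithCorners ℝ E H}
  {M : Type*} [TopologicalSpace M] [ChartedSpace H M]

lemma dirDeriv_congr {X : Π x : M, TangentSpace I x} {f h : M → ℝ} {x : M} (hfh : f =ᶠ[𝓝 x] h) :
    dirDeriv X f x = dirDeriv X h x :=
  congrArg (fun L : TangentSpace I x →L[ℝ] ℝ => L (X x)) hfh.mfderiv_eq

variable [IsManifold I ∞ M]

lemma contMDiff_dirDeriv {X : Π x : M, TangentSpace I x} {f : M → ℝ} (hX : CMDiff ∞ (T% X))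
    (hf : CMDiff ∞ f) : CMDiff ∞ (dirDeriv X f) :=
  (contMDiff_snd_tangentBundle_modelSpace ℝ 𝓘(ℝ, ℝ)).comp
    ((hf.contMDiff_tangentMap (m := ∞) (by simp)).comp hX)

lemma contMDiffOn_met [RiemannianBundle (fun x : M => TangentSpace I x)]
    [IsContMDiffRiemannianBundle I ∞ E (fun x : M => TangentSpace I x)]
    {U : Set M} {X Y : Π x : M, TangentSpace I x} (hX : CMDiff[U] ∞ (T% X))
    (hY : CMDiff[U] ∞ (T% Y)) : CMDiff[U] ∞ (met X Y) :=
  ContMDiffOn.inner_bundle hX hY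

lemma contMDiff_met [RiemannianBundle (fun x : M => TangentSpace I x)]
    [IsContMDiffRiemannianBundle I ∞ E (fun x : M => TangentSpace I x)]
    {X Y : Π x : M, TangentSpace I x} (hX : CMDiff ∞ (T% X))
    (hY : CMDiff ∞ (T% Y)) : CMDiff ∞ (met X Y) :=
  ContMDiff.inner_bundle hX hY

lemma contMDiffOn_gramSchmidt [RiemannianBundle (fun x : M => TangentSpace I x)]
    [IsContMDiffRiemannianBundle I ∞ E (fun x : M => TangentSpace I x)]
    {ι : Type*} [LinearOrder ι] [LocallyFiniteOrderBot ι]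
    [WellFoundedLT ι] {U : Set M} {s : ι → Π x : M, TangentSpace I x}
    (hs : ∀ i, CMDiff[U] ∞ (T% (s i))) (hli : ∀ x ∈ U, LinearIndependent ℝ (s · x)) (i : ι) :
    CMDiff[U] ∞ (T% (fun x => InnerProductSpace.gramSchmidt ℝ (s · x) i)) := by
  induction i using WellFoundedLT.induction with
  | ind i ih =>
    have h (x : M) : InnerProductSpace.gramSchmidt ℝ (s · x) i = s i x - ∑ j ∈ Finset.Iio i,
        (inner ℝ (InnerProductSpace.gramSchmidt ℝ (s · x) j) (s i x)
          / inner ℝ (InnerProductSpace.gramSchmidt ℝ (s · x) j)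
            (InnerProductSpace.gramSchmidt ℝ (s · x) j))
          • InnerProductSpace.gramSchmidt ℝ (s · x) j := by
      have := InnerProductSpace.gramSchmidt_def'' ℝ (s · x) i
      simp only [real_inner_self_eq_norm_sq]
      exact eq_sub_of_add_eq this.symm
    simp only [h]
    refine (hs i).sub_section (ContMDiffOn.sum_section fun j hj => ?_)
    have hj := ih j (Finset.mem_Iio.1 hj)
    refine ContMDiffOn.smul_section (ContMDiffOn.div₀ (contMDiffOn_met hj (hs i))
      (contMDiffOn_met hj hj) fun x hx => ?_) hj
    exact inner_self_ne_zero.2 (InnerProductSpace.gramSchmidt_ne_zero j (hli x hx))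

variable [FiniteDimensional ℝ E]

lemma contMDiff_mlieBracket {X Y : Π x : M, TangentSpace I x} (hX : CMDiff ∞ (T% X))
    (hY : CMDiff ∞ (T% Y)) : CMDiff ∞ (T% (mlieBracket I X Y)) := by
  have : CompleteSpace E := FiniteDimensional.complete ℝ E
  have : IsManifold I (minSmoothness ℝ 2) M := by
    simpa using IsManifold.of_le (n := ∞) (m := 2) ENat.LEInfty.out
  have : IsManifold I (((⊤ : ℕ∞) : ℕ∞ω) + 1) M := by simpa
  exact ContDiff.mlieBracket_vectorField (m := ⊤) (n := ⊤) hX hY (by simp)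

lemma mlieBracket_jacobi {X Y Z : Π x : M, TangentSpace I x} (hX : CMDiff ∞ (T% X))
    (hY : CMDiff ∞ (T% Y)) (hZ : CMDiff ∞ (T% Z)) :
    mlieBracket I X (mlieBracket I Y Z) =
      mlieBracket I (mlieBracket I X Y) Z + mlieBracket I Y (mlieBracket I X Z) := by
  have : CompleteSpace E := FiniteDimensional.complete ℝ E
  have : IsManifold I (minSmoothness ℝ 3) M := by
    simpa using IsManifold.of_le (n := ∞) (m := 3) ENat.LEInfty.out
  have h : minSmoothness ℝ 2 ≤ (∞ : ℕ∞ω) := by simpa using ENat.LEInfty.out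
  exact leibniz_identity_mlieBracket (hX.of_le h) (hY.of_le h) (hZ.of_le h)

/-- A vector field that is smooth near `p` agrees near `p` with a smooth vector field. -/
lemma exists_contMDiff_eventuallyEq [T2Space M] {p : M} {U : Set M} (hU : IsOpen U) (hp : p ∈ U)
    {X : Π x : M, TangentSpace I x} (hX : CMDiff[U] ∞ (T% X)) :
    ∃ Y : Π x : M, TangentSpace I x, CMDiff ∞ (T% Y) ∧ Y =ᶠ[𝓝 p] X := by
  obtain ⟨f, -, hf⟩ := (SmoothBumpFunction.nhds_basis_tsupport (I := I) p).mem_iff.1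
    (hU.mem_nhds hp)
  refine ⟨(f : M → ℝ) • X, f.contMDiff.contMDiffOn.smul_section_of_tsupport hU hf hX, ?_⟩
  filter_upwards [f.eventuallyEq_one] with y hy
  change f y • X y = X y
  rw [hy, Pi.one_apply, one_smul]

lemma exists_contMDiff_eventuallyEq_extend [T2Space M] {p : M} (u : TangentSpace I p) :
    ∃ Y : Π x : M, TangentSpace I x, CMDiff ∞ (T% Y) ∧ Y =ᶠ[𝓝 p] (extend E u : Π x : M, TangentSpace I x) := by
  obtain ⟨s, hs, h⟩ := exists_contMDiffOn_extend (I := I) (k := ∞) E u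
  obtain ⟨t, hts, ht, hp⟩ := mem_nhds_iff.1 hs
  exact exists_contMDiff_eventuallyEq ht hp (h.mono hts)

variable [RiemannianBundle (fun x : M => TangentSpace I x)]
  [IsContMDiffRiemannianBundle I ∞ E (fun x : M => TangentSpace I x)]

/-- Existence of local orthonormal frames. -/
lemma exists_orthonormal_frame (p : M) :
    ∃ U : Set M, IsOpen U ∧ p ∈ U ∧ ∃ e : Fin (Module.finrank ℝ E) → Π x : M, TangentSpace I x,
      (∀ i, CMDiff[U] ∞ (T% (e i))) ∧ ∀ x ∈ U, Orthonormal ℝ (e · x) := by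
  let t := trivializationAt E (fun x : M => TangentSpace I x) p
  let b := Module.finBasis ℝ E
  have hF := t.isLocalFrameOn_localFrame_baseSet I ∞ b
  refine ⟨t.baseSet, t.open_baseSet, mem_baseSet_trivializationAt' p,
    fun i x => InnerProductSpace.gramSchmidtNormed ℝ (t.localFrame b · x) i, fun i => ?_,
    fun x hx => InnerProductSpace.gramSchmidtNormed_orthonormal (hF.linearIndependent hx)⟩
  have hg := contMDiffOn_gramSchmidt hF.contMDiffOn (fun x hx => hF.linearIndependent hx) i
  have hn : CMDiff[t.baseSet] ∞ (fun x => (Real.sqrt (inner ℝ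
      (InnerProductSpace.gramSchmidt ℝ (t.localFrame b · x) i)
      (InnerProductSpace.gramSchmidt ℝ (t.localFrame b · x) i)))⁻¹) := by
    intro x hx
    have h0 : inner ℝ (InnerProductSpace.gramSchmidt ℝ (t.localFrame b · x) i)
        (InnerProductSpace.gramSchmidt ℝ (t.localFrame b · x) i) ≠ 0 :=
      inner_self_ne_zero.2 (InnerProductSpace.gramSchmidt_ne_zero i (hF.linearIndependent hx))
    have h1 : ContDiffAt ℝ ∞ (fun y : ℝ => (Real.sqrt y)⁻¹) (inner ℝ
        (InnerProductSpace.gramSchmidt ℝ (t.localFrame b · x) i)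
        (InnerProductSpace.gramSchmidt ℝ (t.localFrame b · x) i)) :=
      (Real.contDiffAt_sqrt h0).inv
        (Real.sqrt_ne_zero'.2 (lt_of_le_of_ne real_inner_self_nonneg h0.symm))
    exact ContMDiffAt.comp_contMDiffWithinAt (g := fun y : ℝ => (Real.sqrt y)⁻¹) x
      h1.contMDiffAt (contMDiffOn_met hg hg x hx)
  refine (hn.smul_section hg).congr fun x hx => ?_
  exact congrArg (TotalSpace.mk x) (gramSchmidtNormed_eq _ i)

end

end Riem

namespace Riem

noncomputable section

open Topology Filter

lemma sum_inner_smul_of_orthonormal {E : Type*} [NormedAddCommGroup E] [NormedSpace ℝ E]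
    {H : Type*} [TopologicalSpace H] {I : ModelWithCorners ℝ E H} {M : Type*} [TopologicalSpace M]
    [ChartedSpace H M] [RiemannianBundle (fun x : M => TangentSpace I x)] [FiniteDimensional ℝ E]
    {x : M} {v : Fin (Module.finrank ℝ E) → TangentSpace I x}
    (hv : Orthonormal ℝ v) (u : TangentSpace I x) : u = ∑ i, (inner ℝ u (v i) : ℝ) • v i := by
  have hb : Submodule.span ℝ (Set.range v) = ⊤ :=
    hv.linearIndependent.span_eq_top_of_card_eq_finrank' (by simp; rfl)
  have := (OrthonormalBasis.mk hv hb.ge).sum_repr' u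
  simp only [OrthonormalBasis.coe_mk] at this
  conv_lhs => rw [← this]
  simp_rw [real_inner_comm]

variable {E : Type*} [NormedAddCommGroup E] [NormedSpace ℝ E]
  {H : Type*} [TopologicalSpace H] {I : ModelWithCorners ℝ E H}
  {M : Type*} [TopologicalSpace M] [ChartedSpace H M]
  [IsManifold I ∞ M]

variable (I M) in
/-- The smooth vector fields on `M`. -/
abbrev VF := Cₛ^∞⟮I; E, (fun x : M => TangentSpace I x)⟯

instance : SMul C^∞⟮I, M; ℝ⟯ (VF I M) :=
  ⟨fun f X => ⟨(f : M → ℝ) • (X : Π x : M, TangentSpace I x), f.contMDiff.smul_section X.contMDiff⟩⟩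

lemma VF.smul_apply (f : C^∞⟮I, M; ℝ⟯) (X : VF I M) (x : M) : (f • X) x = f x • X x := rfl

instance : Module C^∞⟮I, M; ℝ⟯ (VF I M) where
  smul_add f X Y := by ext x; exact smul_add (f x) (X x) (Y x)
  add_smul f h X := by ext x; exact add_smul (f x) (h x) (X x)
  mul_smul f h X := by ext x; exact mul_smul (f x) (h x) (X x)
  one_smul X := by ext x; exact one_smul ℝ (X x)
  zero_smul X := by ext x; exact zero_smul ℝ (X x)
  smul_zero f := by ext x; exact smul_zero (f x)

lemma VF.sum_apply {ι : Type*} (s : Finset ι) (X : ι → VF I M) (x : M) :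
    (∑ i ∈ s, X i) x = ∑ i ∈ s, X i x := by
  have := map_sum (ContMDiffSection.coeAddHom I E ∞ (fun x : M => TangentSpace I x)) X s
  exact (congrFun this x).trans (Finset.sum_apply _ _ _)

namespace VF

/-- The derivative of a smooth function along a smooth vector field. -/
def D (X : VF I M) (f : C^∞⟮I, M; ℝ⟯) : C^∞⟮I, M; ℝ⟯ :=
  ⟨dirDeriv X f, contMDiff_dirDeriv X.contMDiff f.contMDiff⟩

lemma D_add (X : VF I M) (f h : C^∞⟮I, M; ℝ⟯) : D X (f + h) = D X f + D X h := by
  ext x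
  change d% ((f : M → ℝ) + h) x (X x) = _
  rw [mvfderiv_add f.mdifferentiableAt h.mdifferentiableAt]
  rfl

lemma D_mul (X : VF I M) (f h : C^∞⟮I, M; ℝ⟯) : D X (f * h) = D X f * h + f * D X h := by
  ext x
  change d% ((f : M → ℝ) * h) x (X x) = d% f x (X x) * h x + f x * d% h x (X x)
  rw [mvfderiv_mul f.mdifferentiableAt h.mdifferentiableAt]
  simp
  ring

variable [FiniteDimensional ℝ E]

/-- The Lie bracket of smooth vector fields. -/
def br (X Y : VF I M) : VF I M := ⟨mlieBracket I X Y, contMDiff_mlieBracket X.contMDiff Y.contMDiff⟩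

lemma jacobi (X Y Z : VF I M) : br X (br Y Z) = br (br X Y) Z + br Y (br X Z) :=
  ContMDiffSection.coe_inj (mlieBracket_jacobi X.contMDiff Y.contMDiff Z.contMDiff)

lemma br_add (X Y Z : VF I M) : br X (Y + Z) = br X Y + br X Z := by
  ext x
  exact mlieBracket_add_right Y.mdifferentiableAt Z.mdifferentiableAt

lemma br_smul (X Y : VF I M) (f : C^∞⟮I, M; ℝ⟯) : br X (f • Y) = D X f • Y + f • br X Y := by
  ext x
  exact mlieBracket_smul_right f.mdifferentiableAt Y.mdifferentiableAt

lemma D_br [T2Space M] (X Y : VF I M) (f : C^∞⟮I, M; ℝ⟯) : D (br X Y) f = D X (D Y f) - D Y (D X f) := by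
  have h (Z : VF I M) : (D (br X Y) f - (D X (D Y f) - D Y (D X f))) • Z = 0 := by
    have h1 := jacobi X Y (f • Z)
    have h2 := jacobi X Y Z
    simp only [br_smul, br_add, h2] at h1
    rw [← sub_eq_zero] at h1
    rw [← neg_eq_zero, ← h1]
    module
  rw [← sub_eq_zero]
  ext x
  rcases subsingleton_or_nontrivial (TangentSpace I x) with hs | hn
  · have h0 (W : VF I M) (h : C^∞⟮I, M; ℝ⟯) : D W h x = 0 := by
      change d% h x (W x) = 0
      rw [Subsingleton.elim (W x) 0, map_zero]
    change D (br X Y) f x - (D X (D Y f) x - D Y (D X f) x) = 0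
    simp [h0]
  · obtain ⟨v, hv⟩ := exists_ne (0 : TangentSpace I x)
    obtain ⟨Z, hZ, hZv⟩ := exists_contMDiff_eventuallyEq_extend v
    have h3 := congrArg (fun W : VF I M => W x) (h ⟨Z, hZ⟩)
    have h4 : Z x = v := by rw [hZv.eq_of_nhds, extend_apply_self]
    change (D (br X Y) f - (D X (D Y f) - D Y (D X f))) x • Z x = 0 at h3
    rw [h4] at h3
    exact (smul_eq_zero.1 h3).resolve_right hv

end VF

lemma contMDiff_koszul [FiniteDimensional ℝ E] [RiemannianBundle (fun x : M => TangentSpace I x)]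
    [IsContMDiffRiemannianBundle I ∞ E (fun x : M => TangentSpace I x)]
    {X Y Z : Π x : M, TangentSpace I x} (hX : CMDiff ∞ (T% X))
    (hY : CMDiff ∞ (T% Y)) (hZ : CMDiff ∞ (T% Z)) : CMDiff ∞ (koszul X Y Z) :=
  contMDiff_const.mul <| ((((contMDiff_dirDeriv hX (contMDiff_met hY hZ)).add
    (contMDiff_dirDeriv hY (contMDiff_met hZ hX))).sub
    (contMDiff_dirDeriv hZ (contMDiff_met hX hY))).add
    (contMDiff_met (contMDiff_mlieBracket hX hY) hZ)).sub
    (contMDiff_met (contMDiff_mlieBracket hY hZ) hX) |>.add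
    (contMDiff_met (contMDiff_mlieBracket hZ hX) hY)

variable [FiniteDimensional ℝ E] [T2Space M] [RiemannianBundle (fun x : M => TangentSpace I x)]
  [IsContMDiffRiemannianBundle I ∞ E (fun x : M => TangentSpace I x)]

/-- Near every point there is an orthonormal frame consisting of global smooth vector fields. -/
lemma exists_frame (p : M) : ∃ F : Fin (Module.finrank ℝ E) → VF I M,
    ∀ᶠ y in 𝓝 p, Orthonormal ℝ (fun i => F i y) := by
  obtain ⟨U, hU, hp, e, he, ho⟩ := exists_orthonormal_frame (I := I) p
  choose F hF hFe using fun i => exists_contMDiff_eventuallyEq hU hp (he i)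
  refine ⟨fun i => ⟨F i, hF i⟩, ?_⟩
  filter_upwards [hU.mem_nhds hp, eventually_all.2 hFe] with y hy hy'
  have : (fun i => F i y) = (e · y) := funext hy'
  change Orthonormal ℝ (fun i => F i y)
  rw [this]
  exact ho y hy

lemma contMDiff_nabla {X Y : Π x : M, TangentSpace I x} (hX : CMDiff ∞ (T% X))
    (hY : CMDiff ∞ (T% Y)) : CMDiff ∞ (T% (nabla X Y)) := by
  intro p
  obtain ⟨F, hF⟩ := exists_frame (I := I) p
  have h : CMDiff ∞ (T% (fun x => ∑ i, ((koszul X Y (F i)) • (F i : Π x : M, TangentSpace I x)) x)) :=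
    ContMDiff.sum_section fun i _ =>
      (contMDiff_koszul hX hY (F i).contMDiff).smul_section (F i).contMDiff
  refine (h p).congr_of_eventuallyEq ?_
  filter_upwards [hF] with y hy
  refine congrArg (TotalSpace.mk y) ?_
  rw [sum_inner_smul_of_orthonormal hy (nabla X Y y)]
  refine Finset.sum_congr rfl fun i _ => ?_
  have := inner_leviCivitaFun (hX.mdifferentiable (by simp) y) (hY.mdifferentiable (by simp) y)
    (F i).mdifferentiableAt
  change (inner ℝ (leviCivitaFun Y y (X y)) (F i y) : ℝ) • F i y = _
  rw [this]
  rfl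

namespace VF

variable (X Y : VF I M)

/-- The covariant derivative of smooth vector fields. -/
def nab : VF I M := ⟨nabla X Y, contMDiff_nabla X.contMDiff Y.contMDiff⟩

/-- The inner product of smooth vector fields. -/
def g : C^∞⟮I, M; ℝ⟯ := ⟨met X Y, contMDiff_met X.contMDiff Y.contMDiff⟩

lemma br_eq (X Y : VF I M) : br X Y = nab X Y - nab Y X := by
  ext x
  exact ((CovariantDerivative.torsion_eq_zero_iff _).1 leviCivita_torsion
    X.mdifferentiableAt Y.mdifferentiableAt).symm

end VF

variable (I M) in
/-- The smooth vector fields of a Riemannian manifold, with the Levi-Civita connection. -/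
def lieRinehart : RiemannianLieRinehart C^∞⟮I, M; ℝ⟯ (VF I M) where
  D := VF.D
  nab := VF.nab
  g := VF.g
  D_add_left X Y f := by ext x; exact map_add (d% f x) (X x) (Y x)
  D_smul_left h X f := by ext x; exact map_smul (d% f x) (h x) (X x)
  D_add := VF.D_add
  D_mul := VF.D_mul
  nab_add_left X Y Z := by ext x; exact map_add (leviCivita I M Z x) (X x) (Y x)
  nab_smul_left h X Z := by ext x; exact map_smul (leviCivita I M Z x) (h x) (X x)
  nab_add X Y Z := by
    ext x
    exact congrArg (fun A : TangentSpace I x →L[ℝ] TangentSpace I x => A (X x))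
      ((leviCivita I M).isCovariantDerivativeOnUniv.add Y.mdifferentiableAt Z.mdifferentiableAt)
  nab_smul X f Y := by
    ext x
    have := congrArg (fun A : TangentSpace I x →L[ℝ] TangentSpace I x => A (X x))
      ((leviCivita I M).isCovariantDerivativeOnUniv.leibniz Y.mdifferentiableAt
        f.mdifferentiableAt)
    exact this.trans (add_comm _ _)
  g_comm X Y := by ext x; exact real_inner_comm (Y x) (X x)
  g_add_left X Y Z := by ext x; exact inner_add_left (X x) (Y x) (Z x)
  g_smul_left h X Z := by ext x; exact real_inner_smul_left (X x) (Z x) (h x)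
  two_cancel f hf := by
    ext x
    rw [two_mul] at hf
    have := congrArg (fun h : C^∞⟮I, M; ℝ⟯ => h x) hf
    change f x + f x = 0 at this
    change f x = 0
    linarith
  g_nondeg X hX := by
    ext x
    exact inner_self_eq_zero.1 (congrArg (fun h : C^∞⟮I, M; ℝ⟯ => h x) (hX X))
  metric X Y Z := by
    ext x
    exact leviCivita_metric X.mdifferentiableAt Y.mdifferentiableAt Z.mdifferentiableAt
  D_lie X Y f := by rw [← VF.br_eq, VF.D_br]
  jacobi X Y Z := by simpa only [VF.br_eq] using VF.jacobi X Y Z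

end

end Riem

namespace Riem

noncomputable section

open Topology Filter

/-- The trace of a bilinear form does not depend on the orthonormal basis. -/
lemma sum_orthonormalBasis_eq {F : Type*} [NormedAddCommGroup F] [InnerProductSpace ℝ F]
    {ι κ : Type*} [Fintype ι] [Fintype κ] (b : OrthonormalBasis ι ℝ F)
    (c : OrthonormalBasis κ ℝ F) {B : F → F → ℝ}
    (hadd : ∀ u v w, B (u + v) w = B u w + B v w) (hsmul : ∀ (a : ℝ) u w, B (a • u) w = a * B u w)
    (hadd' : ∀ u v w, B w (u + v) = B w u + B w v) (hsmul' : ∀ (a : ℝ) u w, B w (a • u) = a * B w u) :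
    ∑ i, B (b i) (b i) = ∑ j, B (c j) (c j) := by
  classical
  let B' : F →ₗ[ℝ] F →ₗ[ℝ] ℝ :=
    LinearMap.mk₂ ℝ B hadd hsmul (fun w u v => hadd' u v w) (fun a w u => hsmul' a u w)
  have h (i : ι) : B (b i) (b i) = ∑ j, ∑ k, inner ℝ (c j) (b i) * inner ℝ (c k) (b i)
      * B (c j) (c k) := by
    change B' (b i) (b i) = _
    conv_lhs => rw [← c.sum_repr' (b i)]
    simp only [map_sum, map_smul, LinearMap.sum_apply, LinearMap.smul_apply, smul_eq_mul,
      Finset.mul_sum, ← mul_assoc]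
    rw [Finset.sum_comm]
    refine Finset.sum_congr rfl fun j _ => Finset.sum_congr rfl fun k _ => ?_
    rw [mul_comm (inner ℝ (c k) _)]
    rfl
  have h2 (j k : κ) : ∑ i, inner ℝ (c j) (b i) * inner ℝ (c k) (b i) = inner ℝ (c j) (c k) := by
    rw [← b.sum_inner_mul_inner]
    simp_rw [real_inner_comm (c k)]
  simp_rw [h]
  rw [Finset.sum_comm]
  refine Finset.sum_congr rfl fun j _ => ?_
  rw [Finset.sum_comm]
  simp_rw [← Finset.sum_mul, h2, orthonormal_iff_ite.1 c.orthonormal]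
  simp

variable {E : Type*} [NormedAddCommGroup E] [NormedSpace ℝ E]
  {H : Type*} [TopologicalSpace H] {I : ModelWithCorners ℝ E H}
  {M : Type*} [TopologicalSpace M] [ChartedSpace H M]

lemma smoothMap_sum_apply {ι : Type*} (s : Finset ι) (f : ι → C^∞⟮I, M; ℝ⟯) (x : M) :
    (∑ i ∈ s, f i) x = ∑ i ∈ s, f i x :=
  map_sum (ContMDiffMap.evalRingHom x : C^∞⟮I, M; ℝ⟯ →+* ℝ) f s

/-- The orthonormal basis of a tangent space given by orthonormal vectors. -/
lemma exists_orthonormalBasis [FiniteDimensional ℝ E]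
    [RiemannianBundle (fun x : M => TangentSpace I x)]
    {x : M} {v : Fin (Module.finrank ℝ E) → TangentSpace I x}
    (hv : Orthonormal ℝ v) :
    ∃ b : OrthonormalBasis (Fin (Module.finrank ℝ E)) ℝ (TangentSpace I x), ⇑b = v :=
  ⟨OrthonormalBasis.mk hv
    (hv.linearIndependent.span_eq_top_of_card_eq_finrank' (by simp; rfl)).ge,
    OrthonormalBasis.coe_mk _ _⟩

variable [IsManifold I ∞ M]

lemma D_const (X : VF I M) (a : ℝ) : VF.D X (ContMDiffMap.const a) = 0 := by
  ext x
  change dirDeriv X (fun _ => a) x = 0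
  rw [dirDeriv, mvfderiv_const]
  rfl

lemma IsAlmostContactMetric.phi_xi
    [RiemannianBundle (fun x : M => TangentSpace I x)]
    {φ : Π x : M, TangentSpace I x →L[ℝ] TangentSpace I x}
    {ξ : Π x : M, TangentSpace I x} {η : Π x : M, TangentSpace I x →L[ℝ] ℝ}
    (h : IsAlmostContactMetric φ ξ η) (x : M) : φ x (ξ x) = 0 := by
  have h1 := h.inner_phi x (ξ x) (ξ x)
  rw [← h.eta_eq, h.eta_xi, one_mul, sub_self] at h1
  exact inner_self_eq_zero.1 h1

lemma IsAlmostContactMetric.eta_phi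
    [RiemannianBundle (fun x : M => TangentSpace I x)]
    {φ : Π x : M, TangentSpace I x →L[ℝ] TangentSpace I x}
    {ξ : Π x : M, TangentSpace I x} {η : Π x : M, TangentSpace I x →L[ℝ] ℝ}
    (h : IsAlmostContactMetric φ ξ η) (x : M) (u : TangentSpace I x) : η x (φ x u) = 0 := by
  have h1 := h.phi_phi x (φ x u)
  rw [h.phi_phi x u, map_add, map_neg, map_smul, h.phi_xi, smul_zero, add_zero] at h1
  have h2 : η x (φ x u) • ξ x = 0 := by simpa using h1
  have h3 := congrArg (η x) h2
  simpa [h.eta_xi] using h3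

variable [FiniteDimensional ℝ E]

lemma VF.exists_eq [T2Space M] {x : M} (u : TangentSpace I x) :
    ∃ X : VF I M, X x = u ∧ (extend E u : Π x : M, TangentSpace I x) =ᶠ[𝓝 x] X := by
  obtain ⟨Y, hY, h⟩ := exists_contMDiff_eventuallyEq_extend u
  exact ⟨⟨Y, hY⟩, by rw [← extend_apply_self E u]; exact h.eq_of_nhds, h.symm⟩

variable [RiemannianBundle (fun x : M => TangentSpace I x)]
  [IsContMDiffRiemannianBundle I ∞ E (fun x : M => TangentSpace I x)]

lemma nabla_congr {X X' Y Y' : Π x : M, TangentSpace I x} {x : M} (hX : X x = X' x)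
    (hY : Y =ᶠ[𝓝 x] Y') (hY' : MDiffAt (T% Y') x) : nabla X Y x = nabla X' Y' x := by
  have h : MDiffAt (T% Y) x :=
    hY'.congr_of_eventuallyEq (hY.mono fun y hy => congrArg (TotalSpace.mk y) hy)
  have := (leviCivita I M).isCovariantDerivativeOnUniv.congr_of_eventuallyEq h hY' univ_mem hY
  change leviCivita I M Y x (X x) = leviCivita I M Y' x (X' x)
  rw [hX]
  exact congrArg (fun A : TangentSpace I x →L[ℝ] TangentSpace I x => A (X' x)) this

/-- On a Kenmotsu manifold, `∇_X ξ = X - η(X) ξ`. -/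
lemma IsKenmotsu.nabla_xi {φ : Π x : M, TangentSpace I x →L[ℝ] TangentSpace I x}
    {ξ : Π x : M, TangentSpace I x} {η : Π x : M, TangentSpace I x →L[ℝ] ℝ}
    (h : IsKenmotsu φ ξ η) {X : Π x : M, TangentSpace I x} (hX : SmoothVF X) (x : M) :
    nabla X ξ x = X x - η x (X x) • ξ x := by
  have h1 := h.nabla_phi X ξ hX h.smooth_xi x
  have h2 : (fun y => φ y (ξ y)) = 0 := funext h.phi_xi
  have h3 : nabla X 0 x = 0 := by
    rw [nabla, CovariantDerivative.zero]
    rfl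
  rw [h2, h3, ← h.eta_eq, h.eta_phi, h.eta_xi, zero_smul, one_smul, zero_sub, zero_sub,
    neg_inj] at h1
  have h4 := congrArg (φ x) h1
  rw [h.phi_phi, h.phi_phi] at h4
  have h5 : η x (nabla X ξ x) = 0 := by
    have hd := h.smooth_xi.mdifferentiable (by simp) x
    have hm := leviCivita_metric (hX.mdifferentiable (by simp) x) hd hd
    have hc : met ξ ξ = fun _ => 1 := by
      funext y
      rw [met, ← h.eta_eq, h.eta_xi]
    rw [hc, dirDeriv, mvfderiv_const, real_inner_comm] at hm
    rw [h.eta_eq, nabla, real_inner_comm]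
    change (0 : ℝ) = _ at hm
    linarith
  rw [h5, zero_smul, add_zero, neg_eq_iff_eq_neg] at h4
  rw [h4]
  abel

variable [T2Space M]

variable (I) in
lemma exists_frame_bump (p : M) :
    ∃ (χ : C^∞⟮I, M; ℝ⟯) (F : Fin (Module.finrank ℝ E) → VF I M),
      (∀ᶠ y in 𝓝 p, χ y = 1) ∧ ∀ y, χ y ≠ 0 → Orthonormal ℝ (fun i => F i y) := by
  obtain ⟨F, hF⟩ := exists_frame (I := I) p
  obtain ⟨f, -, hf⟩ := (SmoothBumpFunction.nhds_basis_tsupport (I := I) p).mem_iff.1 hF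
  exact ⟨⟨f, f.contMDiff⟩, F, f.eventuallyEq_one,
    fun y hy => hf (subset_tsupport _ (Function.mem_support.2 hy))⟩

variable (I) in
/-- A bump function at `p` supported where `frame I p` is orthonormal. -/
def bump (p : M) : C^∞⟮I, M; ℝ⟯ := (exists_frame_bump I p).choose

variable (I) in
/-- Smooth vector fields that are orthonormal near `p`. -/
def frame (p : M) : Fin (Module.finrank ℝ E) → VF I M := (exists_frame_bump I p).choose_spec.choose

lemma bump_eventually (p : M) : ∀ᶠ y in 𝓝 p, bump I p y = 1 :=
  (exists_frame_bump I p).choose_spec.choose_spec.1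

lemma bump_self (p : M) : bump I p p = 1 := (bump_eventually p).self_of_nhds

lemma frame_orthonormal {p y : M} (h : bump I p y ≠ 0) : Orthonormal ℝ (fun i => frame I p i y) :=
  (exists_frame_bump I p).choose_spec.choose_spec.2 y h

lemma bump_smul (p : M) (X : VF I M) :
    bump I p • X = ∑ i, (bump I p * VF.g X (frame I p i)) • frame I p i := by
  ext y
  rw [VF.sum_apply]
  change bump I p y • X y = ∑ i, (bump I p y * inner ℝ (X y) (frame I p i y)) • frame I p i y
  by_cases h : bump I p y = 0
  · simp [h]
  · conv_lhs => rw [sum_inner_smul_of_orthonormal (frame_orthonormal h) (X y), Finset.smul_sum]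
    simp_rw [smul_smul]

/-- A `C^∞`-linear operator on vector fields is pointwise. -/
lemma eq_of_apply_eq {A : VF I M → VF I M} (hadd : ∀ X Y, A (X + Y) = A X + A Y)
    (hsmul : ∀ (f : C^∞⟮I, M; ℝ⟯) X, A (f • X) = f • A X) {X Y : VF I M} {p : M}
    (h : X p = Y p) : A X p = A Y p := by
  let A' : VF I M →ₗ[C^∞⟮I, M; ℝ⟯] VF I M := ⟨⟨A, hadd⟩, hsmul⟩
  have key (Z : VF I M) :
      A Z p = ∑ i, (inner ℝ (Z p) (frame I p i p) : ℝ) • A (frame I p i) p := by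
    have h1 := congrArg (fun W : VF I M => W p) (congrArg A' (bump_smul p Z))
    simp only [map_smul, map_sum, VF.sum_apply] at h1
    change bump I p p • A Z p = ∑ i, (bump I p p * inner ℝ (Z p) (frame I p i p))
      • A (frame I p i) p at h1
    simpa only [bump_self, one_smul, one_mul] using h1
  rw [key, key, h]

/-- The curvature of smooth vector fields. -/
abbrev VF.K (X Y Z : VF I M) : VF I M := (lieRinehart I M).K X Y Z

lemma VF.K_apply (X Y Z : VF I M) (x : M) : VF.K X Y Z x = curvatureField X Y Z x := by
  have : VF.K X Y Z
      = VF.nab X (VF.nab Y Z) - VF.nab Y (VF.nab X Z) - VF.nab (VF.br X Y) Z := by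
    rw [VF.br_eq]
    rfl
  rw [this]
  rfl

lemma VF.K_congr {X Y Z X' Y' Z' : VF I M} {x : M} (hX : X x = X' x) (hY : Y x = Y' x)
    (hZ : Z x = Z' x) : VF.K X Y Z x = VF.K X' Y' Z' x := by
  let G := lieRinehart I M
  rw [eq_of_apply_eq (A := fun X => VF.K X Y Z) (fun _ _ => G.K_add_left _ _ _ _)
      (fun _ _ => G.K_smul_left _ _ _ _) hX,
    eq_of_apply_eq (A := fun Y => VF.K X' Y Z) (fun _ _ => G.K_add_mid _ _ _ _)
      (fun _ _ => G.K_smul_mid _ _ _ _) hY,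
    eq_of_apply_eq (A := fun Z => VF.K X' Y' Z) (fun _ _ => G.K_add_right _ _ _ _)
      (fun _ _ => G.K_smul_right _ _ _ _) hZ]

lemma curvatureField_congr {X Y Z : Π x : M, TangentSpace I x} {X' Y' Z' : VF I M} {x : M}
    (hX : X =ᶠ[𝓝 x] X') (hY : Y =ᶠ[𝓝 x] Y') (hZ : Z =ᶠ[𝓝 x] Z') :
    curvatureField X Y Z x = curvatureField X' Y' Z' x := by
  have h {W : Π x : M, TangentSpace I x} {W' : VF I M} (hW : W =ᶠ[𝓝 x] W') :
      nabla W Z =ᶠ[𝓝 x] VF.nab W' Z' := by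
    filter_upwards [hW, hZ.eventuallyEq_nhds] with y hy hy'
    exact nabla_congr hy hy' Z'.mdifferentiableAt
  have h1 := nabla_congr hX.eq_of_nhds (h hY) (VF.nab Y' Z').mdifferentiableAt
  have h2 := nabla_congr hY.eq_of_nhds (h hX) (VF.nab X' Z').mdifferentiableAt
  have h3 := nabla_congr (hX.mlieBracket_vectorField_eq hY) hZ Z'.mdifferentiableAt
  rw [curvatureField, h1, h2, h3]
  rfl

lemma curvature_apply (X Y Z : VF I M) (x : M) : curvature x (X x) (Y x) (Z x) = VF.K X Y Z x := by
  obtain ⟨X', hX, hX'⟩ := VF.exists_eq (X x)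
  obtain ⟨Y', hY, hY'⟩ := VF.exists_eq (Y x)
  obtain ⟨Z', hZ, hZ'⟩ := VF.exists_eq (Z x)
  rw [curvature, curvatureField_congr hX' hY' hZ', ← VF.K_apply, VF.K_congr hX hY hZ]

lemma ricci_apply {x : M} {F : Fin (Module.finrank ℝ E) → VF I M}
    (hF : Orthonormal ℝ (fun i => F i x)) (Y Z : VF I M) :
    ricci x (Y x) (Z x) = ∑ i, inner ℝ (VF.K (F i) Y Z x) (F i x) := by
  obtain ⟨b, hb⟩ := exists_orthonormalBasis hF
  have hc : ∀ i, b i = F i x := congrFun hb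
  rw [ricci, sum_orthonormalBasis_eq _ b (B := fun u w => inner ℝ (curvature x u (Y x) (Z x)) w)]
  · simp only [hc, curvature_apply]
  · intro u v w
    obtain ⟨X, rfl, -⟩ := VF.exists_eq u
    obtain ⟨X', rfl, -⟩ := VF.exists_eq v
    change inner ℝ (curvature x ((X + X') x) (Y x) (Z x)) w = _
    rw [curvature_apply, curvature_apply, curvature_apply, VF.K,
      (lieRinehart I M).K_add_left, ← inner_add_left]
    rfl
  · intro a u w
    obtain ⟨X, rfl, -⟩ := VF.exists_eq u
    change inner ℝ (curvature x (((ContMDiffMap.const a : C^∞⟮I, M; ℝ⟯) • X) x) (Y x) (Z x)) w = _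
    rw [curvature_apply, curvature_apply, VF.K, (lieRinehart I M).K_smul_left,
      ← real_inner_smul_left]
    rfl
  · exact fun u v w => inner_add_right _ _ _
  · exact fun a u w => real_inner_smul_right _ _ _

/-- The Ricci tensor of smooth vector fields. -/
def VF.S (Y Z : VF I M) : C^∞⟮I, M; ℝ⟯ where
  val x := ricci x (Y x) (Z x)
  property p := by
    have h : CMDiff ∞ (fun x => ∑ i, VF.g (VF.K (frame I p i) Y Z) (frame I p i) x) :=
      contMDiff_finsetSum fun i _ => (VF.g _ _).contMDiff
    refine (h p).congr_of_eventuallyEq ?_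
    filter_upwards [bump_eventually (I := I) p] with y hy
    exact ricci_apply (frame_orthonormal (by rw [hy]; exact one_ne_zero)) Y Z

lemma scalarCurvature_apply {x : M} {F : Fin (Module.finrank ℝ E) → VF I M}
    (hF : Orthonormal ℝ (fun i => F i x)) :
    scalarCurvature I x = ∑ i, VF.S (F i) (F i) x := by
  obtain ⟨b, hb⟩ := exists_orthonormalBasis hF
  have hc : ∀ i, b i = F i x := congrFun hb
  let G := lieRinehart I M
  have h (Y Z : VF I M) := ricci_apply (frame_orthonormal (p := x) (y := x)
    (by rw [bump_self (I := I)]; exact one_ne_zero)) Y Z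
  rw [scalarCurvature, sum_orthonormalBasis_eq _ b (B := ricci x)]
  · simp only [hc]
    rfl
  · intro u v w
    obtain ⟨X, rfl, -⟩ := VF.exists_eq u
    obtain ⟨X', rfl, -⟩ := VF.exists_eq v
    obtain ⟨Z, rfl, -⟩ := VF.exists_eq w
    change ricci x ((X + X') x) (Z x) = _
    rw [h, h, h, ← Finset.sum_add_distrib]
    refine Finset.sum_congr rfl fun i _ => ?_
    rw [VF.K, G.K_add_mid, ← inner_add_left]
    rfl
  · intro a u w
    obtain ⟨X, rfl, -⟩ := VF.exists_eq u
    obtain ⟨Z, rfl, -⟩ := VF.exists_eq w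
    change ricci x (((ContMDiffMap.const a : C^∞⟮I, M; ℝ⟯) • X) x) (Z x) = _
    rw [h, h, Finset.mul_sum]
    refine Finset.sum_congr rfl fun i _ => ?_
    rw [VF.K, G.K_smul_mid, ← real_inner_smul_left]
    rfl
  · intro u v w
    obtain ⟨X, rfl, -⟩ := VF.exists_eq u
    obtain ⟨X', rfl, -⟩ := VF.exists_eq v
    obtain ⟨Z, rfl, -⟩ := VF.exists_eq w
    change ricci x (Z x) ((X + X') x) = _
    rw [h, h, h, ← Finset.sum_add_distrib]
    refine Finset.sum_congr rfl fun i _ => ?_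
    rw [VF.K, G.K_add_right, ← inner_add_left]
    rfl
  · intro a u w
    obtain ⟨X, rfl, -⟩ := VF.exists_eq u
    obtain ⟨Z, rfl, -⟩ := VF.exists_eq w
    change ricci x (Z x) (((ContMDiffMap.const a : C^∞⟮I, M; ℝ⟯) • X) x) = _
    rw [h, h, Finset.mul_sum]
    refine Finset.sum_congr rfl fun i _ => ?_
    rw [VF.K, G.K_smul_right, ← real_inner_smul_left]
    rfl

variable (I M) in
/-- The scalar curvature as a smooth function. -/
def smoothScalarCurvature : C^∞⟮I, M; ℝ⟯ where
  val := scalarCurvature I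
  property p := by
    have h : CMDiff ∞ (fun x => ∑ i, VF.S (frame I p i) (frame I p i) x) :=
      contMDiff_finsetSum fun i _ => (VF.S _ _).contMDiff
    refine (h p).congr_of_eventuallyEq ?_
    filter_upwards [bump_eventually (I := I) p] with y hy
    exact scalarCurvature_apply (frame_orthonormal (by rw [hy]; exact one_ne_zero))

lemma bump_mul_congr {p : M} {f h : C^∞⟮I, M; ℝ⟯} (hfh : ∀ y, bump I p y ≠ 0 → f y = h y) :
    bump I p * f = bump I p * h := by
  ext y
  change bump I p y * f y = bump I p y * h y
  by_cases hy : bump I p y = 0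
  · simp [hy]
  · rw [hfh y hy]

variable (I M) in
/-- The smooth vector fields of a Riemannian manifold, with local orthonormal frames. -/
def framedRiemannian :
    FramedRiemannian C^∞⟮I, M; ℝ⟯ (VF I M) M (Fin (Module.finrank ℝ E)) where
  toRiemannianLieRinehart := lieRinehart I M
  ev p := ContMDiffMap.evalRingHom p
  ev_ext f h hfh := by ext x; exact hfh x
  χ := bump I
  E := frame I
  ev_χ := bump_self
  ev_D_χ p W := by
    change dirDeriv W (bump I p) p = 0
    rw [dirDeriv_congr (h := fun _ => (1 : ℝ)) (bump_eventually p), dirDeriv, mvfderiv_const]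
    rfl
  orthonormal p i j := by
    have h := bump_mul_congr (p := p) (f := VF.g (frame I p i) (frame I p j))
      (h := if i = j then 1 else 0) fun y hy => by
        have := orthonormal_iff_ite.1 (frame_orthonormal hy) i j
        refine this.trans ?_
        split_ifs <;> rfl
    refine h.trans ?_
    split_ifs <;> simp
  expand := bump_smul
  S := VF.S
  r := smoothScalarCurvature I M
  χ_mul_S p Y Z := bump_mul_congr fun y hy => by
    rw [smoothMap_sum_apply]
    exact ricci_apply (frame_orthonormal hy) Y Z
  χ_mul_r p := bump_mul_congr fun y hy => by
    rw [smoothMap_sum_apply]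
    exact scalarCurvature_apply (frame_orthonormal hy)

/-- The Lie derivative of the Ricci tensor along the potential vector field of a conformal
`η`-Ricci soliton on a Kenmotsu manifold. -/
theorem IsKenmotsu.lieDeriv_ricci_xi {φ : Π x : M, TangentSpace I x →L[ℝ] TangentSpace I x}
    {ξ : Π x : M, TangentSpace I x} {η : Π x : M, TangentSpace I x →L[ℝ] ℝ}
    (h : IsKenmotsu φ ξ η) {V : Π x : M, TangentSpace I x} {lam mu p : ℝ}
    (hS : IsConformalEtaRicciSoliton η V lam mu p) {Y : Π x : M, TangentSpace I x}
    (hY : SmoothVF Y) (x : M) :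
    lieDeriv V ricci Y ξ x
      = dirDeriv ξ (scalarCurvature I) x * η x (Y x) - dirDeriv Y (scalarCurvature I) x := by
  let G := framedRiemannian I M
  let ξ' : VF I M := ⟨ξ, h.smooth_xi⟩
  let V' : VF I M := ⟨V, hS.smooth⟩
  have hbr (A B : VF I M) : G.br A B = VF.br A B := (VF.br_eq A B).symm
  have hlie (T : VF I M → VF I M → C^∞⟮I, M; ℝ⟯) (A B : VF I M) (y : M) : G.lie V' T A B y
      = dirDeriv V (T A B) y - T (VF.br V' A) B y - T A (VF.br V' B) y := by
    rw [RiemannianLieRinehart.lie, hbr, hbr]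
    rfl
  have key := FramedRiemannian.lie_V_S_xi (G := G) (ξ := ξ') (V := V')
    (c := ContMDiffMap.const (2 * lam - (p + 2 / (Module.finrank ℝ E : ℝ))))
    (mu := ContMDiffMap.const mu)
    (fun X => by
      ext y
      refine (h.nabla_xi X.contMDiff y).trans ?_
      rw [h.eta_eq]
      rfl)
    (by
      ext y
      refine (h.eta_eq y (ξ y)).symm.trans ?_
      rw [h.eta_xi]
      rfl)
    (fun X => D_const X _) (fun X => D_const X _)
    (fun A B => by
      ext y
      have hs := hS.soliton_eq A B A.contMDiff B.contMDiff y
      rw [h.eta_eq, h.eta_eq] at hs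
      rw [two_mul, two_mul (ContMDiffMap.const mu)]
      rw [two_mul (ricci y (A y) (B y)), two_mul mu] at hs
      have e := hlie G.g A B y
      change G.lie V' G.g A B y + (_ + _) + _ * _ + (_ + _) * (_ * _) = 0
      rw [e]
      exact hs) ⟨Y, hY⟩
  have key' := congrArg (fun f : C^∞⟮I, M; ℝ⟯ => f x) key
  rw [h.eta_eq]
  refine Eq.trans ?_ key'
  exact (hlie G.S ⟨Y, hY⟩ ξ' x).symm

end

end Riem

theorem lie_derivative_ricci_xi_eq_of_conformal_eta_ricci_soliton
    (n : ℕ) {M : Type*} [TopologicalSpace M] [T2Space M]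
    [ChartedSpace (EuclideanSpace ℝ (Fin (2 * n + 1))) M]
    [IsManifold (𝓡 (2 * n + 1)) ∞ M]
    [RiemannianBundle (fun x : M => TangentSpace (𝓡 (2 * n + 1)) x)]
    [IsContMDiffRiemannianBundle (𝓡 (2 * n + 1)) ∞ (EuclideanSpace ℝ (Fin (2 * n + 1)))
      (fun x : M => TangentSpace (𝓡 (2 * n + 1)) x)]
    (φ : Π x : M, TangentSpace (𝓡 (2 * n + 1)) x →L[ℝ] TangentSpace (𝓡 (2 * n + 1)) x)
    (ξ : Π x : M, TangentSpace (𝓡 (2 * n + 1)) x)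
    (η : Π x : M, TangentSpace (𝓡 (2 * n + 1)) x →L[ℝ] ℝ)
    (hK : Riem.IsKenmotsu φ ξ η)
    (V : Π x : M, TangentSpace (𝓡 (2 * n + 1)) x) (lam mu p : ℝ)
    (hS : Riem.IsConformalEtaRicciSoliton η V lam mu p) :
    ∀ Y : Π x : M, TangentSpace (𝓡 (2 * n + 1)) x, Riem.SmoothVF Y → ∀ x : M,
      Riem.lieDeriv V Riem.ricci Y ξ x
        = Riem.dirDeriv ξ (Riem.scalarCurvature (𝓡 (2 * n + 1))) x * η x (Y x)
          - Riem.dirDeriv Y (Riem.scalarCurvature (𝓡 (2 * n + 1))) x := by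
  intro Y hY x
  exact hK.lieDeriv_ricci_xi hS hY x
end

section
/- Let $M$ be a smooth manifold of dimension $2n+1$ with a Riemannian metric $g$, Levi-Civita connection $\nabla$, curvature $R(X,Y)Z=\nabla_X\nabla_YZ-\nabla_Y\nabla_XZ-\nabla_{[X,Y]}Z$, Ricci tensor $S(Y,Z)=\operatorname{tr}(X\mapsto R(X,Y)Z)$ and scalar curvature $r=\operatorname{tr}_g S$. Let $\phi$ be a smooth $(1,1)$-tensor field, $\xi$ a smooth vector field and $\eta$ a $1$-form on $M$ with $\phi^2=-I+\eta\otimes\xi$, $\eta(\xi)=1$, $\eta(X)=g(X,\xi)$ and $g(\phi X,\phi Y)=g(X,Y)-\eta(X)\eta(Y)$, and suppose that $(M,g,\phi,\xi,\eta)$ is a Kenmotsu manifold, that is, $(\nabla_X\phi)Y=g(\phi X,Y)\xi-\eta(Y)\phi X$ for all vector fields $X,Y$. Suppose that $(g,V,\lambda,\mu)$ is a conformal $\eta$-Ricci soliton on $M$: $V$ is a smooth vector field and $\lambda,\mu,p$ are real constants ($p$ being the conformal pressure) such that $$\mathcal L_Vg+2S+\Bigl[2\lambda-\Bigl(p+\frac{2}{2n+1}\Bigr)\Bigr]g+2\mu\,\eta\otimes\eta=0,$$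 where $\mathcal L_V$ is the Lie derivative along $V$. Then, for every smooth vector field $Y$ on $M$, $$(\mathcal L_VS)(Y,\xi)=-2\,[\,r+2n(2n+1)\,]\,\eta(Y)-Y(r).$$ -/
open Bundle Manifold VectorField
open scoped ContDiff InnerProductSpace

noncomputable section

section Riemannian

variable {E : Type*} [NormedAddCommGroup E] [NormedSpace ℝ E] [FiniteDimensional ℝ E]
  {H : Type*} [TopologicalSpace H] {I : ModelWithCorners ℝ E H}
  {M : Type*} [TopologicalSpace M] [ChartedSpace H M] [IsManifold I ∞ M]

/-- Tangent spaces of a finite-dimensional manifold are finite-dimensional. -/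
instance tangentSpace_finiteDimensional (x : M) : FiniteDimensional ℝ (TangentSpace I x) :=
  inferInstanceAs (FiniteDimensional ℝ E)

/-- `X` is a smooth vector field on `M`. -/
def IsSmoothVectorField (X : Π x : M, TangentSpace I x) : Prop :=
  ContMDiff I I.tangent ∞ (fun x => (⟨x, X x⟩ : TangentBundle I M))

/-- The derivative `X f` of a function `f` along a vector field `X`. -/
def dirDeriv (X : Π x : M, TangentSpace I x) (f : M → ℝ) (x : M) : ℝ :=
  mvfderiv I f x (X x)

/-- The Lie derivative along `V` of a `(0,2)`-tensor `T`, regarded as an operation on vector fields: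
`(L_V T)(X, Y) = V (T (X, Y)) - T ([V, X], Y) - T (X, [V, Y])`. -/
def lieDerivative₂ (V : Π x : M, TangentSpace I x)
    (T : (Π x : M, TangentSpace I x) → (Π x : M, TangentSpace I x) → M → ℝ)
    (X Y : Π x : M, TangentSpace I x) (x : M) : ℝ :=
  dirDeriv V (T X Y) x - T (mlieBracket I V X) Y x - T X (mlieBracket I V Y) x

/-- The curvature of an affine connection,
`R(X, Y) Z = ∇_X ∇_Y Z - ∇_Y ∇_X Z - ∇_[X, Y] Z`.
Recall that `cov Z x (X x)` is `∇_X Z` at `x`. -/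
def curvature (cov : CovariantDerivative I E (TangentSpace I : M → Type _))
    (X Y Z : Π x : M, TangentSpace I x) (x : M) : TangentSpace I x :=
  cov (fun y => cov Z y (Y y)) x (X x) - cov (fun y => cov Z y (X y)) x (Y x)
    - cov Z x (mlieBracket I X Y x)

variable [RiemannianBundle (fun x : M => TangentSpace I x)]

/-- The Riemannian metric `g(X, Y)` as an operation on vector fields. -/
def metric (X Y : Π x : M, TangentSpace I x) (x : M) : ℝ :=
  ⟪X x, Y x⟫_ℝ

/-- The Ricci tensor `S(Y, Z) = trace (X ↦ R(X, Y) Z)`: the trace at `x` is computed in an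
orthonormal basis `e i` of the tangent space at `x`. The argument `e i` of the curvature is
extended to a vector field which is smooth near `x`. -/
def ricci (cov : CovariantDerivative I E (TangentSpace I : M → Type _))
    (Y Z : Π x : M, TangentSpace I x) (x : M) : ℝ :=
  ∑ i, ⟪curvature cov (FiberBundle.extend E (stdOrthonormalBasis ℝ (TangentSpace I x) i)) Y Z x,
    stdOrthonormalBasis ℝ (TangentSpace I x) i⟫_ℝ

/-- The scalar curvature `r`, the trace of the Ricci tensor with respect to the metric:
`r = ∑ i, S(e i, e i)` for an orthonormal basis `e i` of the tangent space. -/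
def scalarCurvature (cov : CovariantDerivative I E (TangentSpace I : M → Type _)) (x : M) : ℝ :=
  ∑ i, ricci cov (FiberBundle.extend E (stdOrthonormalBasis ℝ (TangentSpace I x) i))
    (FiberBundle.extend E (stdOrthonormalBasis ℝ (TangentSpace I x) i)) x

/-- `cov` is the Levi-Civita connection of the Riemannian metric: the smooth affine connection
which is torsion-free and compatible with the metric. -/
structure IsLeviCivita (cov : CovariantDerivative I E (TangentSpace I : M → Type _)) :
    Prop where
  smooth : CovariantDerivative.ContMDiffCovariantDerivative cov ∞
  torsion_eq_zero : 
    haveI : CompleteSpace E := FiniteDimensional.complete ℝ E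
    cov.torsion = 0
  metric_compatible : ∀ (X Y Z : Π x : M, TangentSpace I x) (x : M),
    MDifferentiableAt I I.tangent (fun y => (⟨y, Y y⟩ : TangentBundle I M)) x →
    MDifferentiableAt I I.tangent (fun y => (⟨y, Z y⟩ : TangentBundle I M)) x →
      dirDeriv X (metric Y Z) x = ⟪cov Y x (X x), Z x⟫_ℝ + ⟪Y x, cov Z x (X x)⟫_ℝ

variable (I M) in
/-- An almost contact metric structure `(φ, ξ, η)` on a Riemannian manifold. -/
structure AlmostContactMetricStructure where
  /-- the `(1,1)`-tensor field `φ` -/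
  phi : Π x : M, TangentSpace I x →L[ℝ] TangentSpace I x
  /-- the characteristic vector field `ξ` -/
  xi : Π x : M, TangentSpace I x
  /-- the `1`-form `η` -/
  eta : Π x : M, TangentSpace I x →L[ℝ] ℝ
  phi_smooth : ContMDiff I (I.prod 𝓘(ℝ, E →L[ℝ] E)) ∞
    (fun x => TotalSpace.mk' (E →L[ℝ] E)
      (E := fun x : M => TangentSpace I x →L[ℝ] TangentSpace I x) x (phi x))
  xi_smooth : IsSmoothVectorField xi
  phi_sq : ∀ (x : M) (v : TangentSpace I x), phi x (phi x v) = -v + eta x v • xi x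
  eta_xi : ∀ x : M, eta x (xi x) = 1
  eta_eq : ∀ (x : M) (v : TangentSpace I x), eta x v = ⟪v, xi x⟫_ℝ
  metric_phi : ∀ (x : M) (v w : TangentSpace I x),
    ⟪phi x v, phi x w⟫_ℝ = ⟪v, w⟫_ℝ - eta x v * eta x w

namespace AlmostContactMetricStructure

/-- The Kenmotsu condition `(∇_X φ) Y = g(φ X, Y) ξ - η(Y) φ X`, where
`(∇_X φ) Y = ∇_X (φ Y) - φ (∇_X Y)`. -/
def IsKenmotsu (A : AlmostContactMetricStructure I M)
    (cov : CovariantDerivative I E (TangentSpace I : M → Type _)) : Prop :=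
  ∀ X Y : Π x : M, TangentSpace I x, IsSmoothVectorField X → IsSmoothVectorField Y → ∀ x : M,
    cov (fun y => A.phi y (Y y)) x (X x) - A.phi x (cov Y x (X x))
      = ⟪A.phi x (X x), Y x⟫_ℝ • A.xi x - A.eta x (Y x) • A.phi x (X x)

/-- `(g, V, lam, mu)` is a conformal `η`-Ricci soliton with conformal pressure `p`:
`V` is a smooth vector field and, with `d` the dimension of the manifold,
`L_V g + 2 S + [2 lam - (p + 2 / d)] g + 2 mu η ⊗ η = 0`. -/
structure IsConformalEtaRicciSoliton (A : AlmostContactMetricStructure I M)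
    (cov : CovariantDerivative I E (TangentSpace I : M → Type _))
    (V : Π x : M, TangentSpace I x) (lam mu p : ℝ) : Prop where
  smooth : IsSmoothVectorField V
  equation : ∀ X Y : Π x : M, TangentSpace I x,
    IsSmoothVectorField X → IsSmoothVectorField Y → ∀ x : M,
      lieDerivative₂ V metric X Y x + 2 * ricci cov X Y x
        + (2 * lam - (p + 2 / (Module.finrank ℝ E : ℝ))) * metric X Y x
        + 2 * mu * (A.eta x (X x) * A.eta x (Y x)) = 0

end AlmostContactMetricStructure

end Riemannian

end

open scoped Topology

/-- The algebraic calculus of a torsion-free metric connection: a commutative ring `𝒜` of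
functions, an `𝒜`-module `𝒳` of vector fields acting on `𝒜` by derivations, a connection on `𝒳`
and a compatible symmetric bilinear form. The Lie bracket is `∇_X Y - ∇_Y X`. -/
structure KoszulCalculus (𝒜 𝒳 : Type*) [CommRing 𝒜] [AddCommGroup 𝒳] [Module 𝒜 𝒳] where
  /-- the action of vector fields on functions -/
  D : 𝒳 →ₗ[𝒜] 𝒜 →+ 𝒜
  /-- the connection -/
  nabla : 𝒳 →ₗ[𝒜] 𝒳 →+ 𝒳
  /-- the metric -/
  g : 𝒳 →ₗ[𝒜] 𝒳 →ₗ[𝒜] 𝒜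
  D_mul : ∀ X a b, D X (a * b) = a * D X b + b * D X a
  nabla_smul_right : ∀ X a Y, nabla X (a • Y) = a • nabla X Y + D X a • Y
  g_comm : ∀ X Y, g X Y = g Y X
  D_g : ∀ X Y Z, D X (g Y Z) = g (nabla X Y) Z + g Y (nabla X Z)
  jacobi' : ∀ X Y Z,
    (nabla X (nabla Y Z - nabla Z Y) - nabla (nabla Y Z - nabla Z Y) X)
      = (nabla (nabla X Y - nabla Y X) Z - nabla Z (nabla X Y - nabla Y X))
        + (nabla Y (nabla X Z - nabla Z X) - nabla (nabla X Z - nabla Z X) Y)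
  two_cancel : ∀ a b : 𝒜, 2 * a = 2 * b → a = b
  /-- a unit vector field -/
  xi : 𝒳
  g_xi_xi : g xi xi = 1

namespace KoszulCalculus

variable {𝒜 𝒳 : Type*} [CommRing 𝒜] [AddCommGroup 𝒳] [Module 𝒜 𝒳] (K : KoszulCalculus 𝒜 𝒳)

/-- The Lie bracket. -/
def br (X Y : 𝒳) : 𝒳 := K.nabla X Y - K.nabla Y X

/-- The curvature. -/
def R (X Y Z : 𝒳) : 𝒳 :=
  K.nabla X (K.nabla Y Z) - K.nabla Y (K.nabla X Z) - K.nabla (K.br X Y) Z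

/-- The covariant derivative of the curvature. -/
def DR (X Y Z W : 𝒳) : 𝒳 :=
  K.nabla X (K.R Y Z W) - K.R (K.nabla X Y) Z W - K.R Y (K.nabla X Z) W - K.R Y Z (K.nabla X W)

/-- The Lie derivative of the connection along `V`. -/
def lieNabla (V X Y : 𝒳) : 𝒳 :=
  K.br V (K.nabla X Y) - K.nabla (K.br V X) Y - K.nabla X (K.br V Y)

/-- The Lie derivative of the metric along `V`. -/
def lieMetric (V X Y : 𝒳) : 𝒜 :=
  K.D V (K.g X Y) - K.g (K.br V X) Y - K.g X (K.br V Y)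

lemma jacobi (X Y Z : 𝒳) :
    K.br X (K.br Y Z) = K.br (K.br X Y) Z + K.br Y (K.br X Z) := K.jacobi' X Y Z

@[simp] lemma D_one (X : 𝒳) : K.D X 1 = 0 := by
  have := K.D_mul X 1 1
  simp only [mul_one, one_mul] at this
  exact left_eq_add.mp this

@[simp] lemma D_natCast (X : 𝒳) (n : ℕ) : K.D X (n : 𝒜) = 0 := by
  induction n with
  | zero => simp
  | succ k ih => simp [ih]

lemma br_smul_right (X : 𝒳) (a : 𝒜) (Y : 𝒳) :
    K.br X (a • Y) = a • K.br X Y + K.D X a • Y := by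
  simp only [br, nabla_smul_right, map_smul, AddMonoidHom.smul_apply]; module

lemma br_smul_left (X : 𝒳) (a : 𝒜) (Y : 𝒳) :
    K.br (a • X) Y = a • K.br X Y - K.D Y a • X := by
  simp only [br, nabla_smul_right, map_smul, AddMonoidHom.smul_apply]; module

lemma br_add_right (X Y Z : 𝒳) : K.br X (Y + Z) = K.br X Y + K.br X Z := by
  simp only [br, map_add, AddMonoidHom.add_apply]; abel

lemma D_br (X Y : 𝒳) (a : 𝒜) : K.D (K.br X Y) a = K.D X (K.D Y a) - K.D Y (K.D X a) := by
  have h := K.jacobi X Y (a • K.xi)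
  simp only [br_smul_right, br_add_right] at h
  rw [K.jacobi X Y K.xi] at h
  have hg := congrArg (fun Z => K.g Z K.xi) h
  simp only [map_add, map_smul, LinearMap.add_apply, LinearMap.smul_apply, smul_eq_mul,
    g_xi_xi] at hg
  linear_combination -hg

/-! ### Curvature -/

lemma R_swap (X Y Z : 𝒳) : K.R X Y Z = - K.R Y X Z := by
  simp only [R, br, map_sub, AddMonoidHom.sub_apply]; abel

lemma R_smul_left (a : 𝒜) (X Y Z : 𝒳) : K.R (a • X) Y Z = a • K.R X Y Z := by
  simp only [R, br_smul_left, nabla_smul_right, map_smul, map_sub, AddMonoidHom.sub_apply,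
    AddMonoidHom.smul_apply]
  module

lemma R_smul_middle (a : 𝒜) (X Y Z : 𝒳) : K.R X (a • Y) Z = a • K.R X Y Z := by
  rw [K.R_swap, K.R_smul_left, K.R_swap Y]; module

lemma R_smul_right (a : 𝒜) (X Y Z : 𝒳) : K.R X Y (a • Z) = a • K.R X Y Z := by
  simp only [R, nabla_smul_right, map_add, D_br]
  module

/-- The curvature as a trilinear map. -/
def curv : 𝒳 →ₗ[𝒜] 𝒳 →ₗ[𝒜] 𝒳 →ₗ[𝒜] 𝒳 :=
  LinearMap.mk₂ 𝒜
    (fun X Y =>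
      { toFun := K.R X Y
        map_add' := fun Z W => by simp only [R, map_add]; abel
        map_smul' := fun a Z => K.R_smul_right a X Y Z })
    (fun X X' Y => by
      ext Z; simp only [R, br, map_add, map_sub, AddMonoidHom.add_apply, AddMonoidHom.sub_apply,
        LinearMap.coe_mk, AddHom.coe_mk, LinearMap.add_apply]; abel)
    (fun a X Y => by ext Z; exact K.R_smul_left a X Y Z)
    (fun X Y Y' => by
      ext Z; simp only [R, br, map_add, map_sub, AddMonoidHom.add_apply, AddMonoidHom.sub_apply,
        LinearMap.coe_mk, AddHom.coe_mk, LinearMap.add_apply]; abel)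
    (fun a X Y => by ext Z; exact K.R_smul_middle a X Y Z)

lemma R_eq_curv (X Y Z : 𝒳) : K.R X Y Z = K.curv X Y Z := rfl

lemma bianchi_first (X Y Z : 𝒳) : K.R X Y Z + K.R Y Z X + K.R Z X Y = 0 := by
  have h := K.jacobi' X Y Z
  simp only [R, br, map_sub, AddMonoidHom.sub_apply] at h ⊢
  linear_combination (norm := abel) h

lemma g_R_skew (X Y Z W : 𝒳) : K.g (K.R X Y Z) W = - K.g (K.R X Y W) Z := by
  have h := K.D_br X Y (K.g Z W)
  simp only [D_g, map_add] at h
  simp only [R, map_sub, LinearMap.sub_apply]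
  rw [K.g_comm (K.nabla X (K.nabla Y W)), K.g_comm (K.nabla Y (K.nabla X W)),
    K.g_comm (K.nabla (K.br X Y) W)]
  linear_combination -h

lemma g_R_pair (X Y Z W : 𝒳) : K.g (K.R X Y Z) W = K.g (K.R Z W X) Y := by
  have b (X Y Z W : 𝒳) : K.g (K.R X Y Z) W + K.g (K.R Y Z X) W + K.g (K.R Z X Y) W = 0 := by
    simpa using congrArg (fun U => K.g U W) (K.bianchi_first X Y Z)
  have s (X Y Z W : 𝒳) : K.g (K.R X Y Z) W = - K.g (K.R Y X Z) W := by
    rw [K.R_swap]; simp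
  apply K.two_cancel
  have k := K.g_R_skew
  linear_combination b X Y Z W + b Y Z W X - b Z W X Y - b W X Y Z - k Y Z W X - k Z W Y X
    - s W Y Z X + k W X Z Y + s X Z W Y - k Z X W Y + k X Y W Z + k Y W X Z

end KoszulCalculus

namespace KoszulCalculus

variable {𝒜 𝒳 : Type*} [CommRing 𝒜] [AddCommGroup 𝒳] [Module 𝒜 𝒳] (K : KoszulCalculus 𝒜 𝒳)

lemma bianchi_second (X Y Z W : 𝒳) : K.DR X Y Z W + K.DR Y Z X W + K.DR Z X Y W = 0 := by
  have h := congrArg (fun U => K.nabla U W) (K.jacobi' X Y Z)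
  simp only [DR, R, br, map_sub, map_add, AddMonoidHom.sub_apply, AddMonoidHom.add_apply] at h ⊢
  linear_combination (norm := abel) -h

lemma DR_swap (X Y Z W : 𝒳) : K.DR X Y Z W = - K.DR X Z Y W := by
  simp only [DR]
  rw [K.R_swap Y, K.R_swap (K.nabla X Y), K.R_swap Y, K.R_swap Y Z, map_neg]
  abel

lemma g_DR_skew (X Y Z U W : 𝒳) : K.g (K.DR X Y Z U) W = - K.g (K.DR X Y Z W) U := by
  have h := congrArg (K.D X) (K.g_R_skew Y Z U W)
  simp only [map_neg, D_g] at h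
  simp only [DR, map_sub, LinearMap.sub_apply]
  linear_combination h - K.g_R_skew (K.nabla X Y) Z U W - K.g_R_skew Y (K.nabla X Z) U W
    - K.g_R_skew Y Z (K.nabla X U) W - K.g_R_skew Y Z U (K.nabla X W)

/-! ### Lie derivatives along `V` -/

lemma lieNabla_comm (V X Y : 𝒳) : K.lieNabla V X Y = K.lieNabla V Y X := by
  have h := K.jacobi' V X Y
  simp only [lieNabla, br, map_sub, AddMonoidHom.sub_apply] at h ⊢
  linear_combination (norm := abel) h

/-- The covariant derivative of a `(0,2)`-tensor. -/
def DB (B : 𝒳 → 𝒳 → 𝒜) (X Y Z : 𝒳) : 𝒜 :=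
  K.D X (B Y Z) - B (K.nabla X Y) Z - B Y (K.nabla X Z)

lemma DB_lieMetric (V X Y Z : 𝒳) :
    K.DB (K.lieMetric V) X Y Z = K.g (K.lieNabla V X Y) Z + K.g Y (K.lieNabla V X Z) := by
  have h := K.D_br V X (K.g Y Z)
  simp only [DB, lieMetric, lieNabla, map_sub, D_g, map_add, LinearMap.sub_apply] at h ⊢
  linear_combination h

lemma two_mul_g_lieNabla (V X Y Z : 𝒳) :
    2 * K.g (K.lieNabla V X Y) Z = K.DB (K.lieMetric V) X Y Z + K.DB (K.lieMetric V) Y X Z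
      - K.DB (K.lieMetric V) Z X Y := by
  simp only [DB_lieMetric]
  rw [K.lieNabla_comm V Y X, K.lieNabla_comm V Z X, K.lieNabla_comm V Z Y,
    K.g_comm Y, K.g_comm X (K.lieNabla V Y Z)]
  ring

lemma br_R (V X Y Z : 𝒳) :
    K.br V (K.R X Y Z) - K.R (K.br V X) Y Z - K.R X (K.br V Y) Z - K.R X Y (K.br V Z)
      = K.nabla X (K.lieNabla V Y Z) - K.lieNabla V Y (K.nabla X Z)
        - K.nabla Y (K.lieNabla V X Z) + K.lieNabla V X (K.nabla Y Z)
        - K.lieNabla V (K.br X Y) Z := by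
  have h := congrArg (fun U => K.nabla U Z) (K.jacobi' V X Y)
  simp only [lieNabla, R, br, map_sub, map_add, AddMonoidHom.sub_apply, AddMonoidHom.add_apply]
    at h ⊢
  linear_combination (norm := abel) -h

/-! ### Traces -/

/-- The endomorphism `X ↦ ∇_X V`. -/
def nablaRight (V : 𝒳) : 𝒳 →ₗ[𝒜] 𝒳 where
  toFun X := K.nabla X V
  map_add' X Y := by simp
  map_smul' a X := by simp

lemma nablaRight_apply (V X : 𝒳) : K.nablaRight V X = K.nabla X V := rfl

section Frame

variable {ι : Type*} [Fintype ι]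

/-- An orthonormal frame. -/
structure IsOrthonormalFrame [DecidableEq ι] (e : ι → 𝒳) : Prop where
  expand : ∀ X, X = ∑ i, K.g X (e i) • e i
  orthonormal : ∀ i j, K.g (e i) (e j) = if i = j then 1 else 0

variable {K} {e : ι → 𝒳} [DecidableEq ι]

namespace IsOrthonormalFrame

lemma sum_g_mul (he : K.IsOrthonormalFrame e) (X Y : 𝒳) : ∑ i, K.g X (e i) * K.g Y (e i) = K.g X Y := by
  conv_rhs => rw [he.expand Y]
  simp [mul_comm]

lemma sum_g_self (he : K.IsOrthonormalFrame e) : ∑ i, K.g (e i) (e i) = (Fintype.card ι : 𝒜) := by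
  simp [he.orthonormal]

lemma sum_apply (he : K.IsOrthonormalFrame e) (f : 𝒳 →ₗ[𝒜] 𝒜) (X : 𝒳) : ∑ i, K.g X (e i) * f (e i) = f X := by
  conv_rhs => rw [he.expand X]
  simp

lemma sum_nabla (he : K.IsOrthonormalFrame e) (B : 𝒳 →ₗ[𝒜] 𝒳 →ₗ[𝒜] 𝒜) (X : 𝒳) :
    ∑ i, (B (K.nabla X (e i)) (e i) + B (e i) (K.nabla X (e i))) = 0 := by
  have h1 (i) : B (K.nabla X (e i)) (e i) = ∑ j, K.g (K.nabla X (e i)) (e j) * B (e j) (e i) :=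
    (he.sum_apply (B.flip (e i)) _).symm
  have h2 (i) : B (e i) (K.nabla X (e i)) = ∑ j, K.g (K.nabla X (e i)) (e j) * B (e i) (e j) :=
    (he.sum_apply (B (e i)) _).symm
  have h3 (i j) : K.g (K.nabla X (e i)) (e j) = - K.g (K.nabla X (e j)) (e i) := by
    have := K.D_g X (e i) (e j)
    rw [he.orthonormal, K.g_comm (e i)] at this
    have h0 : K.D X (if i = j then (1 : 𝒜) else 0) = 0 := by split_ifs <;> simp
    linear_combination h0 - this
  simp only [h1, h2, Finset.sum_add_distrib]
  rw [Finset.sum_comm, ← Finset.sum_add_distrib]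
  refine Finset.sum_eq_zero fun i _ => ?_
  rw [← Finset.sum_add_distrib]
  refine Finset.sum_eq_zero fun j _ => ?_
  rw [h3 i j]; ring

/-- Two linear endomorphisms have commuting traces. -/
lemma sum_comp_comm (he : K.IsOrthonormalFrame e) (A B : 𝒳 →ₗ[𝒜] 𝒳) :
    ∑ i, K.g (A (B (e i))) (e i) = ∑ i, K.g (B (A (e i))) (e i) := by
  have h (A B : 𝒳 →ₗ[𝒜] 𝒳) (i) :
      K.g (A (B (e i))) (e i) = ∑ j, K.g (B (e i)) (e j) * K.g (A (e j)) (e i) :=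
    (he.sum_apply ((K.g.flip (e i)).comp A) _).symm
  simp only [h]
  rw [Finset.sum_comm]
  simp only [mul_comm]

end IsOrthonormalFrame

end Frame

section Ricci

variable {ι : Type*} [Fintype ι] {K} {e : ι → 𝒳}

variable (K) in
/-- The Ricci tensor, computed in the frame `e`. -/
def ric (e : ι → 𝒳) (Y Z : 𝒳) : 𝒜 := ∑ i, K.g (K.R (e i) Y Z) (e i)

variable (K) in
/-- The scalar curvature, computed in the frame `e`. -/
def scal (e : ι → 𝒳) : 𝒜 := ∑ i, K.ric e (e i) (e i)

variable (K e) in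
/-- The Ricci tensor as a bilinear map. -/
def ricLin : 𝒳 →ₗ[𝒜] 𝒳 →ₗ[𝒜] 𝒜 :=
  LinearMap.mk₂ 𝒜 (fun Y Z => K.ric e Y Z)
    (fun X X' Y => by simp [ric, R_eq_curv, Finset.sum_add_distrib])
    (fun a X Y => by simp [ric, R_eq_curv, Finset.mul_sum])
    (fun X Y Y' => by simp [ric, R_eq_curv, Finset.sum_add_distrib])
    (fun a X Y => by simp [ric, R_eq_curv, Finset.mul_sum])

lemma ric_eq_ricLin (Y Z : 𝒳) : K.ric e Y Z = K.ricLin e Y Z := rfl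

lemma ric_comm (Y Z : 𝒳) : K.ric e Y Z = K.ric e Z Y := by
  refine Finset.sum_congr rfl fun i _ => ?_
  rw [K.g_R_pair, K.R_swap, map_neg, LinearMap.neg_apply, K.g_R_skew, neg_neg]

variable [DecidableEq ι]

lemma sum_g_DR (he : K.IsOrthonormalFrame e) (X Y Z : 𝒳) :
    ∑ i, K.g (K.DR X (e i) Y Z) (e i) = K.DB (K.ric e) X Y Z := by
  have h := he.sum_nabla (K.g.comp ((K.curv.flip Y).flip Z)) X
  simp only [DB, ric, DR, map_sum, D_g, map_sub, LinearMap.sub_apply, Finset.sum_sub_distrib,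
    Finset.sum_add_distrib] at h ⊢
  simp only [LinearMap.comp_apply, LinearMap.flip_apply, ← R_eq_curv] at h
  linear_combination -h

lemma sum_DB_ric (he : K.IsOrthonormalFrame e) (X : 𝒳) :
    ∑ i, K.DB (K.ric e) X (e i) (e i) = K.D X (K.scal e) := by
  have h := he.sum_nabla (K.ricLin e) X
  simp only [← ric_eq_ricLin] at h
  simp only [DB, scal, map_sum, Finset.sum_sub_distrib, Finset.sum_add_distrib] at h ⊢
  linear_combination -h

/-- The contracted second Bianchi identity. -/
lemma two_mul_div_ric (he : K.IsOrthonormalFrame e) (X : 𝒳) :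
    2 * ∑ i, K.DB (K.ric e) (e i) X (e i) = K.D X (K.scal e) := by
  have b (i j) : K.g (K.DR X (e i) (e j) (e j)) (e i) + K.g (K.DR (e i) (e j) X (e j)) (e i)
      + K.g (K.DR (e j) X (e i) (e j)) (e i) = 0 := by
    simpa using congrArg (fun U => K.g U (e i)) (K.bianchi_second X (e i) (e j) (e j))
  have hsum : ∑ j, ∑ i, (K.g (K.DR X (e i) (e j) (e j)) (e i)
      + K.g (K.DR (e i) (e j) X (e j)) (e i) + K.g (K.DR (e j) X (e i) (e j)) (e i)) = 0 :=
    Finset.sum_eq_zero fun j _ => Finset.sum_eq_zero fun i _ => b i j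
  simp only [Finset.sum_add_distrib] at hsum
  have h1 : ∑ j, ∑ i, K.g (K.DR X (e i) (e j) (e j)) (e i) = K.D X (K.scal e) := by
    simp only [sum_g_DR he, sum_DB_ric he]
  have h2 : ∑ j, ∑ i, K.g (K.DR (e i) (e j) X (e j)) (e i)
      = - ∑ i, K.DB (K.ric e) (e i) X (e i) := by
    rw [Finset.sum_comm, ← Finset.sum_neg_distrib]
    refine Finset.sum_congr rfl fun i _ => ?_
    rw [← sum_g_DR he, ← Finset.sum_neg_distrib]
    exact Finset.sum_congr rfl fun j _ => K.g_DR_skew _ _ _ _ _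
  have h3 : ∑ j, ∑ i, K.g (K.DR (e j) X (e i) (e j)) (e i)
      = - ∑ i, K.DB (K.ric e) (e i) X (e i) := by
    rw [← Finset.sum_neg_distrib]
    refine Finset.sum_congr rfl fun i _ => ?_
    rw [← sum_g_DR he, ← Finset.sum_neg_distrib]
    refine Finset.sum_congr rfl fun j _ => ?_
    rw [K.DR_swap]; simp
  rw [h1, h2, h3] at hsum
  linear_combination -hsum

/-- The Lie derivative of the Ricci tensor is the trace of the Lie derivative of the curvature. -/
lemma sum_g_br_R (he : K.IsOrthonormalFrame e) (V Y Z : 𝒳) :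
    ∑ i, K.g (K.br V (K.R (e i) Y Z) - K.R (K.br V (e i)) Y Z - K.R (e i) (K.br V Y) Z
        - K.R (e i) Y (K.br V Z)) (e i)
      = K.D V (K.ric e Y Z) - K.ric e (K.br V Y) Z - K.ric e Y (K.br V Z) := by
  have h := he.sum_nabla (K.g.comp ((K.curv.flip Y).flip Z)) V
  have hcomm := he.sum_comp_comm (K.nablaRight V) ((K.curv.flip Y).flip Z)
  simp only [LinearMap.comp_apply, LinearMap.flip_apply, nablaRight_apply, ← R_eq_curv,
    Finset.sum_add_distrib] at h hcomm
  have hb (X : 𝒳) : K.R (K.br V X) Y Z = K.R (K.nabla V X) Y Z - K.R (K.nabla X V) Y Z := by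
    simp [R_eq_curv, br]
  have hb' (W : 𝒳) : K.br V W = K.nabla V W - K.nabla W V := rfl
  simp only [hb, hb' (K.R _ Y Z), ric, map_sum, map_sub, D_g, LinearMap.sub_apply,
    Finset.sum_sub_distrib, Finset.sum_add_distrib]
  linear_combination -h - hcomm

end Ricci

end KoszulCalculus

namespace KoszulCalculus

variable {𝒜 𝒳 : Type*} [CommRing 𝒜] [AddCommGroup 𝒳] [Module 𝒜 𝒳] {K : KoszulCalculus 𝒜 𝒳}
  {ι : Type*} [Fintype ι] {e : ι → 𝒳}

lemma lieNabla_smul_right (V X : 𝒳) (a : 𝒜) (Y : 𝒳) :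
    K.lieNabla V X (a • Y) = a • K.lieNabla V X Y := by
  simp only [lieNabla, nabla_smul_right, br_smul_right, br_add_right, map_add, D_br]
  module

lemma lieNabla_add_right (V X Y Z : 𝒳) :
    K.lieNabla V X (Y + Z) = K.lieNabla V X Y + K.lieNabla V X Z := by
  simp only [lieNabla, br_add_right, map_add]
  abel

lemma DB_ric_comm (X Y Z : 𝒳) : K.DB (K.ric e) X Y Z = K.DB (K.ric e) X Z Y := by
  simp only [DB]
  rw [ric_comm Y, ric_comm (K.nabla X Y), ric_comm Y]
  ring

section Kenmotsu

variable [DecidableEq ι]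

lemma DB_eta_eta (hxi : ∀ X, K.nabla X K.xi = X - K.g X K.xi • K.xi) (X Y Z : 𝒳) :
    K.DB (fun Y Z => K.g Y K.xi * K.g Z K.xi) X Y Z
      = (K.g X Y - K.g X K.xi * K.g Y K.xi) * K.g Z K.xi
        + K.g Y K.xi * (K.g X Z - K.g X K.xi * K.g Z K.xi) := by
  simp only [DB, D_mul, D_g, hxi, map_sub, map_smul, smul_eq_mul]
  rw [K.g_comm Y X, K.g_comm Z X]
  ring

lemma R_xi (hxi : ∀ X, K.nabla X K.xi = X - K.g X K.xi • K.xi) (X Y : 𝒳) :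
    K.R X Y K.xi = K.g X K.xi • Y - K.g Y K.xi • X := by
  simp only [R, br, hxi, map_sub, map_smul, nabla_smul_right, D_g,
    AddMonoidHom.sub_apply, smul_eq_mul]
  rw [K.g_comm Y X]
  module

lemma R_middle_xi (hxi : ∀ X, K.nabla X K.xi = X - K.g X K.xi • K.xi)
    (he : K.IsOrthonormalFrame e) (Y Z : 𝒳) :
    K.R Y K.xi Z = K.g Y Z • K.xi - K.g Z K.xi • Y := by
  rw [he.expand (K.R Y K.xi Z), he.expand (K.g Y Z • K.xi - K.g Z K.xi • Y)]
  refine Finset.sum_congr rfl fun i _ => ?_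
  rw [K.g_R_pair, K.g_comm, ← K.g_comm, K.g_R_skew, R_xi hxi]
  simp only [map_sub, map_smul, LinearMap.sub_apply, LinearMap.smul_apply, smul_eq_mul]
  rw [K.g_comm (e i) K.xi, K.g_comm (e i) Y, K.g_comm Z Y]
  congr 1
  ring

lemma ric_xi (hxi : ∀ X, K.nabla X K.xi = X - K.g X K.xi • K.xi)
    (he : K.IsOrthonormalFrame e) {m : 𝒜} (hm : (Fintype.card ι : 𝒜) = m + 1) (Y : 𝒳) :
    K.ric e Y K.xi = - m * K.g Y K.xi := by
  have h := he.sum_g_mul Y K.xi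
  have h' := he.sum_g_self
  simp only [ric, R_xi hxi, map_sub, map_smul, LinearMap.sub_apply, LinearMap.smul_apply,
    smul_eq_mul, Finset.sum_sub_distrib, ← Finset.mul_sum]
  rw [h', hm]
  simp only [K.g_comm K.xi, mul_comm (K.g Y _)] at h
  rw [h]
  ring

lemma DB_ric_xi (hxi : ∀ X, K.nabla X K.xi = X - K.g X K.xi • K.xi)
    (he : K.IsOrthonormalFrame e) {m : 𝒜} (hm : (Fintype.card ι : 𝒜) = m + 1)
    (X Y : 𝒳) : K.DB (K.ric e) X Y K.xi = - m * K.g X Y - K.ric e X Y := by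
  have hDm : K.D X m = 0 := by
    have := congrArg (K.D X) hm
    simpa using this.symm
  have h1 : K.ric e Y (K.nabla X K.xi) = K.ric e Y X - K.g X K.xi * K.ric e Y K.xi := by
    rw [hxi]; simp [ric_eq_ricLin]
  rw [DB, h1]
  simp only [ric_xi hxi he hm, D_mul, D_g, hxi, map_sub, map_neg, map_smul, smul_eq_mul,
    hDm]
  rw [ric_comm Y X, K.g_comm Y X]
  ring

lemma DB_ric_along_xi (hxi : ∀ X, K.nabla X K.xi = X - K.g X K.xi • K.xi)
    (he : K.IsOrthonormalFrame e) {m : 𝒜} (hm : (Fintype.card ι : 𝒜) = m + 1) (Y Z : 𝒳) :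
    K.DB (K.ric e) K.xi Y Z = - 2 * m * K.g Y Z - 2 * K.ric e Y Z := by
  have b (i) : K.g (K.DR K.xi (e i) Y Z) (e i) + K.g (K.DR (e i) Y K.xi Z) (e i)
      + K.g (K.DR Y K.xi (e i) Z) (e i) = 0 := by
    simpa using congrArg (fun U => K.g U (e i)) (K.bianchi_second K.xi (e i) Y Z)
  have b' := Finset.sum_eq_zero (s := Finset.univ) fun i _ => b i
  simp only [Finset.sum_add_distrib] at b'
  have h3 : ∑ i, K.g (K.DR Y K.xi (e i) Z) (e i) = m * K.g Y Z + K.ric e Y Z := by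
    have : ∑ i, K.g (K.DR Y K.xi (e i) Z) (e i) = - K.DB (K.ric e) Y K.xi Z := by
      rw [← sum_g_DR he, ← Finset.sum_neg_distrib]
      refine Finset.sum_congr rfl fun i _ => ?_
      rw [K.DR_swap]; simp
    rw [this, DB_ric_comm, DB_ric_xi hxi he hm]
    ring
  have hDR (X : 𝒳) : K.DR X Y K.xi Z = K.g Y Z • (X - K.g X K.xi • K.xi)
      - (K.g X Z - K.g X K.xi * K.g Z K.xi) • Y + K.R X Y Z
      + K.g X K.xi • (K.g Y Z • K.xi - K.g Z K.xi • Y) := by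
    have hR (W) : K.R Y W Z = K.curv Y W Z := rfl
    have h1 : K.R Y (K.nabla X K.xi) Z = - K.R X Y Z
        - K.g X K.xi • (K.g Y Z • K.xi - K.g Z K.xi • Y) := by
      rw [hxi, hR, map_sub, map_smul, LinearMap.sub_apply, LinearMap.smul_apply, ← hR, ← hR,
        R_middle_xi hxi he, K.R_swap Y X]
    simp only [DR, h1, R_middle_xi hxi he, map_sub, nabla_smul_right, D_g]
    simp only [hxi, map_sub, map_smul, smul_eq_mul]
    rw [K.g_comm Z X]
    module
  have h2 : ∑ i, K.g (K.DR (e i) Y K.xi Z) (e i) = m * K.g Y Z + K.ric e Y Z := by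
    have s1 := he.sum_g_self
    rw [hm] at s1
    have s2 := he.sum_g_mul Z Y
    have : ∀ i, K.g (K.DR (e i) Y K.xi Z) (e i)
        = K.g Y Z * K.g (e i) (e i) - K.g Z (e i) * K.g Y (e i) + K.g (K.R (e i) Y Z) (e i) := by
      intro i
      rw [hDR]
      simp only [map_sub, map_smul, map_add, LinearMap.sub_apply, LinearMap.smul_apply,
        LinearMap.add_apply, smul_eq_mul]
      rw [K.g_comm (e i) K.xi, K.g_comm (e i) Z]
      ring
    simp only [this, Finset.sum_add_distrib, Finset.sum_sub_distrib, ← Finset.mul_sum]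
    rw [s1, s2, K.g_comm Z Y, ric]
    ring
  rw [sum_g_DR he, h2, h3] at b'
  linear_combination b'

lemma g_lieNabla_xi (hxi : ∀ X, K.nabla X K.xi = X - K.g X K.xi • K.xi)
    (he : K.IsOrthonormalFrame e) {m : 𝒜} (hm : (Fintype.card ι : 𝒜) = m + 1)
    {V : 𝒳} {c mu : 𝒜} (hc : ∀ X, K.D X c = 0) (hmu : ∀ X, K.D X mu = 0)
    (hsol : ∀ X Y, K.lieMetric V X Y + 2 * K.ric e X Y + c * K.g X Y
      + 2 * mu * (K.g X K.xi * K.g Y K.xi) = 0) (X Z : 𝒳) :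
    K.g (K.lieNabla V X K.xi) Z = 2 * K.ric e X Z + 2 * m * K.g X Z := by
  have hh : K.lieMetric V = fun X Y => - (2 * K.ric e X Y + c * K.g X Y
      + 2 * mu * (K.g X K.xi * K.g Y K.xi)) := by
    funext X Y
    linear_combination hsol X Y
  have hD2 (X : 𝒳) : K.D X 2 = 0 := by exact_mod_cast K.D_natCast X 2
  have hDB (X Y Z : 𝒳) : K.DB (K.lieMetric V) X Y Z = - 2 * K.DB (K.ric e) X Y Z
      - 2 * mu * ((K.g X Y - K.g X K.xi * K.g Y K.xi) * K.g Z K.xi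
        + K.g Y K.xi * (K.g X Z - K.g X K.xi * K.g Z K.xi)) := by
    rw [← DB_eta_eta hxi, hh]
    simp only [DB, map_neg, map_add, D_mul, hc, hmu, hD2, D_g]
    ring
  apply K.two_cancel
  rw [two_mul_g_lieNabla, hDB, hDB, hDB, DB_ric_along_xi hxi he hm, DB_ric_comm X K.xi,
    DB_ric_xi hxi he hm, DB_ric_xi hxi he hm, ric_comm Z X, K.g_comm Z X, K.g_comm K.xi X,
    K.g_comm K.xi Z, K.g_xi_xi]
  ring

/-- The algebraic form of the theorem: the Lie derivative of the Ricci tensor of a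
conformal `η`-Ricci soliton on a Kenmotsu manifold. -/
theorem lie_ric_xi (hxi : ∀ X, K.nabla X K.xi = X - K.g X K.xi • K.xi)
    (he : K.IsOrthonormalFrame e) {m : 𝒜} (hm : (Fintype.card ι : 𝒜) = m + 1)
    {V : 𝒳} {c mu : 𝒜} (hc : ∀ X, K.D X c = 0) (hmu : ∀ X, K.D X mu = 0)
    (hsol : ∀ X Y, K.lieMetric V X Y + 2 * K.ric e X Y + c * K.g X Y
      + 2 * mu * (K.g X K.xi * K.g Y K.xi) = 0) (Y : 𝒳) :
    K.D V (K.ric e Y K.xi) - K.ric e (K.br V Y) K.xi - K.ric e Y (K.br V K.xi)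
      = -2 * (K.scal e + m * (m + 1)) * K.g Y K.xi - K.D Y (K.scal e) := by
  have hT := g_lieNabla_xi hxi he hm hc hmu hsol
  have hDm (X) : K.D X m = 0 := by
    have := congrArg (K.D X) hm
    simpa using this.symm
  have hD2 (X : 𝒳) : K.D X 2 = 0 := by exact_mod_cast K.D_natCast X 2
  have hTs (X Y : 𝒳) : K.lieNabla V X (K.nabla Y K.xi)
      = K.lieNabla V X Y - K.g Y K.xi • K.lieNabla V X K.xi := by
    rw [hxi, sub_eq_add_neg, ← neg_smul, lieNabla_add_right, lieNabla_smul_right, neg_smul,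
      ← sub_eq_add_neg]
  have hn (X Y Z : 𝒳) : K.g (K.nabla X (K.lieNabla V Y K.xi)) Z
      = 2 * K.DB (K.ric e) X Y Z + 2 * K.ric e (K.nabla X Y) Z + 2 * m * K.g (K.nabla X Y) Z := by
    have h1 := congrArg (K.D X) (hT Y Z)
    simp only [D_g, map_add, D_mul, hDm, hD2] at h1
    simp only [DB]
    linear_combination h1 - hT Y (K.nabla X Z)
  rw [← sum_g_br_R he]
  have key (i) : K.g (K.br V (K.R (e i) Y K.xi) - K.R (K.br V (e i)) Y K.xi
        - K.R (e i) (K.br V Y) K.xi - K.R (e i) Y (K.br V K.xi)) (e i)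
      = 2 * K.DB (K.ric e) (e i) Y (e i) - 2 * K.DB (K.ric e) Y (e i) (e i)
        + 2 * (K.g K.xi (e i) * K.ricLin e Y (e i)) + 2 * m * (K.g K.xi (e i) * K.g Y (e i))
        - K.g Y K.xi * (2 * K.ric e (e i) (e i) + 2 * m * K.g (e i) (e i)) := by
    have hb : K.ric e (K.br (e i) Y) (e i)
        = K.ric e (K.nabla (e i) Y) (e i) - K.ric e (K.nabla Y (e i)) (e i) := by
      simp [ric_eq_ricLin, br]
    have hb' : K.g (K.br (e i) Y) (e i)
        = K.g (K.nabla (e i) Y) (e i) - K.g (K.nabla Y (e i)) (e i) := by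
      simp [br]
    rw [br_R, hTs, hTs, K.lieNabla_comm V Y (e i)]
    simp only [map_sub, map_add, map_smul, LinearMap.sub_apply, LinearMap.add_apply,
      LinearMap.smul_apply, smul_eq_mul, hn, hT, hb, hb']
    rw [← ric_eq_ricLin, K.g_comm (e i) K.xi]
    ring
  have s1 := he.sum_apply (K.ricLin e Y) K.xi
  have s2 := he.sum_g_mul K.xi Y
  have s3 := two_mul_div_ric he Y
  have s4 := sum_DB_ric he Y
  have s5 := he.sum_g_self
  rw [hm] at s5
  rw [← ric_eq_ricLin, ric_xi hxi he hm] at s1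
  rw [K.g_comm K.xi Y] at s2
  simp only [key, Finset.sum_add_distrib, Finset.sum_sub_distrib, ← Finset.mul_sum, s1, s2, s3, s4,
    s5]
  rw [scal]
  ring

end Kenmotsu

end KoszulCalculus

noncomputable section

section Smooth

variable {E : Type*} [NormedAddCommGroup E] [NormedSpace ℝ E]
  {H : Type*} [TopologicalSpace H] {I : ModelWithCorners ℝ E H}
  {M : Type*} [TopologicalSpace M] [ChartedSpace H M] [IsManifold I ∞ M]

variable (I) in
/-- `X` is a vector field which is smooth on `U`. -/
def SmoothFieldOn (U : Set M) (X : Π x : M, TangentSpace I x) : Prop :=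
  ContMDiffOn I I.tangent ∞ (fun x => (⟨x, X x⟩ : TangentBundle I M)) U

lemma IsSmoothVectorField.smoothFieldOn {X : Π x : M, TangentSpace I x}
    (hX : IsSmoothVectorField X) (U : Set M) : SmoothFieldOn I U X :=
  ContMDiff.contMDiffOn hX

namespace SmoothFieldOn

variable {U W : Set M} {X Y Z : Π x : M, TangentSpace I x} {x : M}

lemma mono (hX : SmoothFieldOn I U X) (h : W ⊆ U) : SmoothFieldOn I W X := ContMDiffOn.mono hX h

lemma contMDiffAt (hX : SmoothFieldOn I U X) (hU : IsOpen U) (hx : x ∈ U) :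
    ContMDiffAt I I.tangent ∞ (fun x => (⟨x, X x⟩ : TangentBundle I M)) x :=
  ContMDiffOn.contMDiffAt hX (hU.mem_nhds hx)

lemma mdifferentiableAt (hX : SmoothFieldOn I U X) (hU : IsOpen U) (hx : x ∈ U) :
    MDifferentiableAt I I.tangent (fun x => (⟨x, X x⟩ : TangentBundle I M)) x :=
  (hX.contMDiffAt hU hx).mdifferentiableAt (by simp)

lemma congr (hX : SmoothFieldOn I U X) (h : ∀ x ∈ U, Y x = X x) : SmoothFieldOn I U Y :=
  ContMDiffOn.congr hX fun x hx => by rw [h x hx]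

lemma sub (hX : SmoothFieldOn I U X) (hY : SmoothFieldOn I U Y) : SmoothFieldOn I U (X - Y) :=
  ContMDiffOn.sub_section hX hY

lemma add (hX : SmoothFieldOn I U X) (hY : SmoothFieldOn I U Y) : SmoothFieldOn I U (X + Y) :=
  ContMDiffOn.add_section hX hY

lemma smul {f : M → ℝ} (hX : SmoothFieldOn I U X) (hf : ContMDiffOn I 𝓘(ℝ) ∞ f U) :
    SmoothFieldOn I U (f • X) :=
  ContMDiffOn.smul_section hf hX

lemma sum {ι : Type*} {s : Finset ι} {X : ι → Π x : M, TangentSpace I x}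
    (hX : ∀ i ∈ s, SmoothFieldOn I U (X i)) : SmoothFieldOn I U (fun x => ∑ i ∈ s, X i x) :=
  ContMDiffOn.sum_section hX

variable {cov : CovariantDerivative I E (TangentSpace I : M → Type _)}

lemma cov_congr (hX : SmoothFieldOn I U X) (hY : SmoothFieldOn I U Y) (hU : IsOpen U)
    (h : ∀ y ∈ U, X y = Y y) (hx : x ∈ U) : cov X x = cov Y x :=
  cov.isCovariantDerivativeOn.congr_of_eqOn (hX.mdifferentiableAt hU hx)
    (hY.mdifferentiableAt hU hx) (hU.mem_nhds hx) h

section FiniteDimensional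

variable [FiniteDimensional ℝ E]

/-- A vector field which is smooth near `x` agrees near `x` with a global smooth one. -/
lemma exists_global [T2Space M] (hX : SmoothFieldOn I U X) (hU : IsOpen U) (hx : x ∈ U) :
    ∃ X' : Π x : M, TangentSpace I x, IsSmoothVectorField X' ∧ ∀ᶠ y in 𝓝 x, X' y = X y := by
  obtain ⟨f, -, hf⟩ := (SmoothBumpFunction.nhds_basis_tsupport (I := I) x).mem_iff.1
    (hU.mem_nhds hx)
  refine ⟨(f : M → ℝ) • X, fun y => ?_, ?_⟩
  · by_cases hy : y ∈ U
    · exact ContMDiffAt.smul_section (f.contMDiff y) (hX.contMDiffAt hU hy)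
    · have h0 : ∀ᶠ z in 𝓝 y, f z = 0 := by
        have : y ∉ tsupport f := fun h => hy (hf h)
        exact notMem_tsupport_iff_eventuallyEq.1 this
      refine (contMDiff_zeroSection ℝ (TangentSpace I : M → Type _) y).congr_of_eventuallyEq ?_
      filter_upwards [h0] with z hz
      simp [hz, zeroSection]
  · filter_upwards [f.eventuallyEq_one] with y hy
    simp [hy]

/-- The covariant derivative of a field which is smooth on `U` is smooth on `U`. -/
lemma contMDiffAt_cov [T2Space M]
    (hcov : CovariantDerivative.ContMDiffCovariantDerivative cov ∞) (hX : SmoothFieldOn I U X)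
    (hU : IsOpen U) (hx : x ∈ U) :
    ContMDiffAt I (I.prod 𝓘(ℝ, E →L[ℝ] E)) ∞ (fun x => TotalSpace.mk' (E →L[ℝ] E)
      (E := fun x : M => TangentSpace I x →L[ℝ] TangentSpace I x) x (cov X x)) x := by
  obtain ⟨X', hX', h⟩ := hX.exists_global hU hx
  have h1 := hcov.contMDiff.contMDiff (σ := X') (ContMDiff.contMDiffOn (by simpa using! hX'))
  refine (h1.contMDiffAt Filter.univ_mem).congr_of_eventuallyEq ?_
  obtain ⟨W, hW, hWo, hxW⟩ := eventually_nhds_iff.1 h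
  filter_upwards [(hWo.inter hU).mem_nhds ⟨hxW, hx⟩] with y hy
  have : cov X y = cov X' y :=
    cov_congr (hX.mono Set.inter_subset_right) (hX'.smoothFieldOn (W ∩ U)) (hWo.inter hU)
      (fun z hz => (hW z hz.1).symm) hy
  rw [this]

lemma cov_apply [T2Space M] (hcov : CovariantDerivative.ContMDiffCovariantDerivative cov ∞)
    (hX : SmoothFieldOn I U X) (hY : SmoothFieldOn I U Y) (hU : IsOpen U) :
    SmoothFieldOn I U (fun y => cov Y y (X y)) := fun _ hy =>
  ((hY.contMDiffAt_cov hcov hU hy).clm_bundle_apply (hX.contMDiffAt hU hy)).contMDiffWithinAt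

end FiniteDimensional

section Metric

variable [RiemannianBundle (fun x : M => TangentSpace I x)]
  [IsContMDiffRiemannianBundle I ∞ E (fun x : M => TangentSpace I x)]

lemma inner (hX : SmoothFieldOn I U X) (hY : SmoothFieldOn I U Y) :
    ContMDiffOn I 𝓘(ℝ) ∞ (fun x => ⟪X x, Y x⟫_ℝ) U :=
  ContMDiffOn.inner_bundle (E := fun x : M => TangentSpace I x) hX hY

lemma gramSchmidt {ι : Type*} [LinearOrder ι] [LocallyFiniteOrderBot ι] [WellFoundedLT ι]
    {X : ι → Π x : M, TangentSpace I x} (hX : ∀ i, SmoothFieldOn I U (X i))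
    (hli : ∀ x ∈ U, LinearIndependent ℝ (fun i => X i x)) (i : ι) :
    SmoothFieldOn I U (fun x => InnerProductSpace.gramSchmidt ℝ (fun i => X i x) i) := by
  induction i using WellFoundedLT.induction with
  | ind i ih =>
    have h : SmoothFieldOn I U (X i - fun x => ∑ j ∈ Finset.Iio i,
        ((fun x => ⟪InnerProductSpace.gramSchmidt ℝ (fun i => X i x) j, X i x⟫_ℝ
          / ⟪InnerProductSpace.gramSchmidt ℝ (fun i => X i x) j,
            InnerProductSpace.gramSchmidt ℝ (fun i => X i x) j⟫_ℝ) •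
          fun x => InnerProductSpace.gramSchmidt ℝ (fun i => X i x) j) x) := by
      refine (hX i).sub (sum fun j hj => smul (ih j (by simpa using hj)) ?_)
      have hj' := ih j (by simpa using hj)
      refine (hj'.inner (hX i)).div₀ (hj'.inner hj') fun x hx => ?_
      rw [inner_self_ne_zero]
      exact InnerProductSpace.gramSchmidt_ne_zero _ (hli x hx)
    refine h.congr fun x hx => ?_
    rw [InnerProductSpace.gramSchmidt_def]
    simp [Submodule.starProjection_singleton]

variable [FiniteDimensional ℝ E]

lemma mvfderiv_apply [T2Space M] (hcov : CovariantDerivative.ContMDiffCovariantDerivative cov ∞)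
    (hX : SmoothFieldOn I U X) (hZ : SmoothFieldOn I U Z) (hU : IsOpen U)
    (hZ1 : ∀ x, ⟪Z x, Z x⟫_ℝ = 1) {f : M → ℝ} (hf : ContMDiffOn I 𝓘(ℝ) ∞ f U) :
    ContMDiffOn I 𝓘(ℝ) ∞ (fun x => mvfderiv I f x (X x)) U := by
  have h := ((hX.cov_apply hcov (hZ.smul hf) hU).sub
    ((hX.cov_apply hcov hZ hU).smul hf)).inner hZ
  refine h.congr fun y hy => ?_
  have := cov.isCovariantDerivativeOnUniv.leibniz (hZ.mdifferentiableAt hU hy)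
    ((hf.contMDiffAt (hU.mem_nhds hy)).mdifferentiableAt (by simp))
  simp [this, inner_smul_left, -inner_self_eq_norm_sq_to_K, hZ1]

/-- Near every point there is a smooth orthonormal frame. -/
lemma exists_orthonormal_frame (x : M) : ∃ (U : Set M)
    (e : Fin (Module.finrank ℝ E) → Π x : M, TangentSpace I x), IsOpen U ∧ x ∈ U ∧
      (∀ i, SmoothFieldOn I U (e i)) ∧ ∀ y ∈ U, Orthonormal ℝ (fun i => e i y) := by
  let t := trivializationAt E (TangentSpace I : M → Type _) x
  let b := Module.finBasis ℝ E
  have ht := t.isLocalFrameOn_localFrame_baseSet I ∞ b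
  have hgs := gramSchmidt (U := t.baseSet) ht.contMDiffOn (fun y hy => ht.linearIndependent hy)
  refine ⟨t.baseSet, fun i y => InnerProductSpace.gramSchmidtNormed ℝ
    (fun i => t.localFrame b i y) i, t.open_baseSet,
    FiberBundle.mem_baseSet_trivializationAt' x, fun i => ?_, fun y hy =>
    InnerProductSpace.gramSchmidtNormed_orthonormal (ht.linearIndependent hy)⟩
  have hne : ∀ y ∈ t.baseSet,
      InnerProductSpace.gramSchmidt ℝ (fun i => t.localFrame b i y) i ≠ 0 := fun y hy =>
    InnerProductSpace.gramSchmidt_ne_zero _ (ht.linearIndependent hy)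
  have hn : ContMDiffOn I 𝓘(ℝ) ∞ (fun y => (√⟪InnerProductSpace.gramSchmidt ℝ
      (fun i => t.localFrame b i y) i, InnerProductSpace.gramSchmidt ℝ
      (fun i => t.localFrame b i y) i⟫_ℝ)⁻¹) t.baseSet := by
    intro y hy
    have h1 := (hgs i).inner (hgs i) y hy
    have h0 : ⟪InnerProductSpace.gramSchmidt ℝ (fun i => t.localFrame b i y) i,
        InnerProductSpace.gramSchmidt ℝ (fun i => t.localFrame b i y) i⟫_ℝ ≠ 0 :=
      inner_self_ne_zero.2 (hne y hy)
    have h2 : ContDiffAt ℝ ∞ (fun r : ℝ => (√r)⁻¹) _ :=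
      (Real.contDiffAt_sqrt (n := ∞) h0).inv (by
        rw [Real.sqrt_ne_zero']
        exact real_inner_self_pos.2 (hne y hy))
    exact ContMDiffAt.comp_contMDiffWithinAt (g := fun r : ℝ => (√r)⁻¹) y h2.contMDiffAt h1
  refine ((hgs i).smul hn).congr fun y hy => ?_
  simp only [InnerProductSpace.gramSchmidtNormed, Pi.smul_apply', norm_eq_sqrt_real_inner]
  rfl

end Metric

end SmoothFieldOn

end Smooth

end

noncomputable section

section ZeroExtend

variable {M : Type*} [TopologicalSpace M] {F : M → Type*} [∀ x, Zero (F x)]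

open scoped Classical in
/-- The extension by zero of a section over the open set `U`. -/
def zeroExtend {U : TopologicalSpace.Opens M} (X : Π y : U, F y) (x : M) : F x :=
  if h : x ∈ U then X ⟨x, h⟩ else 0

variable {U : TopologicalSpace.Opens M}

lemma zeroExtend_of_mem (X : Π y : U, F y) {x : M} (h : x ∈ U) : zeroExtend X x = X ⟨x, h⟩ :=
  dif_pos h

@[simp] lemma zeroExtend_coe (X : Π y : U, F y) (y : U) : zeroExtend X (y : M) = X y :=
  zeroExtend_of_mem X y.2

end ZeroExtend

section LocalCalculus

variable {E : Type*} [NormedAddCommGroup E] [NormedSpace ℝ E]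
  {H : Type*} [TopologicalSpace H] {I : ModelWithCorners ℝ E H}
  {M : Type*} [TopologicalSpace M] [ChartedSpace H M] {U : TopologicalSpace.Opens M}

variable (I U) in
/-- The ring of smooth functions on the open set `U`. -/
def SmoothFn : Subring (U → ℝ) where
  carrier := {f | ContMDiffOn I 𝓘(ℝ) ∞ (zeroExtend (F := fun _ => ℝ) f) (U : Set M)}
  mul_mem' {f g} hf hg := (ContMDiffOn.mul hf hg).congr fun x hx => by
    simp [zeroExtend_of_mem _ (show x ∈ U from hx)]
  add_mem' {f g} hf hg := (ContMDiffOn.add hf hg).congr fun x hx => by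
    simp [zeroExtend_of_mem _ (show x ∈ U from hx)]
  neg_mem' {f} hf := (ContMDiffOn.neg hf).congr fun x hx => by
    simp [zeroExtend_of_mem _ (show x ∈ U from hx)]
  one_mem' := (contMDiffOn_const (c := (1 : ℝ))).congr fun x hx => by
    simp [zeroExtend_of_mem _ (show x ∈ U from hx)]
  zero_mem' := (contMDiffOn_const (c := (0 : ℝ))).congr fun x hx => by
    simp [zeroExtend_of_mem _ (show x ∈ U from hx)]

/-- The extension by zero of a smooth function on `U`. -/
def fnExt (f : SmoothFn I U) : M → ℝ := zeroExtend (F := fun _ => ℝ) (f : U → ℝ)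

lemma fnExt_smooth (f : SmoothFn I U) : ContMDiffOn I 𝓘(ℝ) ∞ (fnExt f) (U : Set M) := f.2

lemma fnExt_mdifferentiableAt (f : SmoothFn I U) (y : U) :
    MDifferentiableAt I 𝓘(ℝ) (fnExt f) (y : M) :=
  ((fnExt_smooth f).contMDiffAt (U.isOpen.mem_nhds y.2)).mdifferentiableAt (by simp)

/-- The restriction of a smooth function to `U`. -/
def fnRestrict (f : M → ℝ) (hf : ContMDiffOn I 𝓘(ℝ) ∞ f (U : Set M)) : SmoothFn I U :=
  ⟨fun y => f y, hf.congr fun _ hx => zeroExtend_of_mem _ hx⟩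

lemma fnExt_coe (f : SmoothFn I U) (y : U) : fnExt f y = f.1 y := zeroExtend_coe _ y

@[simp] lemma fnRestrict_apply (f : M → ℝ) (hf : ContMDiffOn I 𝓘(ℝ) ∞ f (U : Set M)) (y : U) :
    (fnRestrict f hf).1 y = f y := rfl

lemma fnExt_eventuallyEq {f : SmoothFn I U} {h : M → ℝ} (hf : ∀ y : U, f.1 y = h y)
    (y : U) : fnExt f =ᶠ[𝓝 (y : M)] h := by
  filter_upwards [U.isOpen.mem_nhds y.2] with x hx
  exact (fnExt_coe f ⟨x, hx⟩).trans (hf ⟨x, hx⟩)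

lemma fnExt_add (f h : SmoothFn I U) : fnExt (f + h) = fnExt f + fnExt h := by
  funext x
  by_cases hx : x ∈ U <;> simp [fnExt, zeroExtend, hx]

lemma fnExt_mul (f h : SmoothFn I U) : fnExt (f * h) = fnExt f * fnExt h := by
  funext x
  by_cases hx : x ∈ U <;> simp [fnExt, zeroExtend, hx]

lemma SmoothFn.ext_iff {f h : SmoothFn I U} : f = h ↔ ∀ y : U, f.1 y = h.1 y :=
  Subtype.ext_iff.trans funext_iff

lemma SmoothFn.add_apply (f h : SmoothFn I U) (y : U) : (f + h).1 y = f.1 y + h.1 y := rfl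

lemma SmoothFn.sub_apply (f h : SmoothFn I U) (y : U) : (f - h).1 y = f.1 y - h.1 y := rfl

lemma SmoothFn.mul_apply (f h : SmoothFn I U) (y : U) : (f * h).1 y = f.1 y * h.1 y := rfl

variable [IsManifold I ∞ M]

variable (I U) in
/-- The module of smooth vector fields on the open set `U`. -/
def SmoothVF : Submodule (SmoothFn I U) (Π y : U, TangentSpace I (y : M)) where
  carrier := {X | SmoothFieldOn I (U : Set M) (zeroExtend (F := fun x : M => TangentSpace I x) X)}
  add_mem' {X Y} hX hY := by
    rw [Set.mem_ofPred_eq] at hX hY ⊢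
    refine (hX.add hY).congr fun x hx => ?_
    simp [zeroExtend_of_mem _ (show x ∈ U from hx)]
  zero_mem' := (contMDiff_zeroSection ℝ (TangentSpace I : M → Type _)).contMDiffOn.congr
    fun x hx => by simp [zeroExtend_of_mem _ (show x ∈ U from hx), zeroSection]
  smul_mem' f X hX := by
    rw [Set.mem_ofPred_eq] at hX ⊢
    refine (hX.smul f.2).congr fun x hx => ?_
    simp [zeroExtend_of_mem _ (show x ∈ U from hx)]
    rfl

/-- The extension by zero of a smooth vector field on `U`. -/
def vfExt (X : SmoothVF I U) : Π x : M, TangentSpace I x :=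
  zeroExtend (F := fun x : M => TangentSpace I x) (X : Π y : U, TangentSpace I (y : M))

lemma vfExt_smooth (X : SmoothVF I U) : SmoothFieldOn I (U : Set M) (vfExt X) := X.2

lemma vfExt_mdifferentiableAt (X : SmoothVF I U) (y : U) :
    MDifferentiableAt I I.tangent (fun x => (⟨x, vfExt X x⟩ : TangentBundle I M)) y :=
  (vfExt_smooth X).mdifferentiableAt U.isOpen y.2

/-- The restriction of a smooth vector field to `U`. -/
def vfRestrict (X : Π x : M, TangentSpace I x) (hX : SmoothFieldOn I (U : Set M) X) :
    SmoothVF I U :=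
  ⟨fun y => X y, hX.congr fun _ hx => zeroExtend_of_mem (F := fun x : M => TangentSpace I x) _ hx⟩

lemma vfExt_coe (X : SmoothVF I U) (y : U) : vfExt X y = X.1 y :=
  zeroExtend_coe (F := fun x : M => TangentSpace I x) _ y

@[simp] lemma vfRestrict_apply (X : Π x : M, TangentSpace I x)
    (hX : SmoothFieldOn I (U : Set M) X) (y : U) : (vfRestrict X hX).1 y = X y := rfl

lemma vfExt_vfRestrict (X : Π x : M, TangentSpace I x) (hX : SmoothFieldOn I (U : Set M) X)
    {x : M} (hx : x ∈ U) : vfExt (vfRestrict X hX) x = X x :=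
  vfExt_coe (vfRestrict X hX) ⟨x, hx⟩

lemma vfExt_eventuallyEq {X : SmoothVF I U} {Y : Π x : M, TangentSpace I x}
    (h : ∀ y : U, X.1 y = Y y) (y : U) : vfExt X =ᶠ[𝓝 (y : M)] Y := by
  filter_upwards [U.isOpen.mem_nhds y.2] with x hx
  exact (vfExt_coe X ⟨x, hx⟩).trans (h ⟨x, hx⟩)

lemma vfExt_add (X Y : SmoothVF I U) : vfExt (X + Y) = vfExt X + vfExt Y := by
  funext x
  by_cases hx : x ∈ U <;> simp [vfExt, zeroExtend, hx]

lemma vfExt_smul (f : SmoothFn I U) (X : SmoothVF I U) : vfExt (f • X) = fnExt f • vfExt X := by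
  funext x
  by_cases hx : x ∈ U
  · simp [vfExt, fnExt, zeroExtend, hx]
    rfl
  · simp [vfExt, fnExt, zeroExtend, hx]

lemma SmoothVF.ext_iff {X Y : SmoothVF I U} : X = Y ↔ ∀ y : U, X.1 y = Y.1 y :=
  Subtype.ext_iff.trans funext_iff

lemma SmoothVF.smul_apply (f : SmoothFn I U) (X : SmoothVF I U) (y : U) :
    (f • X).1 y = f.1 y • X.1 y := rfl

lemma SmoothVF.add_apply (X Y : SmoothVF I U) (y : U) : (X + Y).1 y = X.1 y + Y.1 y := rfl

lemma SmoothVF.sub_apply (X Y : SmoothVF I U) (y : U) : (X - Y).1 y = X.1 y - Y.1 y := rfl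

end LocalCalculus

lemma mvfderiv_congr_of_eventuallyEq {E : Type*} [NormedAddCommGroup E] [NormedSpace ℝ E]
    {H : Type*} [TopologicalSpace H] {I : ModelWithCorners ℝ E H}
    {M : Type*} [TopologicalSpace M] [ChartedSpace H M] {f h : M → ℝ} {x : M}
    (hf : f =ᶠ[𝓝 x] h) : mvfderiv I f x = mvfderiv I h x := by
  simp only [mvfderiv, hf.mfderiv_eq]
  rw [hf.eq_of_nhds]

section Connection

variable {E : Type*} [NormedAddCommGroup E] [NormedSpace ℝ E] [FiniteDimensional ℝ E]
  {H : Type*} [TopologicalSpace H] {I : ModelWithCorners ℝ E H}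
  {M : Type*} [TopologicalSpace M] [ChartedSpace H M] [IsManifold I ∞ M]
  [RiemannianBundle (fun x : M => TangentSpace I x)]
  {cov : CovariantDerivative I E (TangentSpace I : M → Type _)}
  {U : TopologicalSpace.Opens M}

lemma IsLeviCivita.cov_sub (hcov : IsLeviCivita cov) {X Y : Π x : M, TangentSpace I x} {x : M}
    (hX : MDifferentiableAt I I.tangent (fun y => (⟨y, X y⟩ : TangentBundle I M)) x)
    (hY : MDifferentiableAt I I.tangent (fun y => (⟨y, Y y⟩ : TangentBundle I M)) x) :
    cov Y x (X x) - cov X x (Y x) = mlieBracket I X Y x := by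
  have : CompleteSpace E := FiniteDimensional.complete ℝ E
  exact (cov.torsion_eq_zero_iff).1 hcov.torsion_eq_zero hX hY

lemma cov_vfExt_congr {E : Type*} [NormedAddCommGroup E] [NormedSpace ℝ E]
    {H : Type*} [TopologicalSpace H] {I : ModelWithCorners ℝ E H}
    {M : Type*} [TopologicalSpace M] [ChartedSpace H M] [IsManifold I ∞ M]
    (cov : CovariantDerivative I E (TangentSpace I : M → Type _))
    {U : TopologicalSpace.Opens M} {X : SmoothVF I U} {Y : Π x : M, TangentSpace I x}
    (h : ∀ y : U, X.1 y = Y y) (y : U) : cov (vfExt X) y = cov Y y := by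
  refine (vfExt_smooth X).cov_congr ((vfExt_smooth X).congr fun x hx => ?_) U.isOpen
    (fun x hx => ?_) y.2
  · exact ((vfExt_coe X ⟨x, hx⟩).trans (h ⟨x, hx⟩)).symm
  · exact (vfExt_coe X ⟨x, hx⟩).trans (h ⟨x, hx⟩)

variable [T2Space M]

/-- The covariant derivative of smooth fields on `U`. -/
def localNabla (hcov : IsLeviCivita cov) (X Y : SmoothVF I U) : SmoothVF I U :=
  vfRestrict (fun x => cov (vfExt Y) x (vfExt X x))
    ((vfExt_smooth X).cov_apply hcov.smooth (vfExt_smooth Y) U.isOpen)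

lemma localNabla_apply (hcov : IsLeviCivita cov) (X Y : SmoothVF I U) (y : U) :
    (localNabla hcov X Y).1 y = cov (vfExt Y) y (X.1 y) := by
  rw [← vfExt_coe X]; rfl

lemma localNabla_sub_apply (hcov : IsLeviCivita cov) (X Y : SmoothVF I U) (y : U) :
    (localNabla hcov X Y - localNabla hcov Y X).1 y = mlieBracket I (vfExt X) (vfExt Y) y := by
  rw [← hcov.cov_sub (vfExt_mdifferentiableAt X y) (vfExt_mdifferentiableAt Y y)]
  rfl

lemma localNabla_jacobi (hcov : IsLeviCivita cov) (X Y Z : SmoothVF I U) :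
    localNabla hcov X (localNabla hcov Y Z - localNabla hcov Z Y)
        - localNabla hcov (localNabla hcov Y Z - localNabla hcov Z Y) X
      = (localNabla hcov (localNabla hcov X Y - localNabla hcov Y X) Z
          - localNabla hcov Z (localNabla hcov X Y - localNabla hcov Y X))
        + (localNabla hcov Y (localNabla hcov X Z - localNabla hcov Z X)
          - localNabla hcov (localNabla hcov X Z - localNabla hcov Z X) Y) := by
  have : CompleteSpace E := FiniteDimensional.complete ℝ E
  have : IsManifold I (minSmoothness ℝ 3) M :=
    IsManifold.of_le (n := ∞) (by simpa using ENat.LEInfty.out)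
  have hs (X : SmoothVF I U) (y : U) : ContMDiffAt I I.tangent (minSmoothness ℝ 2)
      (fun x => (⟨x, vfExt X x⟩ : TangentBundle I M)) y :=
    ((vfExt_smooth X).contMDiffAt U.isOpen y.2).of_le (by simpa using ENat.LEInfty.out)
  have hb (X Y : SmoothVF I U) (y : U) :
      vfExt (localNabla hcov X Y - localNabla hcov Y X) =ᶠ[𝓝 (y : M)]
        mlieBracket I (vfExt X) (vfExt Y) :=
    vfExt_eventuallyEq (localNabla_sub_apply hcov X Y) y
  rw [SmoothVF.ext_iff]
  intro y
  rw [SmoothVF.add_apply, localNabla_sub_apply, localNabla_sub_apply, localNabla_sub_apply,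
    (Filter.EventuallyEq.refl _ _).mlieBracket_vectorField_eq (hb Y Z y),
    (Filter.EventuallyEq.refl _ _).mlieBracket_vectorField_eq (hb X Z y),
    (hb X Y y).mlieBracket_vectorField_eq (Filter.EventuallyEq.refl _ (vfExt Z))]
  exact leibniz_identity_mlieBracket_apply (hs X y) (hs Y y) (hs Z y)

variable [IsContMDiffRiemannianBundle I ∞ E (fun x : M => TangentSpace I x)]

/-- The calculus of smooth vector fields on the open set `U`. -/
def localCalculus (hcov : IsLeviCivita cov) {Z : Π x : M, TangentSpace I x}
    (hZ : IsSmoothVectorField Z) (hZ1 : ∀ x, ⟪Z x, Z x⟫_ℝ = 1) (U : TopologicalSpace.Opens M) :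
    KoszulCalculus (SmoothFn I U) (SmoothVF I U) where
  D :=
    { toFun := fun X => AddMonoidHom.mk'
        (fun f => fnRestrict (fun x => mvfderiv I (fnExt f) x (vfExt X x))
          ((vfExt_smooth X).mvfderiv_apply hcov.smooth (hZ.smoothFieldOn U) U.isOpen hZ1
            (fnExt_smooth f)))
        (fun f h => SmoothFn.ext_iff.2 fun y => by
          simp [fnExt_add, SmoothFn.add_apply,
            mvfderiv_add (fnExt_mdifferentiableAt f y) (fnExt_mdifferentiableAt h y)])
      map_add' := fun X Y => AddMonoidHom.ext fun f => SmoothFn.ext_iff.2 fun y => by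
        simp [vfExt_add, SmoothFn.add_apply]
      map_smul' := fun h X => AddMonoidHom.ext fun f => SmoothFn.ext_iff.2 fun y => by
        simp [vfExt_smul, SmoothFn.mul_apply, fnExt_coe] }
  nabla :=
    { toFun := fun X => AddMonoidHom.mk' (fun Y => localNabla hcov X Y)
        (fun Y Z => SmoothVF.ext_iff.2 fun y => by
          simp [localNabla_apply, vfExt_add, SmoothVF.add_apply, cov.isCovariantDerivativeOnUniv.add
            (vfExt_mdifferentiableAt Y y) (vfExt_mdifferentiableAt Z y)])
      map_add' := fun X Y => AddMonoidHom.ext fun Z => SmoothVF.ext_iff.2 fun y => by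
        simp [localNabla_apply, SmoothVF.add_apply]
      map_smul' := fun h X => AddMonoidHom.ext fun Z => SmoothVF.ext_iff.2 fun y => by
        simp [localNabla_apply, SmoothVF.smul_apply] }
  g := LinearMap.mk₂ _ (fun X Y => fnRestrict (fun x => ⟪vfExt X x, vfExt Y x⟫_ℝ)
      ((vfExt_smooth X).inner (vfExt_smooth Y)))
    (fun X Y Z => SmoothFn.ext_iff.2 fun y => by
      simp [vfExt_add, SmoothFn.add_apply, inner_add_left])
    (fun f X Y => SmoothFn.ext_iff.2 fun y => by
      simp [vfExt_smul, SmoothFn.mul_apply, inner_smul_left, fnExt_coe])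
    (fun X Y Z => SmoothFn.ext_iff.2 fun y => by
      simp [vfExt_add, SmoothFn.add_apply, inner_add_right])
    (fun f X Y => SmoothFn.ext_iff.2 fun y => by
      simp [vfExt_smul, SmoothFn.mul_apply, inner_smul_right, fnExt_coe])
  D_mul X f h := SmoothFn.ext_iff.2 fun y => by
    simp [fnExt_mul, SmoothFn.mul_apply, SmoothFn.add_apply, fnExt_coe,
      mvfderiv_mul (fnExt_mdifferentiableAt f y) (fnExt_mdifferentiableAt h y)]
  nabla_smul_right X f Y := SmoothVF.ext_iff.2 fun y => by
    simp [localNabla_apply, vfExt_smul, SmoothVF.add_apply, SmoothVF.smul_apply,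
      cov.isCovariantDerivativeOnUniv.leibniz (vfExt_mdifferentiableAt Y y)
      (fnExt_mdifferentiableAt f y), fnExt_coe, vfExt_coe]
  g_comm X Y := SmoothFn.ext_iff.2 fun y => real_inner_comm _ _
  D_g X Y Z := SmoothFn.ext_iff.2 fun y => by
    have h := hcov.metric_compatible (vfExt X) _ _ _ (vfExt_mdifferentiableAt Y y)
      (vfExt_mdifferentiableAt Z y)
    refine Eq.trans ?_ (h.trans ?_)
    · exact congrArg (fun L => L (vfExt X y)) (mvfderiv_congr_of_eventuallyEq
        (fnExt_eventuallyEq (h := metric (vfExt Y) (vfExt Z)) (f := fnRestrict (metric (vfExt Y) (vfExt Z))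
          ((vfExt_smooth Y).inner (vfExt_smooth Z))) (fun z => rfl) y))
    · simp [SmoothFn.add_apply, vfExt_coe, localNabla_apply]
  jacobi' := localNabla_jacobi hcov
  two_cancel f h hfh := SmoothFn.ext_iff.2 fun y => by
    have := SmoothFn.ext_iff.1 hfh y
    have h2 : (2 : SmoothFn I U).1 y = 2 := rfl
    simpa [SmoothFn.mul_apply, h2] using this
  xi := vfRestrict Z (hZ.smoothFieldOn U)
  g_xi_xi := SmoothFn.ext_iff.2 fun y => by
    simpa [vfExt_coe, -inner_self_eq_norm_sq_to_K] using hZ1 y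

end Connection

end

noncomputable section

section Ricci

variable {E : Type*} [NormedAddCommGroup E] [NormedSpace ℝ E] [FiniteDimensional ℝ E]
  {H : Type*} [TopologicalSpace H] {I : ModelWithCorners ℝ E H}
  {M : Type*} [TopologicalSpace M] [ChartedSpace H M] [IsManifold I ∞ M] [T2Space M]
  {cov : CovariantDerivative I E (TangentSpace I : M → Type _)}

lemma curvature_tensorialAt (hcov : CovariantDerivative.ContMDiffCovariantDerivative cov ∞)
    {U : Set M} (hU : IsOpen U) (Y : Π x : M, TangentSpace I x)
    {Z : Π x : M, TangentSpace I x} (hZ : SmoothFieldOn I U Z) {x : M} (hx : x ∈ U) :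
    TensorialAt I E (fun X : Π x : M, TangentSpace I x => curvature cov X Y Z x) x := by
  have : CompleteSpace E := FiniteDimensional.complete ℝ E
  have hcZ := (hZ.contMDiffAt_cov hcov hU hx).mdifferentiableAt (by simp)
  have hd {X : Π x : M, TangentSpace I x}
      (hX : MDifferentiableAt I I.tangent (fun y => (⟨y, X y⟩ : TangentBundle I M)) x) :
      MDifferentiableAt I I.tangent
        (fun y => (⟨y, cov Z y (X y)⟩ : TangentBundle I M)) x :=
    hcZ.clm_bundle_apply hX
  refine ⟨fun {f X} hf hX => ?_, fun {X X'} hX hX' => ?_⟩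
  · have h1 : (fun y => cov Z y ((f • X) y)) = f • fun y => cov Z y (X y) := by
      funext y; simp
    simp only [curvature, h1, cov.isCovariantDerivativeOnUniv.leibniz (hd hX) hf,
      mlieBracket_smul_left hf hX]
    simp
    module
  · have h1 : (fun y => cov Z y ((X + X') y))
        = (fun y => cov Z y (X y)) + fun y => cov Z y (X' y) := by
      funext y; simp
    simp only [curvature, h1, cov.isCovariantDerivativeOnUniv.add (hd hX) (hd hX'),
      mlieBracket_add_left hX hX']
    simp
    abel

/-- The curvature only depends on the germs of its arguments. -/
lemma curvature_congr (hcov : CovariantDerivative.ContMDiffCovariantDerivative cov ∞)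
    {U : Set M} (hU : IsOpen U) {X X' Y Y' Z Z' : Π x : M, TangentSpace I x}
    (hX : SmoothFieldOn I U X) (hY : SmoothFieldOn I U Y) (hZ : SmoothFieldOn I U Z)
    (hXX : ∀ y ∈ U, X y = X' y) (hYY : ∀ y ∈ U, Y y = Y' y) (hZZ : ∀ y ∈ U, Z y = Z' y)
    {x : M} (hx : x ∈ U) : curvature cov X Y Z x = curvature cov X' Y' Z' x := by
  have hX' := hX.congr fun y hy => (hXX y hy).symm
  have hY' := hY.congr fun y hy => (hYY y hy).symm
  have hZ' := hZ.congr fun y hy => (hZZ y hy).symm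
  have h1 (y) (hy : y ∈ U) : cov Z y = cov Z' y := hZ.cov_congr hZ' hU hZZ hy
  have h2 : cov (fun y => cov Z y (Y y)) x = cov (fun y => cov Z' y (Y' y)) x :=
    (hY.cov_apply hcov hZ hU).cov_congr (hY'.cov_apply hcov hZ' hU) hU
      (fun y hy => by rw [h1 y hy, hYY y hy]) hx
  have h3 : cov (fun y => cov Z y (X y)) x = cov (fun y => cov Z' y (X' y)) x :=
    (hX.cov_apply hcov hZ hU).cov_congr (hX'.cov_apply hcov hZ' hU) hU
      (fun y hy => by rw [h1 y hy, hXX y hy]) hx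
  have h4 : mlieBracket I X Y x = mlieBracket I X' Y' x :=
    Filter.EventuallyEq.mlieBracket_vectorField_eq
      (Filter.eventually_of_mem (hU.mem_nhds hx) hXX)
      (Filter.eventually_of_mem (hU.mem_nhds hx) hYY)
  rw [curvature, curvature, h2, h3, h4, h1 x hx, hYY x hx, hXX x hx]

lemma SmoothFn.sum_apply {E : Type*} [NormedAddCommGroup E] [NormedSpace ℝ E]
    {H : Type*} [TopologicalSpace H] {I : ModelWithCorners ℝ E H}
    {M : Type*} [TopologicalSpace M] [ChartedSpace H M] {U : TopologicalSpace.Opens M}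
    {ι : Type*} (s : Finset ι) (f : ι → SmoothFn I U) (y : U) :
    (∑ i ∈ s, f i).1 y = ∑ i ∈ s, (f i).1 y := by
  simp

variable [RiemannianBundle (fun x : M => TangentSpace I x)]

lemma ricci_eq_sum (hcov : CovariantDerivative.ContMDiffCovariantDerivative cov ∞)
    {U : Set M} (hU : IsOpen U) (Y : Π x : M, TangentSpace I x)
    {Z : Π x : M, TangentSpace I x} (hZ : SmoothFieldOn I U Z) {x : M} (hx : x ∈ U)
    {ι : Type*} [Fintype ι]
    {e : ι → Π x : M, TangentSpace I x} (he : ∀ i, SmoothFieldOn I U (e i))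
    (b : OrthonormalBasis ι ℝ (TangentSpace I x)) (hb : ∀ i, b i = e i x) :
    ricci cov Y Z x = ∑ i, ⟪curvature cov (e i) Y Z x, e i x⟫_ℝ := by
  have hT := curvature_tensorialAt hcov hU Y hZ hx
  have h1 := LinearMap.trace_eq_sum_inner (TensorialAt.mkHom _ x hT).toLinearMap b
  have h2 := LinearMap.trace_eq_sum_inner (TensorialAt.mkHom _ x hT).toLinearMap
    (stdOrthonormalBasis ℝ (TangentSpace I x))
  rw [h1] at h2
  refine Eq.trans (Finset.sum_congr rfl fun i _ => ?_) (h2.symm.trans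
    (Finset.sum_congr rfl fun i _ => ?_))
  · exact real_inner_comm _ _
  · rw [real_inner_comm, hb]
    congr 1
    exact TensorialAt.mkHom_apply hT ((he i).mdifferentiableAt hU hx)

/-- The orthonormal basis of the tangent space given by an orthonormal frame. -/
lemma exists_orthonormalBasis_of_frame
    {E : Type*} [NormedAddCommGroup E] [NormedSpace ℝ E] [FiniteDimensional ℝ E]
    {H : Type*} [TopologicalSpace H] {I : ModelWithCorners ℝ E H}
    {M : Type*} [TopologicalSpace M] [ChartedSpace H M]
    [RiemannianBundle (fun x : M => TangentSpace I x)] {x : M}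
    {e : Fin (Module.finrank ℝ E) → Π x : M, TangentSpace I x}
    (he : Orthonormal ℝ (fun i => e i x)) :
    ∃ b : OrthonormalBasis (Fin (Module.finrank ℝ E)) ℝ (TangentSpace I x), ∀ i, b i = e i x := by
  have hc : Fintype.card (Fin (Module.finrank ℝ E)) = Module.finrank ℝ (TangentSpace I x) := by
    rw [Fintype.card_fin]; rfl
  refine ⟨OrthonormalBasis.mk he ?_, fun i => congrFun (OrthonormalBasis.coe_mk he _) i⟩
  rw [he.linearIndependent.span_eq_top_of_card_eq_finrank' hc]

variable [IsContMDiffRiemannianBundle I ∞ E (fun x : M => TangentSpace I x)]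

section Local

variable (hcov : IsLeviCivita cov) {ξ : Π x : M, TangentSpace I x}
  (hξ : IsSmoothVectorField ξ) (hξ1 : ∀ x, ⟪ξ x, ξ x⟫_ℝ = 1) {U : TopologicalSpace.Opens M}

lemma localCalculus_g_apply (X Y : SmoothVF I U) (y : U) :
    ((localCalculus hcov hξ hξ1 U).g X Y).1 y = ⟪X.1 y, Y.1 y⟫_ℝ := by
  rw [← vfExt_coe X, ← vfExt_coe Y]; rfl

lemma localCalculus_D_apply (X : SmoothVF I U) (f : SmoothFn I U) (y : U) :
    ((localCalculus hcov hξ hξ1 U).D X f).1 y = mvfderiv I (fnExt f) y (X.1 y) := by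
  rw [← vfExt_coe X]; rfl

lemma localCalculus_nabla_apply (X Y : SmoothVF I U) (y : U) :
    ((localCalculus hcov hξ hξ1 U).nabla X Y).1 y = cov (vfExt Y) y (X.1 y) :=
  localNabla_apply hcov X Y y

lemma localCalculus_br_apply (X Y : SmoothVF I U) (y : U) :
    ((localCalculus hcov hξ hξ1 U).br X Y).1 y = mlieBracket I (vfExt X) (vfExt Y) y :=
  localNabla_sub_apply hcov X Y y

lemma localCalculus_R_apply (X Y Z : SmoothVF I U) (y : U) :
    ((localCalculus hcov hξ hξ1 U).R X Y Z).1 y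
      = curvature cov (vfExt X) (vfExt Y) (vfExt Z) y := by
  have h (X : SmoothVF I U) :
      cov (vfExt ((localCalculus hcov hξ hξ1 U).nabla X Z)) y
        = cov (fun z => cov (vfExt Z) z (vfExt X z)) y :=
    cov_vfExt_congr cov (fun z => rfl) y
  simp only [KoszulCalculus.R, SmoothVF.sub_apply, localCalculus_nabla_apply,
    localCalculus_br_apply, h, curvature, vfExt_coe]

variable {e : Fin (Module.finrank ℝ E) → Π x : M, TangentSpace I x}
  (he : ∀ i, SmoothFieldOn I (U : Set M) (e i))

lemma localCalculus_isOrthonormalFrame (ho : ∀ y ∈ U, Orthonormal ℝ (fun i => e i y)) :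
    (localCalculus hcov hξ hξ1 U).IsOrthonormalFrame (fun i => vfRestrict (e i) (he i)) where
  expand X := SmoothVF.ext_iff.2 fun y => by
    obtain ⟨b, hb⟩ := exists_orthonormalBasis_of_frame (ho y y.2)
    have h1 : (∑ i, (localCalculus hcov hξ hξ1 U).g X (vfRestrict (e i) (he i)) •
        vfRestrict (e i) (he i)).1 y = ∑ i, ⟪X.1 y, e i y⟫_ℝ • e i y := by
      rw [Submodule.coe_sum, Finset.sum_apply]
      refine Finset.sum_congr rfl fun i _ => ?_
      rw [SmoothVF.smul_apply, localCalculus_g_apply]; rfl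
    rw [h1, ← b.sum_repr' (X.1 y)]
    refine Finset.sum_congr rfl fun i _ => ?_
    rw [hb, b.sum_repr', real_inner_comm]
  orthonormal i j := SmoothFn.ext_iff.2 fun y => by
    rw [localCalculus_g_apply]
    have := orthonormal_iff_ite.1 (ho y y.2) i j
    simp only [vfRestrict_apply, this]
    split_ifs <;> rfl

lemma localCalculus_ric_restrict (ho : ∀ y ∈ U, Orthonormal ℝ (fun i => e i y))
    {Y Z : Π x : M, TangentSpace I x} (hY : SmoothFieldOn I (U : Set M) Y)
    (hZ : SmoothFieldOn I (U : Set M) Z) (y : U) :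
    ((localCalculus hcov hξ hξ1 U).ric (fun i => vfRestrict (e i) (he i)) (vfRestrict Y hY)
      (vfRestrict Z hZ)).1 y = ricci cov Y Z y := by
  obtain ⟨b, hb⟩ := exists_orthonormalBasis_of_frame (ho y y.2)
  rw [ricci_eq_sum hcov.smooth U.isOpen Y hZ y.2 he b hb, KoszulCalculus.ric, SmoothFn.sum_apply]
  refine Finset.sum_congr rfl fun i _ => ?_
  rw [localCalculus_g_apply, localCalculus_R_apply, vfRestrict_apply,
    curvature_congr hcov.smooth U.isOpen (he i) hY hZ (fun z hz => (vfExt_vfRestrict _ _ hz).symm)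
      (fun z hz => (vfExt_vfRestrict _ _ hz).symm) (fun z hz => (vfExt_vfRestrict _ _ hz).symm)
      y.2]

lemma ricci_eq_sum_frame (hcov : IsLeviCivita cov) (hξ : IsSmoothVectorField ξ)
    (hξ1 : ∀ x, ⟪ξ x, ξ x⟫_ℝ = 1) (he : ∀ i, SmoothFieldOn I (U : Set M) (e i))
    (ho : ∀ y ∈ U, Orthonormal ℝ (fun i => e i y))
    {Y Z : Π x : M, TangentSpace I x} (hY : SmoothFieldOn I (U : Set M) Y)
    (hZ : SmoothFieldOn I (U : Set M) Z) (y : U) :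
    ricci cov Y Z y
      = ∑ i, ∑ j, ⟪Y y, e i y⟫_ℝ * (⟪Z y, e j y⟫_ℝ * ricci cov (e i) (e j) y) := by
  have hf := localCalculus_isOrthonormalFrame hcov hξ hξ1 he ho
  have h1 := hf.sum_apply (((localCalculus hcov hξ hξ1 U).ricLin
    (fun i => vfRestrict (e i) (he i))).flip (vfRestrict Z hZ)) (vfRestrict Y hY)
  have h2 (i) := hf.sum_apply ((localCalculus hcov hξ hξ1 U).ricLin
    (fun i => vfRestrict (e i) (he i)) (vfRestrict (e i) (he i))) (vfRestrict Z hZ)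
  simp only [LinearMap.flip_apply, ← KoszulCalculus.ric_eq_ricLin] at h1 h2
  simp only [← h2] at h1
  have h3 := SmoothFn.ext_iff.1 h1 y
  rw [localCalculus_ric_restrict hcov hξ hξ1 he ho] at h3
  rw [← h3]
  simp only [SmoothFn.sum_apply, SmoothFn.mul_apply, localCalculus_g_apply,
    localCalculus_ric_restrict hcov hξ hξ1 he ho, Finset.mul_sum, vfRestrict_apply]

lemma localCalculus_scal_apply (ho : ∀ y ∈ U, Orthonormal ℝ (fun i => e i y)) (y : U) :
    ((localCalculus hcov hξ hξ1 U).scal (fun i => vfRestrict (e i) (he i))).1 y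
      = scalarCurvature cov (y : M) := by
  let b := stdOrthonormalBasis ℝ (TangentSpace I (y : M))
  choose s hs hsm using fun i => FiberBundle.exists_contMDiffOn_extend (k := ∞) I E (b i)
  have hW : (U : Set M) ∩ ⋂ i, interior (s i) ∈ 𝓝 (y : M) :=
    Filter.inter_mem (U.isOpen.mem_nhds y.2)
      (Filter.iInter_mem.2 fun i => interior_mem_nhds.2 (hs i))
  let W : TopologicalSpace.Opens M := ⟨(U : Set M) ∩ ⋂ i, interior (s i),
    U.isOpen.inter (isOpen_iInter_of_finite fun i => isOpen_interior)⟩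
  have hWU : (W : Set M) ⊆ U := Set.inter_subset_left
  have hext (i) : SmoothFieldOn I (W : Set M) (FiberBundle.extend E (b i)) :=
    ContMDiffOn.mono (hsm i) fun z hz => interior_subset (Set.mem_iInter.1 hz.2 i)
  have h (i) := ricci_eq_sum_frame hcov hξ hξ1 (U := W) (fun j => (he j).mono hWU)
    (fun z hz => ho z (hWU hz)) (hext i) (hext i) ⟨y, mem_of_mem_nhds hW⟩
  rw [scalarCurvature]
  simp only [b] at h
  simp only [h]
  rw [KoszulCalculus.scal, SmoothFn.sum_apply]
  simp only [localCalculus_ric_restrict hcov hξ hξ1 he ho, FiberBundle.extend_apply_self]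
  rw [Finset.sum_comm]
  refine Finset.sum_congr rfl fun j _ => ?_
  rw [Finset.sum_comm]
  have hk (k) : ∑ i, ⟪b i, e j y⟫_ℝ * (⟪b i, e k y⟫_ℝ * ricci cov (e j) (e k) y)
      = (if j = k then 1 else 0) * ricci cov (e j) (e k) y := by
    rw [← orthonormal_iff_ite.1 (ho y y.2) j k, ← b.sum_inner_mul_inner, Finset.sum_mul]
    refine Finset.sum_congr rfl fun i _ => ?_
    rw [real_inner_comm (b i) (e j y)]
    ring
  simp only [b] at hk
  simp [hk]

end Local

end Ricci

end

noncomputable section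

section Soliton

variable {E : Type*} [NormedAddCommGroup E] [NormedSpace ℝ E]
  {H : Type*} [TopologicalSpace H] {I : ModelWithCorners ℝ E H}
  {M : Type*} [TopologicalSpace M] [ChartedSpace H M] [IsManifold I ∞ M]
  [RiemannianBundle (fun x : M => TangentSpace I x)]

namespace AlmostContactMetricStructure

lemma inner_xi_xi (A : AlmostContactMetricStructure I M) (x : M) : ⟪A.xi x, A.xi x⟫_ℝ = 1 := by
  rw [← A.eta_eq, A.eta_xi]

lemma phi_xi (A : AlmostContactMetricStructure I M) (x : M) : A.phi x (A.xi x) = 0 := by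
  rw [← inner_self_eq_zero (𝕜 := ℝ), A.metric_phi, A.eta_xi, A.inner_xi_xi]
  norm_num

lemma eta_phi (A : AlmostContactMetricStructure I M) (x : M) (v : TangentSpace I x) :
    A.eta x (A.phi x v) = 0 := by
  have h1 := congrArg (A.phi x) (A.phi_sq x v)
  rw [A.phi_sq x (A.phi x v), map_add, map_neg, map_smul, A.phi_xi, smul_zero, add_right_inj] at h1
  simpa [A.eta_xi] using congrArg (A.eta x) h1

variable [FiniteDimensional ℝ E] {cov : CovariantDerivative I E (TangentSpace I : M → Type _)}
  {A : AlmostContactMetricStructure I M}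

/-- On a Kenmotsu manifold, `∇_X ξ = X - η(X) ξ`. -/
lemma IsKenmotsu.cov_xi [T2Space M] (hA : A.IsKenmotsu cov) (hcov : IsLeviCivita cov) (x : M)
    (v : TangentSpace I x) : cov A.xi x v = v - ⟪v, A.xi x⟫_ℝ • A.xi x := by
  obtain ⟨s, hs, hsm⟩ := FiberBundle.exists_contMDiffOn_extend (k := ∞) I E v
  have hext : SmoothFieldOn I (interior s) (FiberBundle.extend E v) :=
    ContMDiffOn.mono hsm interior_subset
  obtain ⟨X, hX, hXv⟩ := hext.exists_global isOpen_interior (mem_interior_iff_mem_nhds.2 hs)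
  have hv : X x = v := by rw [hXv.self_of_nhds, FiberBundle.extend_apply_self]
  have h := hA X A.xi hX A.xi_smooth x
  have h0 : (fun y => A.phi y (A.xi y)) = 0 := funext fun y => A.phi_xi y
  rw [h0, cov.zero, hv, ← A.eta_eq, A.eta_phi, A.eta_xi] at h
  have h' : A.phi x (cov A.xi x v) = A.phi x v := by simpa using h
  have hd := A.xi_smooth.smoothFieldOn Set.univ |>.mdifferentiableAt isOpen_univ (Set.mem_univ x)
  have hm := hcov.metric_compatible X A.xi A.xi x hd hd
  have h1 : metric A.xi A.xi = fun _ : M => (1 : ℝ) := funext fun y => A.inner_xi_xi y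
  rw [dirDeriv, h1, mvfderiv_const, hv, real_inner_comm] at hm
  have hη : A.eta x (cov A.xi x v) = 0 := by
    rw [A.eta_eq, real_inner_comm]
    simp at hm
    linarith
  have h2 := congrArg (A.phi x) h'
  rw [A.phi_sq, A.phi_sq, hη, zero_smul, add_zero, A.eta_eq] at h2
  rw [← neg_inj, h2]
  abel

end AlmostContactMetricStructure

variable [FiniteDimensional ℝ E] {cov : CovariantDerivative I E (TangentSpace I : M → Type _)}
  {A : AlmostContactMetricStructure I M} [T2Space M]
  [IsContMDiffRiemannianBundle I ∞ E (fun x : M => TangentSpace I x)]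

lemma localCalculus_D_const {ξ : Π x : M, TangentSpace I x} (hcov : IsLeviCivita cov)
    (hξ : IsSmoothVectorField ξ) (hξ1 : ∀ x, ⟪ξ x, ξ x⟫_ℝ = 1) {U : TopologicalSpace.Opens M}
    (X : SmoothVF I U) (c : ℝ) :
    (localCalculus hcov hξ hξ1 U).D X (fnRestrict (fun _ => c) contMDiffOn_const) = 0 :=
  SmoothFn.ext_iff.2 fun y => by
    rw [localCalculus_D_apply, mvfderiv_congr_of_eventuallyEq
      (fnExt_eventuallyEq (h := fun _ => c) (fun z => rfl) y), mvfderiv_const]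
    rfl

lemma localCalculus_lieMetric_apply {ξ : Π x : M, TangentSpace I x} (hcov : IsLeviCivita cov)
    (hξ : IsSmoothVectorField ξ) (hξ1 : ∀ x, ⟪ξ x, ξ x⟫_ℝ = 1) {U : TopologicalSpace.Opens M}
    {V : Π x : M, TangentSpace I x} (hV : SmoothFieldOn I (U : Set M) V) (X Y : SmoothVF I U)
    {X' Y' : Π x : M, TangentSpace I x} (y : U) (hX : vfExt X =ᶠ[𝓝 (y : M)] X')
    (hY : vfExt Y =ᶠ[𝓝 (y : M)] Y') :
    ((localCalculus hcov hξ hξ1 U).lieMetric (vfRestrict V hV) X Y).1 y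
      = lieDerivative₂ V metric X' Y' y := by
  have hVe : vfExt (vfRestrict V hV) =ᶠ[𝓝 (y : M)] V := vfExt_eventuallyEq (fun z => rfl) y
  have h1 : fnExt ((localCalculus hcov hξ hξ1 U).g X Y) =ᶠ[𝓝 (y : M)] metric X' Y' := by
    filter_upwards [fnExt_eventuallyEq (f := (localCalculus hcov hξ hξ1 U).g X Y)
      (h := metric (vfExt X) (vfExt Y)) (fun z => rfl) y, hX, hY] with z hz hzX hzY
    rw [hz, metric, metric, hzX, hzY]
  have h2 := hVe.mlieBracket_vectorField_eq hX
  have h3 := hVe.mlieBracket_vectorField_eq hY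
  have h4 : X.1 y = X' y := (vfExt_coe X y).symm.trans hX.self_of_nhds
  have h5 : Y.1 y = Y' y := (vfExt_coe Y y).symm.trans hY.self_of_nhds
  rw [lieDerivative₂, dirDeriv, metric, metric, ← h2, ← h3, ← h4, ← h5,
    ← mvfderiv_congr_of_eventuallyEq h1, ← localCalculus_br_apply hcov hξ hξ1,
    ← localCalculus_br_apply hcov hξ hξ1, ← localCalculus_g_apply hcov hξ hξ1,
    ← localCalculus_g_apply hcov hξ hξ1]
  have h6 := localCalculus_D_apply hcov hξ hξ1 (vfRestrict V hV)
    ((localCalculus hcov hξ hξ1 U).g X Y) y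
  rw [vfRestrict_apply] at h6
  rw [← h6]
  rfl

lemma smoothFieldOn_mlieBracket {ξ : Π x : M, TangentSpace I x} (hcov : IsLeviCivita cov)
    (hξ : IsSmoothVectorField ξ) (hξ1 : ∀ x, ⟪ξ x, ξ x⟫_ℝ = 1) {U : TopologicalSpace.Opens M}
    {X Y : Π x : M, TangentSpace I x} (hX : SmoothFieldOn I (U : Set M) X)
    (hY : SmoothFieldOn I (U : Set M) Y) :
    ∃ h : SmoothFieldOn I (U : Set M) (mlieBracket I X Y),
      (localCalculus hcov hξ hξ1 U).br (vfRestrict X hX) (vfRestrict Y hY)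
        = vfRestrict (mlieBracket I X Y) h := by
  have hbr (y : U) : ((localCalculus hcov hξ hξ1 U).br (vfRestrict X hX) (vfRestrict Y hY)).1 y
      = mlieBracket I X Y y := by
    rw [localCalculus_br_apply]
    exact (vfExt_eventuallyEq (fun z => rfl) y).mlieBracket_vectorField_eq
      (vfExt_eventuallyEq (fun z => rfl) y)
  refine ⟨(vfExt_smooth _).congr fun y hy => ((vfExt_coe _ ⟨y, hy⟩).trans (hbr ⟨y, hy⟩)).symm, ?_⟩
  exact SmoothVF.ext_iff.2 hbr

/-- The Lie derivative of the Ricci tensor along the potential field of a conformal `η`-Ricci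
soliton on a Kenmotsu manifold of dimension `m + 1`. -/
theorem lieDerivative_ricci_xi (hcov : IsLeviCivita cov) (hA : A.IsKenmotsu cov)
    {V : Π x : M, TangentSpace I x} {lam mu p : ℝ}
    (hsol : A.IsConformalEtaRicciSoliton cov V lam mu p) {m : ℕ}
    (hm : Module.finrank ℝ E = m + 1) {Y : Π x : M, TangentSpace I x}
    (hY : IsSmoothVectorField Y) (x : M) :
    lieDerivative₂ V (ricci cov) Y A.xi x
      = -2 * (scalarCurvature cov x + (m : ℝ) * ((m : ℝ) + 1)) * A.eta x (Y x)
        - dirDeriv Y (scalarCurvature cov) x := by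
  obtain ⟨U₀, e, hU₀, hx, he, ho⟩ := SmoothFieldOn.exists_orthonormal_frame (I := I) x
  let U : TopologicalSpace.Opens M := ⟨U₀, hU₀⟩
  have hξ := A.xi_smooth
  have hξ1 := A.inner_xi_xi
  let K := localCalculus hcov hξ hξ1 U
  have hf : K.IsOrthonormalFrame (fun i => vfRestrict (e i) (he i)) :=
    localCalculus_isOrthonormalFrame hcov hξ hξ1 he ho
  have hxi (X : SmoothVF I U) : K.nabla X K.xi = X - K.g X K.xi • K.xi :=
    SmoothVF.ext_iff.2 fun y => by
      rw [SmoothVF.sub_apply, SmoothVF.smul_apply, localCalculus_nabla_apply,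
        localCalculus_g_apply, cov_vfExt_congr cov (Y := A.xi) (fun z => rfl) y]
      exact hA.cov_xi hcov y _
  have hcard : (Fintype.card (Fin (Module.finrank ℝ E)) : SmoothFn I U) = (m : SmoothFn I U) + 1 := by
    rw [Fintype.card_fin, hm]; push_cast; rfl
  have hV := hsol.smooth.smoothFieldOn (U : Set M)
  have hYU := hY.smoothFieldOn (U : Set M)
  have hric (X Y : SmoothVF I U) (y : U) :
      (K.ric (fun i => vfRestrict (e i) (he i)) X Y).1 y = ricci cov (vfExt X) (vfExt Y) y := by
    have hr (X : SmoothVF I U) : vfRestrict (vfExt X) (vfExt_smooth X) = X :=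
      SmoothVF.ext_iff.2 fun z => vfExt_coe X z
    rw [← localCalculus_ric_restrict hcov hξ hξ1 he ho (vfExt_smooth X) (vfExt_smooth Y), hr, hr]
  have hsolK (X Y : SmoothVF I U) : K.lieMetric (vfRestrict V hV) X Y
      + 2 * K.ric (fun i => vfRestrict (e i) (he i)) X Y
      + fnRestrict (fun _ => 2 * lam - (p + 2 / (Module.finrank ℝ E : ℝ))) contMDiffOn_const
        * K.g X Y
      + 2 * fnRestrict (fun _ => mu) contMDiffOn_const * (K.g X K.xi * K.g Y K.xi) = 0 :=
    SmoothFn.ext_iff.2 fun y => by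
      obtain ⟨X', hX', hXX⟩ := (vfExt_smooth X).exists_global U.isOpen y.2
      obtain ⟨Y', hY', hYY⟩ := (vfExt_smooth Y).exists_global U.isOpen y.2
      have h := hsol.equation X' Y' hX' hY' y
      have hXy : X.1 y = X' y := (vfExt_coe X y).symm.trans hXX.self_of_nhds.symm
      have hYy : Y.1 y = Y' y := (vfExt_coe Y y).symm.trans hYY.self_of_nhds.symm
      have h1 := localCalculus_lieMetric_apply hcov hξ hξ1 hV X Y y
        (Filter.EventuallyEq.symm hXX) (Filter.EventuallyEq.symm hYY)
      have h2 : ricci cov (vfExt X) (vfExt Y) y = ricci cov X' Y' y := by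
        rw [ricci_eq_sum_frame hcov hξ hξ1 (U := U) he ho (vfExt_smooth X) (vfExt_smooth Y) y,
          ricci_eq_sum_frame hcov hξ hξ1 (U := U) he ho (hX'.smoothFieldOn U)
            (hY'.smoothFieldOn U) y, hXX.self_of_nhds, hYY.self_of_nhds]
      have h3 : (2 : SmoothFn I U).1 y = 2 := rfl
      have h4 : K.xi.1 y = A.xi y := rfl
      simp only [SmoothFn.add_apply, SmoothFn.mul_apply, fnRestrict_apply, hric, h3]
      rw [h1, h2, localCalculus_g_apply, localCalculus_g_apply, localCalculus_g_apply, hXy, hYy,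
        h4, ← A.eta_eq, ← A.eta_eq]
      exact h
  have key := KoszulCalculus.lie_ric_xi hxi hf hcard
    (fun X => localCalculus_D_const hcov hξ hξ1 X _)
    (fun X => localCalculus_D_const hcov hξ hξ1 X _) hsolK (vfRestrict Y hYU)
  have keyx := SmoothFn.ext_iff.1 key ⟨x, hx⟩
  obtain ⟨hVY, hbY⟩ := smoothFieldOn_mlieBracket hcov hξ hξ1 hV hYU
  obtain ⟨hVξ, hbξ⟩ := smoothFieldOn_mlieBracket hcov hξ hξ1 hV (hξ.smoothFieldOn (U : Set M))
  have hKxi : K.xi = vfRestrict A.xi (hξ.smoothFieldOn (U : Set M)) := rfl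
  have hr {X Z : Π x : M, TangentSpace I x} (hX : SmoothFieldOn I (U : Set M) X)
      (hZ : SmoothFieldOn I (U : Set M) Z) (y : U) :=
    localCalculus_ric_restrict hcov hξ hξ1 (U := U) he ho hX hZ y
  have hdr : fnExt (K.ric (fun i => vfRestrict (e i) (he i)) (vfRestrict Y hYU)
      (vfRestrict A.xi (hξ.smoothFieldOn (U : Set M)))) =ᶠ[𝓝 x] ricci cov Y A.xi :=
    fnExt_eventuallyEq (fun z => hr _ _ z) ⟨x, hx⟩
  have hds : fnExt (K.scal (fun i => vfRestrict (e i) (he i))) =ᶠ[𝓝 x] scalarCurvature cov :=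
    fnExt_eventuallyEq (fun z => localCalculus_scal_apply hcov hξ hξ1 he ho z) ⟨x, hx⟩
  have h2 : (-2 : SmoothFn I U).1 ⟨x, hx⟩ = -2 := rfl
  have h1 : (1 : SmoothFn I U).1 ⟨x, hx⟩ = 1 := rfl
  have hmx : (m : SmoothFn I U).1 ⟨x, hx⟩ = m := rfl
  rw [hKxi, hbY, hbξ] at keyx
  simp only [SmoothFn.sub_apply, SmoothFn.mul_apply, SmoothFn.add_apply] at keyx
  rw [hr, hr, localCalculus_D_apply, localCalculus_D_apply, localCalculus_g_apply,
    localCalculus_scal_apply hcov hξ hξ1 he ho, mvfderiv_congr_of_eventuallyEq hdr,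
    mvfderiv_congr_of_eventuallyEq hds, h1, h2, hmx] at keyx
  simp only [vfRestrict_apply] at keyx
  rw [← A.eta_eq] at keyx
  exact keyx

end Soliton

end

theorem lie_derivative_ricci_xi_eq_scalar_of_conformal_eta_ricci_soliton
    (n : ℕ) {M : Type*} [TopologicalSpace M] [T2Space M]
    [ChartedSpace (EuclideanSpace ℝ (Fin (2 * n + 1))) M] [IsManifold (𝓡 (2 * n + 1)) ∞ M]
    [RiemannianBundle (fun x : M => TangentSpace (𝓡 (2 * n + 1)) x)]
    [IsContMDiffRiemannianBundle (𝓡 (2 * n + 1)) ∞ (EuclideanSpace ℝ (Fin (2 * n + 1)))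
      (fun x : M => TangentSpace (𝓡 (2 * n + 1)) x)]
    (cov : CovariantDerivative (𝓡 (2 * n + 1)) (EuclideanSpace ℝ (Fin (2 * n + 1)))
      (TangentSpace (𝓡 (2 * n + 1)) : M → Type _))
    (hcov : IsLeviCivita cov)
    (A : AlmostContactMetricStructure (𝓡 (2 * n + 1)) M)
    (hA : A.IsKenmotsu cov)
    (V : Π x : M, TangentSpace (𝓡 (2 * n + 1)) x) (lam mu p : ℝ)
    (hsol : A.IsConformalEtaRicciSoliton cov V lam mu p)
    (Y : Π x : M, TangentSpace (𝓡 (2 * n + 1)) x) (hY : IsSmoothVectorField Y) (x : M) :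
    lieDerivative₂ V (ricci cov) Y A.xi x
      = -2 * (scalarCurvature cov x + 2 * (n : ℝ) * (2 * (n : ℝ) + 1)) * A.eta x (Y x)
        - dirDeriv Y (scalarCurvature cov) x := by
  have h := lieDerivative_ricci_xi hcov hA hsol (m := 2 * n) (by simp) hY x
  push_cast at h
  exact h
end
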